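/- Trapping of admissible states (Theorem III). Let (m, Ψ, Ω, c, Ũ) be an admissible steady rotating vortex patch with Σ = ∂Ũ. Then there exist 1 ≤ R⋆ < ∞, constants 0 < C, C₁ < ∞ with C₁ ≤ R⋆, and a bounded open set U ⊇ Σ such that for every R ≥ R⋆ there exist a bounded open set W_R ⊆ B(0, C₁) and a continuously differentiable Ψ_R : closure(B(0,R)) → ℝ whose gradient is uniformly α-Hölder continuous for every α ∈ (0,1) such that, setting ω_R = 1_{W_R}: (1) for almost every x ∈ B(0,R), ∇Ψ_R(x) = −Ωx − ∫_{B(0,R)} K_R(x,y)^⊥ ω_R(y) dy, where K_R(x,y) = (1/2π)(x−y)^⊥/‖x−y‖² + (1/2π)(R²y − ‖y‖²x)^⊥/(R⁴ − 2R² x·y + ‖x‖²‖y‖²) and v^⊥ = (−v₂, v₁); for every f : ℝ² → ℝ continuously differentiable on a neighborhood of closure(B(0,R)), ∫_{B(0,R)} ω_R ∇⊥Ψ_R·∇f = 0; and ∇⊥Ψ_R(x)·x = 0 for every x with ‖x‖ = R (so (Ω, Ψ_R, ω_R) is a steady rotating weak solution of the Euler equations in the disk B(0,R)); (2) ∂W_R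 = {x ∈ U : Ψ_R(x) = 0}; (3) ∫_{B(0,R)}|ω_R − 1_{Ũ}| + sup_{B(0,R)}‖∇(Ψ_R − Ψ)‖ ≤ C log(R)/R²; (4) Ψ_R and ω_R have m-fold dihedral symmetry. -/

import Mathlib

open MeasureTheory Real Filter Topology Metric
open scoped RealInnerProductSpace

noncomputable section

/-- The Euclidean plane. -/
abbrev Pt := EuclideanSpace ℝ (Fin 2)

/-- The point of the plane with the given coordinates. -/
def pt (a b : ℝ) : Pt := (WithLp.equiv 2 (Fin 2 → ℝ)).symm ![a, b]

/-- Counterclockwise rotation of a vector by `π/2`, i.e. `v ↦ v^⊥ = (-v₂, v₁)`. -/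
def perp (v : Pt) : Pt := pt (-(v 1)) (v 0)

/-- Reflection `(x₁, x₂) ↦ (x₁, -x₂)`. -/
def reflPt (x : Pt) : Pt := pt (x 0) (-(x 1))

/-- Counterclockwise rotation of the plane by angle `θ`. -/
def rotPt (θ : ℝ) (x : Pt) : Pt :=
  pt (Real.cos θ * x 0 - Real.sin θ * x 1) (Real.sin θ * x 0 + Real.cos θ * x 1)

/-- A set `E ⊆ ℝ²` has `m`-fold dihedral symmetry:
`x ∈ E ↔ (x₁,-x₂) ∈ E ↔ R(2π/m) x ∈ E`. -/
def DihedralSymSet (m : ℕ) (E : Set Pt) : Prop :=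
  ∀ x : Pt, (x ∈ E ↔ reflPt x ∈ E) ∧ (x ∈ E ↔ rotPt (2 * π / m) x ∈ E)

/-- A function on `ℝ²` has `m`-fold dihedral symmetry:
`f x = f (x₁,-x₂) = f (R(2π/m) x)`. -/
def DihedralSymFun (m : ℕ) (f : Pt → ℝ) : Prop :=
  ∀ x : Pt, f x = f (reflPt x) ∧ f x = f (rotPt (2 * π / m) x)

/-- An admissible steady rotating vortex patch `(m, Ψ, Ω, c, Ũ)`. -/
structure AdmissiblePatch (m : ℕ) (Ψ : Pt → ℝ) (Ω c : ℝ) (Upatch : Set Pt) : Prop where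
  m_pos : 1 ≤ m
  nonempty : Upatch.Nonempty
  isOpen : IsOpen Upatch
  bounded : Bornology.IsBounded Upatch
  simplyConn : SimplyConnectedSpace Upatch
  contDiff : ContDiff ℝ 1 Ψ
  gradLip : ∃ K : NNReal, LipschitzWith K (fun x => gradient Ψ x)
  symSet : DihedralSymSet m Upatch
  symFun : DihedralSymFun m Ψ
  level : ∃ V : Set Pt, IsOpen V ∧ frontier Upatch ⊆ V ∧
      frontier Upatch = {x ∈ V | Ψ x = 0} ∧
      (∀ x ∈ V ∩ Upatch, Ψ x < 0) ∧ (∀ x ∈ V \ closure Upatch, 0 < Ψ x)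
  gradNeZero : ∀ x ∈ frontier Upatch, gradient Ψ x ≠ 0
  potential : ∀ x : Pt,
      Ψ x = (1 / (2 * π)) * (∫ y in Upatch, Real.log ‖x - y‖) - Ω * ‖x‖ ^ 2 / 2 - c
  nondeg : ∀ φ : Pt → ℝ, ContinuousOn φ (frontier Upatch) →
      (∀ x ∈ frontier Upatch, φ x = φ (reflPt x) ∧ φ x = φ (rotPt (2 * π / m) x)) →
      (∀ x ∈ frontier Upatch,
        φ x + ∫ y in frontier Upatch,
          (1 / (2 * π)) * Real.log ‖x - y‖ * (φ y / ‖gradient Ψ y‖) ∂μH[1] = 0) →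
      ∀ x ∈ frontier Upatch, φ x = 0


namespace Trap

/-! ### Scalar and vector inequalities -/

lemma abs_log_sub_le {a b : ℝ} (ha : 0 < a) (hb : 0 < b) :
    |log a - log b| ≤ |a - b| * (a⁻¹ + b⁻¹) := by
  have key : ∀ {a b : ℝ}, 0 < a → 0 < b → log a - log b ≤ |a - b| * (a⁻¹ + b⁻¹) := by
    intro a b ha hb
    rw [← Real.log_div ha.ne' hb.ne']
    have h1 : log (a / b) ≤ a / b - 1 := Real.log_le_sub_one_of_pos (by positivity)
    have h2 : a / b - 1 = (a - b) * b⁻¹ := by field_simp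
    have h3 : (a - b) * b⁻¹ ≤ |a - b| * b⁻¹ := by gcongr; exact le_abs_self _
    have h4 : 0 ≤ |a - b| * a⁻¹ := by positivity
    linarith [mul_add |a - b| a⁻¹ b⁻¹]
  rw [abs_le]
  constructor
  · have := key hb ha
    rw [abs_sub_comm, add_comm] at this
    linarith
  · exact key ha hb

lemma abs_log_sub_le_sqrt {a b : ℝ} (ha : 0 < a) (hb : 0 < b) :
    |log a - log b| ≤ 2 * √|a - b| * ((√a)⁻¹ + (√b)⁻¹) := by
  have h := abs_log_sub_le (Real.sqrt_pos.2 ha) (Real.sqrt_pos.2 hb)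
  rw [Real.log_sqrt ha.le, Real.log_sqrt hb.le] at h
  have h1 : |√a - √b| ≤ √|a - b| := by
    apply Real.abs_le_sqrt
    have h2 : |a - b| = |√a - √b| * |√a + √b| := by
      rw [← abs_mul]; congr 1
      have := Real.mul_self_sqrt ha.le
      have := Real.mul_self_sqrt hb.le
      nlinarith
    rw [h2, ← sq_abs, sq]
    refine mul_le_mul_of_nonneg_left ?_ (abs_nonneg _)
    rw [abs_of_nonneg (add_nonneg (sqrt_nonneg a) (sqrt_nonneg b)), abs_le]
    constructor <;> linarith [sqrt_nonneg a, sqrt_nonneg b]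
  have h3 : |log a - log b| = 2 * |log a / 2 - log b / 2| := by
    rw [← sub_div, abs_div]; norm_num; ring
  rw [h3, mul_assoc]
  gcongr
  refine h.trans ?_
  gcongr

/-- The vector field `a / |a|²`. -/
def ker (a : Pt) : Pt := (‖a‖ ^ 2)⁻¹ • a

lemma norm_ker (a : Pt) : ‖ker a‖ = ‖a‖⁻¹ := by
  rcases eq_or_ne a 0 with rfl | ha
  · simp [ker]
  · have := norm_pos_iff.2 ha
    rw [ker, norm_smul]; simp; field_simp

lemma norm_ker_sub {a b : Pt} (ha : a ≠ 0) (hb : b ≠ 0) :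
    ‖ker a - ker b‖ = ‖a - b‖ / (‖a‖ * ‖b‖) := by
  have h1 := norm_pos_iff.2 ha
  have h2 := norm_pos_iff.2 hb
  have h : ‖ker a - ker b‖ ^ 2 = (‖a - b‖ / (‖a‖ * ‖b‖)) ^ 2 := by
    rw [@norm_sub_sq_real, norm_ker, norm_ker, div_pow, @norm_sub_sq_real, ker, ker,
      real_inner_smul_left, real_inner_smul_right]
    field_simp
    ring
  have := (sq_eq_sq₀ (norm_nonneg _) (by positivity)).1 h
  exact this

lemma holder_aux {a b : Pt} (ha : a ≠ 0) (hb : b ≠ 0) (hab : ‖a‖ ≤ ‖b‖) {α : ℝ}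
    (h0 : 0 < α) (h1 : α < 1) :
    ‖ker a - ker b‖ ≤ 2 * ‖a - b‖ ^ α * ‖a‖ ^ (-1 - α) := by
  have ha' := norm_pos_iff.2 ha
  have hb' := norm_pos_iff.2 hb
  rw [norm_ker_sub ha hb]
  have h3 : ‖a - b‖ ≤ 2 * ‖b‖ := by
    have := norm_sub_le a b; linarith
  rcases (norm_nonneg (a - b)).eq_or_lt with h | h
  · rw [← h]; simp; positivity
  have e1 : ‖a - b‖ = ‖a - b‖ ^ α * ‖a - b‖ ^ (1 - α) := by
    rw [← rpow_add h]; simp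
  have e2 : ‖a - b‖ ^ (1 - α) ≤ 2 * ‖b‖ ^ (1 - α) := by
    calc ‖a - b‖ ^ (1 - α) ≤ (2 * ‖b‖) ^ (1 - α) := by gcongr
      _ = 2 ^ (1 - α) * ‖b‖ ^ (1 - α) := by rw [mul_rpow] <;> positivity
      _ ≤ 2 ^ (1 : ℝ) * ‖b‖ ^ (1 - α) := by
          gcongr
          · norm_num
          · linarith
      _ = _ := by simp
  calc ‖a - b‖ / (‖a‖ * ‖b‖) = ‖a - b‖ ^ α * ‖a - b‖ ^ (1 - α) / (‖a‖ * ‖b‖) := by rw [← e1]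
    _ ≤ ‖a - b‖ ^ α * (2 * ‖b‖ ^ (1 - α)) / (‖a‖ * ‖b‖) := by gcongr
    _ = 2 * ‖a - b‖ ^ α * (‖b‖ ^ (-α) * ‖a‖⁻¹) := by
        have : ‖b‖ ^ (1 - α) = ‖b‖ * ‖b‖ ^ (-α) := by
          rw [sub_eq_add_neg, rpow_add hb', rpow_one]
        rw [this]; field_simp
    _ ≤ 2 * ‖a - b‖ ^ α * (‖a‖ ^ (-α) * ‖a‖⁻¹) := by
        gcongr 2 * _ * (?_ * _)
        exact rpow_le_rpow_of_nonpos ha' hab (by linarith)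
    _ = _ := by
        rw [← rpow_neg_one, ← rpow_add ha']; congr 2; ring

lemma norm_ker_sub_le (a b : Pt) {α : ℝ} (h0 : 0 < α) (h1 : α < 1) :
    ‖ker a - ker b‖ ≤ 2 * ‖a - b‖ ^ α * (‖a‖ ^ (-1 - α) + ‖b‖ ^ (-1 - α)) := by
  have zero_case : ∀ b : Pt, ‖ker b‖ ≤ 2 * ‖b‖ ^ α * ‖b‖ ^ (-1 - α) := by
    intro b
    rw [norm_ker]
    rcases eq_or_ne b 0 with rfl | hb
    · simp; positivity
    · have hb' := norm_pos_iff.2 hb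
      rw [mul_assoc, ← rpow_add hb', show α + (-1 - α) = -1 by ring, rpow_neg_one]
      have : 0 < ‖b‖⁻¹ := by positivity
      linarith
  rcases eq_or_ne a 0 with rfl | ha
  · have := zero_case b
    simpa [ker, zero_rpow (show -1 - α ≠ 0 by linarith)] using this
  rcases eq_or_ne b 0 with rfl | hb
  · have := zero_case a
    simpa [ker, zero_rpow (show -1 - α ≠ 0 by linarith)] using this
  rcases le_total ‖a‖ ‖b‖ with hab | hab
  · refine (holder_aux ha hb hab h0 h1).trans ?_
    gcongr
    have : 0 ≤ ‖b‖ ^ (-1 - α) := by positivity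
    linarith
  · rw [norm_sub_rev, norm_sub_rev a b]
    refine (holder_aux hb ha hab h0 h1).trans ?_
    gcongr
    have : 0 ≤ ‖a‖ ^ (-1 - α) := by positivity
    linarith

lemma hasGradientAt_log_norm {a : Pt} (ha : a ≠ 0) :
    HasGradientAt (fun x : Pt => log ‖x‖) (ker a) a := by
  have h1 : HasFDerivAt (fun x : Pt => ‖x‖ ^ 2) (2 • (innerSL ℝ a)) a :=
    (hasStrictFDerivAt_norm_sq a).hasFDerivAt
  have h2 := h1.log (by have := norm_pos_iff.2 ha; positivity)
  have h3 := h2.const_mul (1/2 : ℝ)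
  have e : (fun x : Pt => log ‖x‖) = fun x : Pt => (1/2 : ℝ) * log (‖x‖ ^ 2) := by
    ext x; rw [log_pow]; push_cast; ring
  rw [e, hasGradientAt_iff_hasFDerivAt]
  have e2 : InnerProductSpace.toDual ℝ Pt (ker a) =
      (1 / 2 : ℝ) • (‖a‖ ^ 2)⁻¹ • 2 • (innerSL ℝ) a := by
    ext v
    simp [ker, real_inner_smul_left]
    ring
  rw [e2]
  exact h3

lemma log_taylor {a h : Pt} (ha : a ≠ 0) (hah : a + h ≠ 0) :
    |log ‖a + h‖ - log ‖a‖ - ⟪ker a, h⟫| ≤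
      8 * ‖h‖ ^ (3/2 : ℝ) * (‖a‖ ^ (-(3/2) : ℝ) + ‖a + h‖ ^ (-(3/2) : ℝ)) := by
  have ha' := norm_pos_iff.2 ha
  have hb' := norm_pos_iff.2 hah
  rcases (norm_nonneg h).eq_or_lt with hh | hh
  · have : h = 0 := norm_eq_zero.1 hh.symm
    subst this
    simp
  have aux : ∀ t : ℝ, 0 < t → t ≤ 3 * ‖h‖ → ‖h‖ * t⁻¹ ≤ 2 * ‖h‖ ^ (3/2 : ℝ) * t ^ (-(3/2) : ℝ) := by
    intro t ht hth
    have e1 : ‖h‖ ^ (3/2 : ℝ) = ‖h‖ * ‖h‖ ^ (1/2 : ℝ) := by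
      rw [show (3/2 : ℝ) = 1 + 1/2 by norm_num, rpow_add hh, rpow_one]
    have e2 : t ^ (-(3/2) : ℝ) = t⁻¹ * (t ^ (1/2 : ℝ))⁻¹ := by
      rw [show (-(3/2) : ℝ) = -1 + -(1/2) by norm_num, rpow_add ht, rpow_neg_one, rpow_neg ht.le]
    rw [e1, e2]
    have e3 : t ^ (1/2 : ℝ) ≤ 2 * ‖h‖ ^ (1/2 : ℝ) := by
      rw [← sqrt_eq_rpow, ← sqrt_eq_rpow]
      rw [show (2:ℝ) = √4 by rw [show (4:ℝ) = 2^2 by norm_num]; simp, ← sqrt_mul (by norm_num)]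
      apply sqrt_le_sqrt; linarith
    have e4 : 0 < t ^ (1/2 : ℝ) := by positivity
    have e5 : 1 ≤ 2 * ‖h‖ ^ (1/2 : ℝ) * (t ^ (1/2 : ℝ))⁻¹ := by
      rw [← div_eq_mul_inv, one_le_div e4]; exact e3
    calc ‖h‖ * t⁻¹ = ‖h‖ * t⁻¹ * 1 := by ring
      _ ≤ ‖h‖ * t⁻¹ * (2 * ‖h‖ ^ (1/2 : ℝ) * (t ^ (1/2 : ℝ))⁻¹) := by gcongr
      _ = _ := by ring
  rcases le_or_gt ‖a‖ (2 * ‖h‖) with hc | hc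
  · have h1 := abs_log_sub_le hb' ha'
    have h2 : |‖a + h‖ - ‖a‖| ≤ ‖h‖ := by
      have := abs_norm_sub_norm_le (a + h) a; simpa using this
    have h3 : |⟪ker a, h⟫| ≤ ‖h‖ * ‖a‖⁻¹ := by
      have := abs_real_inner_le_norm (ker a) h
      rw [norm_ker] at this; linarith
    have h4 : |‖a + h‖ - ‖a‖| * (‖a + h‖⁻¹ + ‖a‖⁻¹) ≤ ‖h‖ * (‖a + h‖⁻¹ + ‖a‖⁻¹) := by gcongr
    have h5 := aux ‖a‖ ha' (by linarith)
    have h6 := aux ‖a + h‖ hb' (by have := norm_add_le a h; linarith)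
    have h7 := abs_sub (log ‖a + h‖ - log ‖a‖) ⟪ker a, h⟫
    have p1 : 0 ≤ ‖h‖ ^ (3/2 : ℝ) * ‖a‖ ^ (-(3/2) : ℝ) := by positivity
    have p2 : 0 ≤ ‖h‖ ^ (3/2 : ℝ) * ‖a + h‖ ^ (-(3/2) : ℝ) := by positivity
    nlinarith
  · -- mean value
    have hconv : Convex ℝ (closedBall a ‖h‖) := convex_closedBall _ _
    have hne : ∀ x ∈ closedBall a ‖h‖, ‖a‖ / 2 ≤ ‖x‖ := by
      intro x hx
      rw [mem_closedBall, dist_eq_norm] at hx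
      have := norm_sub_norm_le a x
      rw [norm_sub_rev] at this
      linarith
    have hd : ∀ x ∈ closedBall a ‖h‖, HasFDerivWithinAt (fun x : Pt => log ‖x‖)
        (InnerProductSpace.toDual ℝ Pt (ker x)) (closedBall a ‖h‖) x := by
      intro x hx
      have hx0 : x ≠ 0 := by
        have := hne x hx
        rw [← norm_pos_iff]; linarith
      exact (hasGradientAt_iff_hasFDerivAt.1 (hasGradientAt_log_norm hx0)).hasFDerivWithinAt
    have hb : ∀ x ∈ closedBall a ‖h‖, ‖InnerProductSpace.toDual ℝ Pt (ker x) -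
        InnerProductSpace.toDual ℝ Pt (ker a)‖ ≤ 2 * ‖h‖ / ‖a‖ ^ 2 := by
      intro x hx
      have hx1 := hne x hx
      have hx0 : x ≠ 0 := by
        rw [← norm_pos_iff]; linarith
      rw [← map_sub, LinearIsometryEquiv.norm_map, norm_ker_sub hx0 ha]
      rw [mem_closedBall, dist_eq_norm] at hx
      rw [div_le_div_iff₀ (by positivity) (by positivity)]
      have : ‖x - a‖ * ‖a‖ ^ 2 ≤ ‖h‖ * ‖a‖ ^ 2 := by gcongr
      have h8 : ‖h‖ * ‖a‖ * ‖a‖ ≤ ‖h‖ * ‖a‖ * (2 * ‖x‖) := by gcongr; linarith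
      nlinarith
    have := hconv.norm_image_sub_le_of_norm_hasFDerivWithin_le' hd hb
      (mem_closedBall_self (norm_nonneg h)) (show a + h ∈ closedBall a ‖h‖ by simp)
    simp only [add_sub_cancel_left, InnerProductSpace.toDual_apply_apply, norm_eq_abs] at this
    refine this.trans ?_
    have e1 : ‖h‖ * ‖a‖⁻¹ ≤ ‖h‖ ^ (1/2 : ℝ) * (‖a‖ ^ (1/2:ℝ))⁻¹ := by
      rw [← div_eq_mul_inv, ← div_eq_mul_inv, ← div_rpow hh.le ha'.le]
      have : ‖h‖ / ‖a‖ ≤ 1 := by rw [div_le_one ha']; linarith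
      calc ‖h‖ / ‖a‖ = (‖h‖ / ‖a‖) ^ (1:ℝ) := by simp
        _ ≤ _ := rpow_le_rpow_of_exponent_ge (by positivity) this (by norm_num)
    have e2 : ‖h‖ ^ (3/2 : ℝ) = ‖h‖ * ‖h‖ ^ (1/2 : ℝ) := by
      rw [show (3/2 : ℝ) = 1 + 1/2 by norm_num, rpow_add hh, rpow_one]
    have e3 : ‖a‖ ^ (-(3/2) : ℝ) = ‖a‖⁻¹ * (‖a‖ ^ (1/2 : ℝ))⁻¹ := by
      rw [show (-(3/2) : ℝ) = -1 + -(1/2) by norm_num, rpow_add ha', rpow_neg_one, rpow_neg ha'.le]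
    have e4 : 2 * ‖h‖ / ‖a‖ ^ 2 * ‖h‖ = 2 * (‖h‖ * ‖a‖⁻¹) * (‖h‖ * ‖a‖⁻¹) := by
      field_simp
    rw [e4]
    calc 2 * (‖h‖ * ‖a‖⁻¹) * (‖h‖ * ‖a‖⁻¹)
        ≤ 2 * (‖h‖ * ‖a‖⁻¹) * (‖h‖ ^ (1/2 : ℝ) * (‖a‖ ^ (1/2:ℝ))⁻¹) := by gcongr
      _ = 2 * ‖h‖ ^ (3/2 : ℝ) * ‖a‖ ^ (-(3/2) : ℝ) := by rw [e2, e3]; ring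
      _ ≤ _ := by
        have p1 : 0 ≤ ‖h‖ ^ (3/2 : ℝ) * ‖a‖ ^ (-(3/2) : ℝ) := by positivity
        have p2 : 0 ≤ ‖h‖ ^ (3/2 : ℝ) * ‖a + h‖ ^ (-(3/2) : ℝ) := by positivity
        nlinarith

end Trap

namespace Trap

/-! ### Newtonian potentials of bounded sets -/

lemma riesz_int {p : ℝ} (hp0 : 0 < p) (hp : p < 2) :
    ∃ C : ℝ, 0 ≤ C ∧ ∀ (W : Set Pt), volume W ≠ ⊤ → ∀ x : Pt,
      IntegrableOn (fun z => ‖x - z‖ ^ (-p)) W ∧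
        ∫ z in W, ‖x - z‖ ^ (-p) ≤ C + volume.real W := by
  have h0 : IntegrableOn (fun z : Pt => ‖z‖ ^ (-p)) (ball 0 1) := by
    refine integrableOn_ball_of_norm_le_rpow (C := 1) (α := p) (by simp) (by simpa using hp) ?_ ?_
    · refine Eventually.of_forall fun z => ?_
      rw [norm_of_nonneg (by positivity)]; simp
    · apply Measurable.aestronglyMeasurable; fun_prop
  refine ⟨∫ z in ball (0:Pt) 1, ‖z‖ ^ (-p), by positivity, fun W hW x => ?_⟩
  have h1 : Integrable ((ball (0:Pt) 1).indicator fun z : Pt => ‖z‖ ^ (-p)) :=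
    (integrable_indicator_iff measurableSet_ball).2 h0
  have h2 : Integrable fun z => (ball (0:Pt) 1).indicator (fun z : Pt => ‖z‖ ^ (-p)) (x - z) :=
    h1.comp_sub_left x
  have h3 : IntegrableOn (fun z => (ball (0:Pt) 1).indicator (fun z : Pt => ‖z‖ ^ (-p)) (x - z) + 1)
      W := h2.integrableOn.add (integrableOn_const hW)
  have h4 : ∀ z, ‖x - z‖ ^ (-p) ≤
      (ball (0:Pt) 1).indicator (fun z : Pt => ‖z‖ ^ (-p)) (x - z) + 1 := by
    intro z
    by_cases hz : x - z ∈ ball (0:Pt) 1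
    · rw [Set.indicator_of_mem hz]; linarith
    · rw [Set.indicator_of_notMem hz, zero_add]
      apply rpow_le_one_of_one_le_of_nonpos _ (by linarith)
      simpa using hz
  have h5 : IntegrableOn (fun z => ‖x - z‖ ^ (-p)) W := by
    refine Integrable.mono' h3 (Measurable.aestronglyMeasurable (by fun_prop))
      (Eventually.of_forall fun z => ?_)
    rw [norm_of_nonneg (by positivity)]; exact h4 z
  refine ⟨h5, (integral_mono h5 h3 h4).trans ?_⟩
  rw [integral_add h2.integrableOn (integrableOn_const hW)]
  gcongr
  · refine (setIntegral_le_integral h2 (Eventually.of_forall fun z => ?_)).trans ?_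
    · exact Set.indicator_nonneg (fun z _ => by positivity) _
    · rw [integral_sub_left_eq_self (fun z => (ball (0:Pt) 1).indicator (fun z : Pt => ‖z‖ ^ (-p)) z),
        integral_indicator measurableSet_ball]
  · simp

lemma riesz_int_one {W : Set Pt} (hW : volume W ≠ ⊤) (x : Pt) :
    IntegrableOn (fun z => ‖x - z‖⁻¹) W := by
  obtain ⟨C, -, h⟩ := riesz_int (p := 1) (by norm_num) (by norm_num)
  simpa [rpow_neg_one] using (h W hW x).1

/-- The logarithmic potential. -/
def newt (W : Set Pt) (x : Pt) : ℝ := ∫ z in W, log ‖x - z‖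

/-- The gradient of the logarithmic potential. -/
def bs (W : Set Pt) (x : Pt) : Pt := ∫ z in W, ker (x - z)

lemma measurable_ker : Measurable ker := by
  unfold ker; fun_prop

lemma abs_log_le {a : ℝ} (ha : 0 ≤ a) : |log a| ≤ a + a⁻¹ := by
  rcases ha.eq_or_lt with rfl | h
  · simp
  · rw [abs_le]
    have h1 := Real.log_le_sub_one_of_pos h
    have h2 := Real.log_le_sub_one_of_pos (inv_pos.2 h)
    rw [Real.log_inv] at h2
    have := inv_pos.2 h
    constructor <;> linarith

lemma bounded_vol {W : Set Pt} (hW : Bornology.IsBounded W) : volume W ≠ ⊤ :=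
  hW.measure_lt_top.ne

lemma integrableOn_norm_sub {W : Set Pt} (hW : Bornology.IsBounded W) (x : Pt) :
    IntegrableOn (fun z => ‖x - z‖) W := by
  obtain ⟨D, hD⟩ := hW.subset_closedBall 0
  have : IntegrableOn (fun z => ‖x - z‖) (closedBall 0 D) :=
    (Continuous.continuousOn (by fun_prop)).integrableOn_compact (isCompact_closedBall _ _)
  exact this.mono_set hD

lemma integrableOn_log {W : Set Pt} (hW : Bornology.IsBounded W) (x : Pt) :
    IntegrableOn (fun z => log ‖x - z‖) W := by
  refine Integrable.mono' ((integrableOn_norm_sub hW x).add (riesz_int_one (bounded_vol hW) x))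
    (Measurable.aestronglyMeasurable (by fun_prop)) (Eventually.of_forall fun z => ?_)
  exact abs_log_le (norm_nonneg _)

lemma integrableOn_ker {W : Set Pt} (hW : volume W ≠ ⊤) (x : Pt) :
    IntegrableOn (fun z => ker (x - z)) W := by
  refine Integrable.mono' (riesz_int_one hW x)
    (measurable_ker.comp (by fun_prop)).aestronglyMeasurable (Eventually.of_forall fun z => ?_)
  rw [norm_ker]

lemma bs_holder {W : Set Pt} (hW : volume W ≠ ⊤) {α : ℝ} (h0 : 0 < α) (h1 : α < 1) :
    ∃ C : ℝ, ∀ x y, ‖bs W x - bs W y‖ ≤ C * ‖x - y‖ ^ α := by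
  obtain ⟨C, -, h⟩ := riesz_int (p := 1 + α) (by linarith) (by linarith)
  refine ⟨2 * ((C + volume.real W) + (C + volume.real W)), fun x y => ?_⟩
  have e : -(1 + α) = -1 - α := by ring
  simp only [e] at h
  rw [bs, bs, ← integral_sub (integrableOn_ker hW x) (integrableOn_ker hW y)]
  calc ‖∫ z in W, (ker (x - z) - ker (y - z))‖
      ≤ ∫ z in W, 2 * ‖x - y‖ ^ α * (‖x - z‖ ^ (-1 - α) + ‖y - z‖ ^ (-1 - α)) := by
        apply norm_integral_le_of_norm_le
        · exact ((h W hW x).1.add (h W hW y).1).const_mul _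
        · refine Eventually.of_forall fun z => ?_
          have := norm_ker_sub_le (x - z) (y - z) h0 h1
          simpa using this
    _ = 2 * ‖x - y‖ ^ α * ((∫ z in W, ‖x - z‖ ^ (-1 - α)) + ∫ z in W, ‖y - z‖ ^ (-1 - α)) := by
        rw [integral_const_mul, integral_add (h W hW x).1 (h W hW y).1]
    _ ≤ 2 * ‖x - y‖ ^ α * ((C + volume.real W) + (C + volume.real W)) := by
        gcongr
        · exact (h W hW x).2
        · exact (h W hW y).2
    _ = _ := by ring

lemma ae_sub_ne (W : Set Pt) (x : Pt) : ∀ᵐ z ∂(volume.restrict W), x - z ≠ 0 := by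
  apply ae_restrict_of_ae
  have : ∀ᵐ z : Pt, z ≠ x := by simp [ae_iff]
  filter_upwards [this] with z hz h
  exact hz (sub_eq_zero.1 h).symm

lemma newt_hasGradientAt {W : Set Pt} (hW : Bornology.IsBounded W) (x : Pt) :
    HasGradientAt (newt W) (bs W x) x := by
  have hv := bounded_vol hW
  obtain ⟨C, hC, h⟩ := riesz_int (p := 3/2) (by norm_num) (by norm_num)
  rw [hasGradientAt_iff_isLittleO]
  have key : ∀ y, ‖newt W y - newt W x - ⟪bs W x, y - x⟫‖ ≤
      (8 * ((C + volume.real W) + (C + volume.real W))) * ‖y - x‖ ^ (3/2 : ℝ) := by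
    intro y
    have e1 : ⟪bs W x, y - x⟫ = ∫ z in W, ⟪ker (x - z), y - x⟫ := by
      rw [bs, real_inner_comm, ← integral_inner (integrableOn_ker hv x)]
      simp_rw [real_inner_comm]
    have i1 := integrableOn_log hW x
    have i2 := integrableOn_log hW y
    have i3 : IntegrableOn (fun z => ⟪ker (x - z), y - x⟫) W := by
      exact (integrableOn_ker hv x).inner_const (y - x)
    rw [e1, newt, newt, ← integral_sub i2 i1, ← integral_sub (f := fun z => log ‖y - z‖ - log ‖x - z‖) (i2.sub i1) i3]
    calc _ ≤ ∫ z in W, 8 * ‖y - x‖ ^ (3/2 : ℝ) *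
            (‖x - z‖ ^ (-(3/2) : ℝ) + ‖y - z‖ ^ (-(3/2) : ℝ)) := by
          apply norm_integral_le_of_norm_le
          · exact ((h W hv x).1.add (h W hv y).1).const_mul _
          · filter_upwards [ae_sub_ne W x, ae_sub_ne W y] with z hx hy
            have e : y - z = (x - z) + (y - x) := by abel
            have := log_taylor hx (h := y - x) (by rwa [← e])
            rw [← e] at this
            simpa using this
      _ = 8 * ‖y - x‖ ^ (3/2 : ℝ) * ((∫ z in W, ‖x - z‖ ^ (-(3/2) : ℝ)) +
            ∫ z in W, ‖y - z‖ ^ (-(3/2) : ℝ)) := by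
          rw [integral_const_mul, integral_add (h W hv x).1 (h W hv y).1]
      _ ≤ 8 * ‖y - x‖ ^ (3/2 : ℝ) * ((C + volume.real W) + (C + volume.real W)) := by
          gcongr
          · exact (h W hv x).2
          · exact (h W hv y).2
      _ = _ := by ring
  have hO : (fun y => newt W y - newt W x - ⟪bs W x, y - x⟫) =O[𝓝 x]
      (fun y => ‖y - x‖ ^ (3/2 : ℝ)) := by
    refine Asymptotics.IsBigO.of_bound (8 * ((C + volume.real W) + (C + volume.real W)))
      (Eventually.of_forall fun y => ?_)
    rw [norm_of_nonneg (r := ‖y - x‖ ^ (3/2 : ℝ)) (by positivity)]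
    exact key y
  refine hO.trans_isLittleO ?_
  · have : (fun y => ‖y - x‖ ^ (3/2 : ℝ)) = fun y => ‖y - x‖ ^ (1/2 : ℝ) * ‖y - x‖ := by
      ext y
      rcases (norm_nonneg (y - x)).eq_or_lt with h | h
      · rw [← h]; norm_num
      · rw [show (3/2 : ℝ) = 1/2 + 1 by norm_num, rpow_add h, rpow_one]
    rw [this]
    have h2 : Tendsto (fun y => ‖y - x‖ ^ (1/2 : ℝ)) (𝓝 x) (𝓝 0) := by
      have : ContinuousAt (fun y => ‖y - x‖ ^ (1/2 : ℝ)) x := by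
        apply ContinuousAt.rpow_const (by fun_prop) (Or.inr (by norm_num))
      have h3 := this.tendsto
      simpa using h3
    have h3 : (fun y => ‖y - x‖ ^ (1/2 : ℝ)) =o[𝓝 x] (fun _ => (1:ℝ)) :=
      (Asymptotics.isLittleO_one_iff ℝ).2 h2
    have h4 : (fun y => ‖y - x‖) =O[𝓝 x] (fun y => y - x) := Asymptotics.isBigO_norm_left.2
      (Asymptotics.isBigO_refl _ _)
    have := h3.mul_isBigO h4.norm_right
    simpa using this

end Trap

namespace Trap

/-! ### The image part of the Green function of the disk -/

/-- Denominator. -/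
def den (R : ℝ) (x y : Pt) : ℝ := R ^ 4 - 2 * R ^ 2 * ⟪x, y⟫ + ‖x‖ ^ 2 * ‖y‖ ^ 2

/-- Image kernel (normalised to vanish at `x = 0`). -/
def hk (R : ℝ) (x y : Pt) : ℝ := -(1 / (4 * π)) * (log (den R x y) - log (R ^ 4))

/-- Gradient of the image kernel. -/
def gk (R : ℝ) (x y : Pt) : Pt :=
  (1 / (2 * π) / den R x y) • ((R ^ 2 : ℝ) • y - (‖y‖ ^ 2 : ℝ) • x)

variable {R D : ℝ}

lemma den_eq {x y : Pt} (hy : y ≠ 0) : den R x y = ‖y‖ ^ 2 * ‖x - R ^ 2 • ker y‖ ^ 2 := by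
  have := norm_pos_iff.2 hy
  rw [@norm_sub_sq_real, norm_smul, norm_ker, den, ker, real_inner_smul_right,
    real_inner_smul_right]
  simp
  field_simp
  ring

lemma norm_star_sub {x y : Pt} (hR : 0 < R) (hD : 4 * D ≤ R) (hx : ‖x‖ ≤ 2 * R) (hyD : ‖y‖ ≤ D)
    (hy : y ≠ 0) : R ^ 2 / (2 * ‖y‖) ≤ ‖x - R ^ 2 • ker y‖ := by
  have hy' := norm_pos_iff.2 hy
  have h1 := norm_sub_norm_le (R ^ 2 • ker y) x
  rw [norm_sub_rev, norm_smul, norm_ker] at h1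
  simp at h1
  have h2 : 2 * R ≤ R ^ 2 / (2 * ‖y‖) := by
    rw [le_div_iff₀ (by positivity)]; nlinarith
  have h3 : R ^ 2 * ‖y‖⁻¹ = R ^ 2 / (2 * ‖y‖) + R ^ 2 / (2 * ‖y‖) := by field_simp; ring
  linarith

lemma den_pos {x y : Pt} (hR : 0 < R) (hD : 4 * D ≤ R) (hx : ‖x‖ ≤ 2 * R) (hyD : ‖y‖ ≤ D) :
    0 < den R x y := by
  rcases eq_or_ne y 0 with rfl | hy
  · simp [den]; positivity
  · rw [den_eq hy]
    have hy' := norm_pos_iff.2 hy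
    have := norm_star_sub hR hD hx hyD hy
    have : 0 < ‖x - R ^ 2 • ker y‖ := lt_of_lt_of_le (by positivity) this
    positivity

lemma gk_eq {x y : Pt} (hy : y ≠ 0) :
    gk R x y = -(1 / (2 * π)) • ker (x - R ^ 2 • ker y) := by
  have hy' := norm_pos_iff.2 hy
  have hk : (‖y‖ ^ 2 : ℝ) • ((R ^ 2 : ℝ) • ker y) = (R ^ 2 : ℝ) • y := by
    rw [ker, smul_smul, smul_smul]; congr 1; field_simp
  have hk2 : ker (x - R ^ 2 • ker y) = (‖x - R ^ 2 • ker y‖ ^ 2)⁻¹ • (x - R ^ 2 • ker y) := rfl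
  rw [hk2, gk, den_eq hy, ← hk, ← smul_sub, smul_smul, smul_smul, ← neg_sub x, smul_neg,
    ← neg_smul]
  congr 1
  field_simp

lemma norm_gk_le {x y : Pt} (hR : 0 < R) (hD : 4 * D ≤ R) (hx : ‖x‖ ≤ 2 * R) (hyD : ‖y‖ ≤ D) :
    ‖gk R x y‖ ≤ D / R ^ 2 := by
  have hD0 : 0 ≤ D := (norm_nonneg y).trans hyD
  rcases eq_or_ne y 0 with rfl | hy
  · simp [gk]; positivity
  have hy' := norm_pos_iff.2 hy
  have h1 := norm_star_sub hR hD hx hyD hy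
  rw [gk_eq hy, norm_smul, norm_ker]
  have h2 : ‖x - R ^ 2 • ker y‖⁻¹ ≤ 2 * ‖y‖ / R ^ 2 := by
    rw [← inv_div]; gcongr
  have h3 : ‖-(1 / (2 * π))‖ ≤ 1 / 2 := by
    rw [norm_neg, norm_of_nonneg (by positivity)]
    apply one_div_le_one_div_of_le <;> linarith [pi_gt_three]
  calc _ ≤ 1 / 2 * (2 * ‖y‖ / R ^ 2) := by gcongr
    _ = ‖y‖ / R ^ 2 := by ring
    _ ≤ _ := by gcongr

lemma gk_lip {x x' y : Pt} (hR : 0 < R) (hD : 4 * D ≤ R) (hx : ‖x‖ ≤ 2 * R) (hx' : ‖x'‖ ≤ 2 * R)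
    (hyD : ‖y‖ ≤ D) : ‖gk R x y - gk R x' y‖ ≤ 1 / R ^ 2 * ‖x - x'‖ := by
  have hD0 : 0 ≤ D := (norm_nonneg y).trans hyD
  rcases eq_or_ne y 0 with rfl | hy
  · simp [gk]; positivity
  have hy' := norm_pos_iff.2 hy
  have hl : 2 * R ≤ R ^ 2 / (2 * ‖y‖) := by
    rw [le_div_iff₀ (by positivity)]; nlinarith
  have h1 := hl.trans (norm_star_sub hR hD hx hyD hy)
  have h2 := hl.trans (norm_star_sub hR hD hx' hyD hy)
  have n1 : x - R ^ 2 • ker y ≠ 0 := by rw [← norm_pos_iff]; linarith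
  have n2 : x' - R ^ 2 • ker y ≠ 0 := by rw [← norm_pos_iff]; linarith
  rw [gk_eq hy, gk_eq hy, ← smul_sub, norm_smul, norm_ker_sub n1 n2, sub_sub_sub_cancel_right]
  have h3 : ‖-(1 / (2 * π))‖ ≤ 1 := by
    rw [norm_neg, norm_of_nonneg (by positivity), div_le_one (by positivity)]
    linarith [pi_gt_three]
  calc _ ≤ 1 * (‖x - x'‖ / (R * R)) := by
        gcongr <;> linarith
    _ = _ := by field_simp

lemma hk_hasGradientAt {x y : Pt} (h : 0 < den R x y) :
    HasGradientAt (fun x => hk R x y) (gk R x y) x := by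
  have h1 : HasFDerivAt (fun x : Pt => ‖x‖ ^ 2) (2 • (innerSL ℝ x)) x :=
    (hasStrictFDerivAt_norm_sq x).hasFDerivAt
  have h2 : HasFDerivAt (fun x : Pt => ⟪x, y⟫) (innerSL ℝ y) x := by
    have := (innerSL ℝ y).hasFDerivAt (x := x)
    refine this.congr_of_eventuallyEq (Eventually.of_forall fun z => ?_)
    simp [real_inner_comm]
  have h3 : HasFDerivAt (fun x : Pt => den R x y)
      (-(2 * R ^ 2) • innerSL ℝ y + (‖y‖ ^ 2) • (2 • (innerSL ℝ x))) x := by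
    unfold den
    have := ((h2.const_mul (2 * R ^ 2)).const_sub (R ^ 4)).add (h1.mul_const (‖y‖ ^ 2))
    rw [neg_smul]
    exact this
  have h4 := ((h3.log h.ne').sub_const (log (R ^ 4))).const_mul (-(1 / (4 * π)))
  rw [hasGradientAt_iff_hasFDerivAt]
  have e : InnerProductSpace.toDual ℝ Pt (gk R x y) = -(1 / (4 * π)) • (den R x y)⁻¹ •
      (-(2 * R ^ 2) • innerSL ℝ y + (‖y‖ ^ 2) • (2 • (innerSL ℝ x))) := by
    ext v
    simp [gk, inner_sub_left, real_inner_smul_left]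
    field_simp
    ring
  rw [e]
  exact h4

lemma hk_zero (y : Pt) : hk R 0 y = 0 := by simp [hk, den]

lemma hk_lip {x x' y : Pt} (hR : 0 < R) (hD : 4 * D ≤ R) (hx : ‖x‖ ≤ 2 * R) (hx' : ‖x'‖ ≤ 2 * R)
    (hyD : ‖y‖ ≤ D) : |hk R x y - hk R x' y| ≤ D / R ^ 2 * ‖x - x'‖ := by
  have := (convex_closedBall (0:Pt) (2 * R)).norm_image_sub_le_of_norm_hasFDerivWithin_le
    (f := fun x => hk R x y) (f' := fun x => InnerProductSpace.toDual ℝ Pt (gk R x y))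
    (C := D / R ^ 2) (fun z hz => ?_) (fun z hz => ?_) (x := x') (y := x) (by simpa using hx')
    (by simpa using hx)
  · simpa using this
  · have hz' : ‖z‖ ≤ 2 * R := by simpa using hz
    exact (hasGradientAt_iff_hasFDerivAt.1
      (hk_hasGradientAt (den_pos hR hD hz' hyD))).hasFDerivWithinAt
  · have hz' : ‖z‖ ≤ 2 * R := by simpa using hz
    rw [LinearIsometryEquiv.norm_map]
    exact norm_gk_le hR hD hz' hyD

lemma hk_abs {x y : Pt} (hR : 0 < R) (hD : 4 * D ≤ R) (hx : ‖x‖ ≤ 2 * R)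
    (hyD : ‖y‖ ≤ D) : |hk R x y| ≤ D / R ^ 2 * ‖x‖ := by
  have := hk_lip hR hD hx (x' := 0) (by simp; linarith) hyD
  simpa [hk_zero] using this

lemma measurable_hk (x : Pt) : Measurable (hk R x) := by
  unfold hk den
  have : Measurable fun y : Pt => ⟪x, y⟫ := (Continuous.inner continuous_const continuous_id).measurable
  fun_prop

lemma measurable_gk (x : Pt) : Measurable (gk R x) := by
  unfold gk den
  have : Measurable fun y : Pt => ⟪x, y⟫ := (Continuous.inner continuous_const continuous_id).measurable
  fun_prop

/-- Image potential -/
def hpot (R : ℝ) (W : Set Pt) (x : Pt) : ℝ := ∫ y in W, hk R x y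
/-- Gradient of the image potential -/
def gpot (R : ℝ) (W : Set Pt) (x : Pt) : Pt := ∫ y in W, gk R x y

lemma mem_ball_vol {W : Set Pt} (hW : W ⊆ closedBall 0 D) : volume W ≠ ⊤ :=
  bounded_vol (isBounded_closedBall.subset hW)

lemma ae_norm_le {W : Set Pt} (hm : MeasurableSet W) (hW : W ⊆ closedBall 0 D) :
    ∀ᵐ y ∂(volume.restrict W), ‖y‖ ≤ D := by
  filter_upwards [ae_restrict_mem hm] with y hy
  simpa using hW hy

lemma integrableOn_hk {W : Set Pt} (hm : MeasurableSet W) (hW : W ⊆ closedBall 0 D)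
    (hR : 0 < R) (hD : 4 * D ≤ R) {x : Pt} (hx : ‖x‖ ≤ 2 * R) : IntegrableOn (hk R x) W := by
  refine Integrable.mono' (g := fun _ => D / R ^ 2 * ‖x‖) (integrableOn_const (mem_ball_vol hW))
    (measurable_hk x).aestronglyMeasurable ?_
  filter_upwards [ae_norm_le hm hW] with y hy
  exact hk_abs hR hD hx hy

lemma integrableOn_gk {W : Set Pt} (hm : MeasurableSet W) (hW : W ⊆ closedBall 0 D)
    (hR : 0 < R) (hD : 4 * D ≤ R) {x : Pt} (hx : ‖x‖ ≤ 2 * R) : IntegrableOn (gk R x) W := by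
  refine Integrable.mono' (g := fun _ => D / R ^ 2) (integrableOn_const (mem_ball_vol hW))
    (measurable_gk x).aestronglyMeasurable ?_
  filter_upwards [ae_norm_le hm hW] with y hy
  exact norm_gk_le hR hD hx hy

lemma hpot_hasGradientAt {W : Set Pt} (hm : MeasurableSet W) (hW : W ⊆ closedBall 0 D)
    (hR : 0 < R) (hD : 4 * D ≤ R) {x : Pt} (hx : ‖x‖ < 2 * R) :
    HasGradientAt (hpot R W) (gpot R W x) x := by
  have hs : ball (0:Pt) (2 * R) ∈ 𝓝 x := isOpen_ball.mem_nhds (by simpa using hx)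
  have := hasFDerivAt_integral_of_dominated_of_fderiv_le (𝕜 := ℝ) (μ := volume.restrict W)
    (F := fun x y => hk R x y) (F' := fun x y => InnerProductSpace.toDual ℝ Pt (gk R x y))
    (x₀ := x) (bound := fun _ => D / R ^ 2) hs
    (Eventually.of_forall fun z => (measurable_hk z).aestronglyMeasurable)
    (integrableOn_hk hm hW hR hD hx.le)
    ((InnerProductSpace.toDual ℝ Pt).continuous.comp_aestronglyMeasurable
      (measurable_gk x).aestronglyMeasurable) ?_ (integrableOn_const (mem_ball_vol hW)) ?_
  · rw [hasGradientAt_iff_hasFDerivAt]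
    have e : InnerProductSpace.toDual ℝ Pt (gpot R W x) =
        ∫ y in W, InnerProductSpace.toDual ℝ Pt (gk R x y) := by
      rw [gpot]
      exact ((InnerProductSpace.toDual ℝ Pt).toContinuousLinearEquiv.toContinuousLinearMap.integral_comp_comm
        (integrableOn_gk hm hW hR hD hx.le)).symm
    rw [e]
    exact this
  · filter_upwards [ae_norm_le hm hW] with y hy z hz
    rw [LinearIsometryEquiv.norm_map]
    exact norm_gk_le hR hD (by simpa using (mem_ball.1 hz).le) hy
  · filter_upwards [ae_norm_le hm hW] with y hy z hz
    exact hasGradientAt_iff_hasFDerivAt.1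
      (hk_hasGradientAt (den_pos hR hD (by simpa using (mem_ball.1 hz).le) hy))

lemma norm_gpot_le {W : Set Pt} (hm : MeasurableSet W) (hW : W ⊆ closedBall 0 D)
    (hR : 0 < R) (hD : 4 * D ≤ R) {x : Pt} (hx : ‖x‖ ≤ 2 * R) :
    ‖gpot R W x‖ ≤ D / R ^ 2 * volume.real W := by
  rw [gpot]
  have := norm_setIntegral_le_of_norm_le_const_ae (μ := volume) (s := W) (f := gk R x)
    (C := D / R ^ 2) (mem_ball_vol hW).lt_top ?_
  · exact this
  · skip
    filter_upwards [ae_norm_le hm hW] with y hy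
    exact norm_gk_le hR hD hx hy

lemma gpot_lip {W : Set Pt} (hm : MeasurableSet W) (hW : W ⊆ closedBall 0 D)
    (hR : 0 < R) (hD : 4 * D ≤ R) {x x' : Pt} (hx : ‖x‖ ≤ 2 * R) (hx' : ‖x'‖ ≤ 2 * R) :
    ‖gpot R W x - gpot R W x'‖ ≤ 1 / R ^ 2 * ‖x - x'‖ * volume.real W := by
  rw [gpot, gpot, ← integral_sub (integrableOn_gk hm hW hR hD hx) (integrableOn_gk hm hW hR hD hx')]
  have := norm_setIntegral_le_of_norm_le_const_ae (μ := volume) (s := W)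
    (f := fun y => gk R x y - gk R x' y)
    (C := 1 / R ^ 2 * ‖x - x'‖) (mem_ball_vol hW).lt_top ?_
  · exact this
  · skip
    filter_upwards [ae_norm_le hm hW] with y hy
    exact gk_lip hR hD hx hx' hy

lemma hpot_lip {W : Set Pt} (hm : MeasurableSet W) (hW : W ⊆ closedBall 0 D)
    (hR : 0 < R) (hD : 4 * D ≤ R) {x x' : Pt} (hx : ‖x‖ ≤ 2 * R) (hx' : ‖x'‖ ≤ 2 * R) :
    |hpot R W x - hpot R W x'| ≤ D / R ^ 2 * ‖x - x'‖ * volume.real W := by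
  rw [hpot, hpot, ← integral_sub (integrableOn_hk hm hW hR hD hx) (integrableOn_hk hm hW hR hD hx')]
  have := norm_setIntegral_le_of_norm_le_const_ae (μ := volume) (s := W)
    (f := fun y => hk R x y - hk R x' y)
    (C := D / R ^ 2 * ‖x - x'‖) (mem_ball_vol hW).lt_top ?_
  · exact this
  · skip
    filter_upwards [ae_norm_le hm hW] with y hy
    exact hk_lip hR hD hx hx' hy

end Trap

namespace Trap

/-! ### Geometry of the level set and its tubular neighbourhood -/

/-- Standing geometric assumptions. -/
structure Geo (Ψ : Pt → ℝ) (G : Pt → Pt) (S : Set Pt) (K c0 M : ℝ) : Prop where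
  compact : IsCompact S
  nonempty : S.Nonempty
  grad : ∀ x, HasGradientAt Ψ (G x) x
  lip : ∀ x y, ‖G x - G y‖ ≤ K * ‖x - y‖
  zero : ∀ y ∈ S, Ψ y = 0
  K_pos : 0 < K
  c0_pos : 0 < c0
  lo : ∀ y ∈ S, c0 ≤ ‖G y‖
  hi : ∀ y ∈ S, ‖G y‖ ≤ M
  loc : ∃ V : Set Pt, IsOpen V ∧ S ⊆ V ∧ ∀ x ∈ V, Ψ x = 0 → x ∈ S
  strict : ∀ x, HasStrictFDerivAt Ψ (InnerProductSpace.toDual ℝ Pt (G x)) x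

/-- Normal coordinates. -/
def pp (G : Pt → Pt) (y : Pt) (s : ℝ) : Pt := y + s • ker (G y)

variable {Ψ : Pt → ℝ} {G : Pt → Pt} {S : Set Pt} {K c0 M : ℝ}

namespace Geo

lemma M_pos (h : Geo Ψ G S K c0 M) : 0 < M := by
  obtain ⟨y, hy⟩ := h.nonempty
  exact h.c0_pos.trans_le ((h.lo y hy).trans (h.hi y hy))

lemma ne (h : Geo Ψ G S K c0 M) {y : Pt} (hy : y ∈ S) : G y ≠ 0 :=
  norm_pos_iff.1 (h.c0_pos.trans_le (h.lo y hy))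

lemma normker (h : Geo Ψ G S K c0 M) {y : Pt} (hy : y ∈ S) : ‖ker (G y)‖ ≤ 1 / c0 := by
  rw [norm_ker, ← one_div]
  exact one_div_le_one_div_of_le h.c0_pos (h.lo y hy)

lemma contG (h : Geo Ψ G S K c0 M) : Continuous G := by
  have : LipschitzWith (Real.toNNReal K) G := LipschitzWith.of_dist_le_mul fun x y => by
    rw [dist_eq_norm, dist_eq_norm, Real.coe_toNNReal _ h.K_pos.le]; exact h.lip x y
  exact this.continuous

lemma measG (h : Geo Ψ G S K c0 M) : Measurable G := h.contG.measurable

lemma contOn_ker (h : Geo Ψ G S K c0 M) : ContinuousOn (fun y => ker (G y)) S := by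
  have : ∀ y ∈ S, ContinuousAt (fun y => ker (G y)) y := by
    intro y hy
    unfold ker
    have := h.contG.continuousAt (x := y)
    have h2 : ‖G y‖ ^ 2 ≠ 0 := by
      have := norm_pos_iff.2 (h.ne hy); positivity
    exact ((this.norm.pow 2).inv₀ h2).smul this
  exact fun y hy => (this y hy).continuousWithinAt

lemma taylor (h : Geo Ψ G S K c0 M) (x y : Pt) :
    |Ψ y - Ψ x - ⟪G x, y - x⟫| ≤ K * ‖y - x‖ ^ 2 := by
  have := (convex_closedBall x ‖y - x‖).norm_image_sub_le_of_norm_hasFDerivWithin_le'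
    (f := Ψ) (f' := fun z => InnerProductSpace.toDual ℝ Pt (G z))
    (φ := InnerProductSpace.toDual ℝ Pt (G x)) (C := K * ‖y - x‖)
    (fun z _ => (hasGradientAt_iff_hasFDerivAt.1 (h.grad z)).hasFDerivWithinAt) (fun z hz => ?_)
    (x := x) (y := y) (by simp) (by simp [dist_eq_norm])
  · simpa [pow_two, mul_assoc] using this
  · rw [← map_sub, LinearIsometryEquiv.norm_map]
    refine (h.lip _ _).trans ?_
    have : ‖z - x‖ ≤ ‖y - x‖ := by simpa [dist_eq_norm] using hz
    exact mul_le_mul_of_nonneg_left this h.K_pos.le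

lemma tangent (h : Geo Ψ G S K c0 M) {y y' : Pt} (hy : y ∈ S) (hy' : y' ∈ S) :
    |⟪y - y', G y⟫| ≤ K * ‖y - y'‖ ^ 2 := by
  have := h.taylor y y'
  rw [h.zero y hy, h.zero y' hy', sub_zero, zero_sub, abs_neg, real_inner_comm, norm_sub_rev,
    ← neg_sub, inner_neg_left, abs_neg] at this
  exact this

lemma ker_lip (h : Geo Ψ G S K c0 M) {y y' : Pt} (hy : y ∈ S) (hy' : y' ∈ S) :
    ‖ker (G y) - ker (G y')‖ ≤ K / c0 ^ 2 * ‖y - y'‖ := by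
  have c := h.c0_pos
  have := h.lip y y'
  have h1 := h.lo y hy
  have h2 := h.lo y' hy'
  rw [norm_ker_sub (h.ne hy) (h.ne hy')]
  calc _ ≤ K * ‖y - y'‖ / (c0 * c0) := by gcongr; exact (norm_nonneg _).trans this
    _ = _ := by ring

/-- squared comparison distance -/
def Qd (G : Pt → Pt) (y : Pt) (s : ℝ) (y' : Pt) (s' : ℝ) : ℝ :=
  √(‖y - y'‖ ^ 2 + ((s - s') / ‖G y‖) ^ 2)

lemma bilip (h : Geo Ψ G S K c0 M) {y y' : Pt} (hy : y ∈ S) (hy' : y' ∈ S) {s s' δ : ℝ}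
    (hs : |s| ≤ δ) (hs' : |s'| ≤ δ) (hη : δ * K / c0 ^ 2 ≤ 1 / 10) :
    |‖pp G y s - pp G y' s'‖ - Qd G y s y' s'| ≤ 5 * (δ * K / c0 ^ 2) * Qd G y s y' s' := by
  set η := δ * K / c0 ^ 2 with hη_def
  set Q := Qd G y s y' s' with hQ
  set d := ‖y - y'‖ with hd
  have c := h.c0_pos
  have hK := h.K_pos
  have hδ : 0 ≤ δ := (abs_nonneg s).trans hs
  have hη0 : 0 ≤ η := by positivity
  have hQ0 : 0 ≤ Q := Real.sqrt_nonneg _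
  have hQ2 : Q ^ 2 = d ^ 2 + ((s - s') / ‖G y‖) ^ 2 := Real.sq_sqrt (by positivity)
  have hG := norm_pos_iff.2 (h.ne hy)
  have hd0 : 0 ≤ d := norm_nonneg _
  have hdQ : d ≤ Q := by
    apply le_of_sq_le_sq _ hQ0 |>.trans' le_rfl
    rw [hQ2]; nlinarith [sq_nonneg ((s - s') / ‖G y‖)]
  set v := (y - y') + (s - s') • ker (G y) with hv
  have e : pp G y s - pp G y' s' = v + s' • (ker (G y) - ker (G y')) := by
    simp only [pp, hv]; module
  have hin : |⟪y - y', ker (G y)⟫| ≤ K / c0 ^ 2 * d ^ 2 := by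
    rw [ker, real_inner_smul_right, abs_mul, abs_of_nonneg (by positivity)]
    have h1 := h.tangent hy hy'
    have h2 : (‖G y‖ ^ 2)⁻¹ ≤ (c0 ^ 2)⁻¹ := by
      have := h.lo y hy
      gcongr
    calc _ ≤ (c0 ^ 2)⁻¹ * (K * d ^ 2) := by gcongr
      _ = _ := by ring
  have hv2 : ‖v‖ ^ 2 = Q ^ 2 + 2 * ((s - s') * ⟪y - y', ker (G y)⟫) := by
    rw [hv, @norm_add_sq_real, norm_smul, norm_ker, real_inner_smul_right, hQ2, mul_pow,
      Real.norm_eq_abs, sq_abs, div_eq_mul_inv, mul_pow]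
    ring
  have hcross : |2 * ((s - s') * ⟪y - y', ker (G y)⟫)| ≤ 4 * η * Q ^ 2 := by
    rw [abs_mul, abs_mul, abs_two]
    have h1 : |s - s'| ≤ 2 * δ := (abs_sub _ _).trans (by linarith)
    calc _ ≤ 2 * (2 * δ * (K / c0 ^ 2 * d ^ 2)) := by gcongr
      _ = 4 * η * d ^ 2 := by rw [hη_def]; ring
      _ ≤ _ := by gcongr
  have hc := abs_le.1 hcross
  have hv0 := norm_nonneg v
  have hvQ : |‖v‖ - Q| ≤ 4 * η * Q := by
    rw [abs_le]
    constructor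
    · have : (1 - 4 * η) * Q ≤ ‖v‖ := by
        apply le_of_sq_le_sq _ hv0
        rw [hv2, mul_pow]
        nlinarith [sq_nonneg Q, mul_nonneg hη0 (sq_nonneg Q), mul_nonneg (mul_nonneg hη0 (sq_nonneg Q)) (by linarith : 0 ≤ 1/10 - η)]
      linarith
    · have : ‖v‖ ≤ (1 + 4 * η) * Q := by
        apply le_of_sq_le_sq _ (by positivity)
        rw [hv2, mul_pow]
        nlinarith [sq_nonneg Q, mul_nonneg hη0 (sq_nonneg Q), mul_nonneg (mul_nonneg hη0 (sq_nonneg Q)) hη0]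
      linarith
  have herr : ‖s' • (ker (G y) - ker (G y'))‖ ≤ η * Q := by
    rw [norm_smul, Real.norm_eq_abs]
    calc _ ≤ δ * (K / c0 ^ 2 * d) := by gcongr; exact h.ker_lip hy hy'
      _ = η * d := by rw [hη_def]; ring
      _ ≤ _ := by gcongr
  rw [e]
  have h3 := abs_norm_sub_norm_le (v + s' • (ker (G y) - ker (G y'))) v
  rw [add_sub_cancel_left] at h3
  have h4 := abs_sub_le ‖v + s' • (ker (G y) - ker (G y'))‖ ‖v‖ Q
  linarith

lemma Qd_ge (y y' : Pt) (s s' : ℝ) : ‖y - y'‖ ≤ Qd G y s y' s' := by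
  apply Real.le_sqrt_of_sq_le
  nlinarith [sq_nonneg ((s - s') / ‖G y‖)]

lemma Qd_ge' (h : Geo Ψ G S K c0 M) {y : Pt} (hy : y ∈ S) (y' : Pt) (s s' : ℝ) :
    |s - s'| / M ≤ Qd G y s y' s' := by
  have hG := norm_pos_iff.2 (h.ne hy)
  apply Real.le_sqrt_of_sq_le
  have : (|s - s'| / M) ≤ |s - s'| / ‖G y‖ := by
    have := h.hi y hy
    gcongr
  have h2 := pow_le_pow_left₀ (div_nonneg (abs_nonneg _) h.M_pos.le) this 2
  rw [div_pow, div_pow, sq_abs, ← div_pow, ← div_pow] at h2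
  rw [div_pow, sq_abs, ← div_pow]
  nlinarith [sq_nonneg ‖y - y'‖]

lemma half_dist (h : Geo Ψ G S K c0 M) {y y' : Pt} (hy : y ∈ S) (hy' : y' ∈ S) {s s' δ : ℝ}
    (hs : |s| ≤ δ) (hs' : |s'| ≤ δ) (hη : δ * K / c0 ^ 2 ≤ 1 / 10) :
    ‖y - y'‖ ≤ 2 * ‖pp G y s - pp G y' s'‖ := by
  have := (abs_le.1 (h.bilip hy hy' hs hs' hη)).1
  have h2 := Qd_ge (G := G) y y' s s'
  have : 5 * (δ * K / c0 ^ 2) * Qd G y s y' s' ≤ 1 / 2 * Qd G y s y' s' := by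
    have : 0 ≤ Qd G y s y' s' := Real.sqrt_nonneg _
    gcongr; linarith
  linarith

lemma half_s (h : Geo Ψ G S K c0 M) {y y' : Pt} (hy : y ∈ S) (hy' : y' ∈ S) {s s' δ : ℝ}
    (hs : |s| ≤ δ) (hs' : |s'| ≤ δ) (hη : δ * K / c0 ^ 2 ≤ 1 / 10) :
    |s - s'| ≤ 2 * M * ‖pp G y s - pp G y' s'‖ := by
  have := (abs_le.1 (h.bilip hy hy' hs hs' hη)).1
  have h2 := h.Qd_ge' hy y' s s'
  have : 5 * (δ * K / c0 ^ 2) * Qd G y s y' s' ≤ 1 / 2 * Qd G y s y' s' := by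
    have : 0 ≤ Qd G y s y' s' := Real.sqrt_nonneg _
    gcongr; linarith
  have h3 : |s - s'| / M ≤ 2 * ‖pp G y s - pp G y' s'‖ := by linarith
  rw [div_le_iff₀ h.M_pos] at h3
  linarith

lemma foot (h : Geo Ψ G S K c0 M) (z : Pt) :
    ∃ y ∈ S, ∃ s : ℝ, z = pp G y s ∧ |s| ≤ M * infDist z S := by
  obtain ⟨y, hy, hmin⟩ := h.compact.exists_infDist_eq_dist h.nonempty z
  obtain ⟨V, hV, hSV, hloc⟩ := h.loc
  have hG := norm_pos_iff.2 (h.ne hy)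
  have hext : IsLocalExtrOn (fun x : Pt => ‖x - z‖ ^ 2) {x | Ψ x = Ψ y} y := by
    left
    have : V ∈ 𝓝[{x | Ψ x = Ψ y}] y := mem_nhdsWithin_of_mem_nhds (hV.mem_nhds (hSV hy))
    filter_upwards [this, self_mem_nhdsWithin] with x hxV hx
    have hxS : x ∈ S := hloc x hxV (by rw [hx, h.zero y hy])
    have := infDist_le_dist_of_mem (x := z) hxS
    rw [hmin, dist_comm, dist_comm z x, dist_eq_norm, dist_eq_norm] at this
    gcongr
  have hd : HasStrictFDerivAt (fun x : Pt => ‖x - z‖ ^ 2) (2 • (innerSL ℝ (y - z))) y := by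
    have := (hasStrictFDerivAt_norm_sq (y - z)).comp y ((hasStrictFDerivAt_id y).sub_const z)
    exact this
  obtain ⟨a, b, hab, heq⟩ := hext.exists_multipliers_of_hasStrictFDerivAt_1d (h.strict y) hd
  have hv : a • G y + (2 * b) • (y - z) = 0 := by
    apply ext_inner_right ℝ
    intro w
    have := congrArg (fun f => f w) heq
    simp [inner_add_left, inner_smul_left] at this ⊢
    rw [inner_sub_left]
    linarith
  have hb : b ≠ 0 := by
    rintro rfl
    simp [h.ne hy] at hv
    exact hab (by simp [hv])
  set t := a / (2 * b) with ht
  have hz : z - y = t • G y := by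
    have h2 : (2 * b) • (z - y) = a • G y := by
      rw [← neg_sub y z, smul_neg, ← add_eq_zero_iff_neg_eq']
      rw [add_comm]; rw [add_comm] at hv; simpa [add_comm] using hv
    rw [ht, div_eq_inv_mul, ← smul_smul, ← h2, smul_smul, inv_mul_cancel₀ (by simp [hb]), one_smul]
  refine ⟨y, hy, t * ‖G y‖ ^ 2, ?_, ?_⟩
  · rw [pp, ker, smul_smul, mul_assoc, mul_inv_cancel₀ (by positivity), mul_one, ← hz]; simp
  · rw [hmin, dist_eq_norm, hz, norm_smul, abs_mul, Real.norm_eq_abs, abs_of_nonneg (by positivity : 0 ≤ ‖G y‖ ^ 2)]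
    have := h.hi y hy
    nlinarith [mul_nonneg (abs_nonneg t) hG.le]

/-- foot point -/
def ft (h : Geo Ψ G S K c0 M) (z : Pt) : Pt := (h.foot z).choose

lemma ft_mem (h : Geo Ψ G S K c0 M) (z : Pt) : h.ft z ∈ S := (h.foot z).choose_spec.1

/-- normal coordinate -/
def sc (h : Geo Ψ G S K c0 M) (z : Pt) : ℝ := (h.foot z).choose_spec.2.choose

lemma pp_ft (h : Geo Ψ G S K c0 M) (z : Pt) : pp G (h.ft z) (h.sc z) = z :=
  (h.foot z).choose_spec.2.choose_spec.1.symm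

lemma sc_le (h : Geo Ψ G S K c0 M) (z : Pt) : |h.sc z| ≤ M * infDist z S :=
  (h.foot z).choose_spec.2.choose_spec.2

/-- `δ` is admissible as tube width. -/
def Adm (K c0 M δ : ℝ) : Prop := 0 < δ ∧ (M / c0 * δ) * K / c0 ^ 2 ≤ 1 / 10

lemma one_le (h : Geo Ψ G S K c0 M) : 1 ≤ M / c0 := by
  obtain ⟨y, hy⟩ := h.nonempty
  rw [one_le_div h.c0_pos]
  exact (h.lo y hy).trans (h.hi y hy)

lemma adm_le (h : Geo Ψ G S K c0 M) {δ : ℝ} (hδ : Adm K c0 M δ) : δ * K / c0 ^ 2 ≤ 1 / 10 := by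
  refine le_trans ?_ hδ.2
  have := h.one_le
  have := h.K_pos
  have := h.c0_pos
  have h1 : δ ≤ M / c0 * δ := by nlinarith [hδ.1]
  gcongr

lemma adm_mono (h : Geo Ψ G S K c0 M) {δ δ' : ℝ} (hδ : Adm K c0 M δ) (h0 : 0 < δ') (h1 : δ' ≤ δ) :
    Adm K c0 M δ' := by
  refine ⟨h0, le_trans ?_ hδ.2⟩
  have := h.one_le
  have := h.K_pos
  have := h.c0_pos
  have := h.M_pos
  gcongr

lemma exists_adm (h : Geo Ψ G S K c0 M) : ∃ δ, Adm K c0 M δ := by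
  have := h.K_pos
  have := h.c0_pos
  have := h.M_pos
  refine ⟨c0 ^ 3 / (10 * M * K), by positivity, le_of_eq ?_⟩
  field_simp

lemma infDist_pp (h : Geo Ψ G S K c0 M) {y : Pt} (hy : y ∈ S) (s : ℝ) :
    infDist (pp G y s) S ≤ |s| / c0 := by
  refine (infDist_le_dist_of_mem hy).trans ?_
  rw [dist_eq_norm, pp, add_sub_cancel_left, norm_smul, Real.norm_eq_abs, div_eq_mul_one_div]
  have := h.normker hy
  gcongr

lemma pp_inj (h : Geo Ψ G S K c0 M) {y y' : Pt} (hy : y ∈ S) (hy' : y' ∈ S) {s s' δ : ℝ}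
    (hs : |s| ≤ δ) (hs' : |s'| ≤ δ) (hη : δ * K / c0 ^ 2 ≤ 1 / 10) (heq : pp G y s = pp G y' s') :
    y = y' ∧ s = s' := by
  have h1 := h.half_dist hy hy' hs hs' hη
  have h2 := h.half_s hy hy' hs hs' hη
  rw [heq, sub_self, norm_zero, mul_zero] at h1 h2
  exact ⟨sub_eq_zero.1 (norm_le_zero_iff.1 h1), sub_eq_zero.1 (abs_nonpos_iff.1 h2)⟩

lemma coords (h : Geo Ψ G S K c0 M) {δ : ℝ} (hδ : Adm K c0 M δ) {y : Pt} (hy : y ∈ S) {s : ℝ}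
    (hs : |s| ≤ δ) : h.ft (pp G y s) = y ∧ h.sc (pp G y s) = s := by
  have hM := h.M_pos
  have h1 := h.one_le
  have hc := h.c0_pos
  have h2 : |h.sc (pp G y s)| ≤ M / c0 * δ := by
    refine (h.sc_le _).trans ?_
    calc _ ≤ M * (|s| / c0) := by gcongr; exact h.infDist_pp hy s
      _ = M / c0 * |s| := by ring
      _ ≤ _ := by gcongr
  exact h.pp_inj (h.ft_mem _) hy h2 (hs.trans (by nlinarith [hδ.1])) hδ.2 (h.pp_ft _)

lemma coords_lip (h : Geo Ψ G S K c0 M) {δ : ℝ} (hδ : Adm K c0 M δ) {z z' : Pt}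
    (hz : M * infDist z S ≤ δ) (hz' : M * infDist z' S ≤ δ) :
    ‖h.ft z - h.ft z'‖ ≤ 2 * ‖z - z'‖ ∧ |h.sc z - h.sc z'| ≤ 2 * M * ‖z - z'‖ := by
  have h1 := (h.sc_le z).trans hz
  have h2 := (h.sc_le z').trans hz'
  have a := h.half_dist (h.ft_mem z) (h.ft_mem z') h1 h2 (h.adm_le hδ)
  have b := h.half_s (h.ft_mem z) (h.ft_mem z') h1 h2 (h.adm_le hδ)
  rw [h.pp_ft, h.pp_ft] at a b
  exact ⟨a, b⟩

/-- The tube of width `δ`. -/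
def tube (h : Geo Ψ G S K c0 M) (δ : ℝ) : Set Pt := {z | |h.sc z| < δ}

lemma mem_tube_pp (h : Geo Ψ G S K c0 M) {δ : ℝ} (hδ : Adm K c0 M δ) {y : Pt} (hy : y ∈ S) {s : ℝ}
    (hs : |s| < δ) : pp G y s ∈ h.tube δ := by
  simpa [tube, (h.coords hδ hy hs.le).2] using hs

lemma tube_infDist (h : Geo Ψ G S K c0 M) {δ : ℝ} {z : Pt} (hz : z ∈ h.tube δ) :
    M * infDist z S < M / c0 * δ := by
  have := h.infDist_pp (h.ft_mem z) (h.sc z)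
  rw [h.pp_ft] at this
  have hM := h.M_pos
  have hc := h.c0_pos
  have hz' : |h.sc z| < δ := hz
  calc _ ≤ M * (|h.sc z| / c0) := by gcongr
    _ < M * (δ / c0) := by gcongr
    _ = _ := by ring

lemma isOpen_nbhd (δ : ℝ) : IsOpen {z : Pt | M * infDist z S < δ} :=
  isOpen_lt (continuous_const.mul (continuous_infDist_pt S)) continuous_const

/-- stronger admissibility: one further factor `M / c0`. -/
def Adm2 (K c0 M δ : ℝ) : Prop := 0 < δ ∧ Adm K c0 M (M / c0 * δ)

lemma Adm2.adm (h : Geo Ψ G S K c0 M) {δ : ℝ} (hδ : Adm2 K c0 M δ) : Adm K c0 M δ :=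
  h.adm_mono hδ.2 hδ.1 (by have := h.one_le; nlinarith [hδ.1])

lemma adm2_mono (h : Geo Ψ G S K c0 M) {δ δ' : ℝ} (hδ : Adm2 K c0 M δ) (h0 : 0 < δ')
    (h1 : δ' ≤ δ) : Adm2 K c0 M δ' := by
  have := h.M_pos
  have := h.c0_pos
  exact ⟨h0, h.adm_mono hδ.2 (by positivity) (by gcongr)⟩

lemma exists_adm2 (h : Geo Ψ G S K c0 M) : ∃ δ, Adm2 K c0 M δ := by
  obtain ⟨δ, hδ⟩ := h.exists_adm
  have := h.M_pos
  have := h.c0_pos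
  have := hδ.1
  refine ⟨c0 / M * δ, by positivity, ?_⟩
  convert hδ using 1
  field_simp

lemma contOn (h : Geo Ψ G S K c0 M) {δ : ℝ} (hδ : Adm2 K c0 M δ) :
    ContinuousOn h.ft {z | M * infDist z S < M / c0 * δ} ∧
    ContinuousOn h.sc {z | M * infDist z S < M / c0 * δ} := by
  constructor
  · have : LipschitzOnWith 2 h.ft {z | M * infDist z S < M / c0 * δ} :=
      LipschitzOnWith.of_dist_le_mul fun z hz z' hz' => by
        rw [dist_eq_norm, dist_eq_norm]
        exact (h.coords_lip hδ.2 (le_of_lt hz) (le_of_lt hz')).1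
    exact this.continuousOn
  · have : LipschitzOnWith (Real.toNNReal (2 * M)) h.sc {z | M * infDist z S < M / c0 * δ} :=
      LipschitzOnWith.of_dist_le_mul fun z hz z' hz' => by
        rw [dist_eq_norm, dist_eq_norm, Real.coe_toNNReal _ (by linarith [h.M_pos])]
        exact (h.coords_lip hδ.2 (le_of_lt hz) (le_of_lt hz')).2
    exact this.continuousOn

lemma isOpen_tube (h : Geo Ψ G S K c0 M) {δ : ℝ} (hδ : Adm2 K c0 M δ) : IsOpen (h.tube δ) := by
  have := (h.contOn hδ).2.abs.isOpen_inter_preimage (isOpen_nbhd _) (isOpen_Iio (a := δ))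
  convert this using 1
  ext z
  constructor
  · intro hz
    exact ⟨h.tube_infDist hz, hz⟩
  · intro hz; exact hz.2

lemma contOn_tube (h : Geo Ψ G S K c0 M) {δ : ℝ} (hδ : Adm2 K c0 M δ) :
    ContinuousOn h.ft (h.tube δ) ∧ ContinuousOn h.sc (h.tube δ) :=
  ⟨(h.contOn hδ).1.mono fun _ hz => h.tube_infDist hz,
    (h.contOn hδ).2.mono fun _ hz => h.tube_infDist hz⟩

lemma contOn_pp (h : Geo Ψ G S K c0 M) :
    ContinuousOn (fun q : Pt × ℝ => pp G q.1 q.2) (S ×ˢ Set.univ) := by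
  unfold pp
  have := h.contOn_ker.comp (continuous_fst.continuousOn (s := S ×ˢ (Set.univ : Set ℝ)))
    (fun q hq => hq.1)
  exact continuous_fst.continuousOn.add (continuous_snd.continuousOn.smul this)

lemma meas_pp (h : Geo Ψ G S K c0 M) : Measurable (fun q : Pt × ℝ => pp G q.1 q.2) := by
  unfold pp
  have : Measurable (fun q : Pt × ℝ => ker (G q.1)) :=
    measurable_ker.comp (h.measG.comp measurable_fst)
  exact measurable_fst.add (measurable_snd.smul this)

/-- closed tube -/
def ctube (G : Pt → Pt) (S : Set Pt) (δ : ℝ) : Set Pt :=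
  (fun q : Pt × ℝ => pp G q.1 q.2) '' (S ×ˢ Set.Icc (-δ) δ)

lemma isCompact_ctube (h : Geo Ψ G S K c0 M) (δ : ℝ) : IsCompact (ctube G S δ) :=
  (h.compact.prod isCompact_Icc).image_of_continuousOn
    (h.contOn_pp.mono (Set.prod_mono_right (Set.subset_univ _)))

lemma mem_ctube_iff (h : Geo Ψ G S K c0 M) {δ : ℝ} (hδ : Adm K c0 M δ) {δ' : ℝ} (h1 : δ' ≤ δ)
    {z : Pt} : z ∈ ctube G S δ' ↔ |h.sc z| ≤ δ' := by
  constructor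
  · rintro ⟨⟨y, s⟩, ⟨hy, hs⟩, rfl⟩
    have hs : |s| ≤ δ' := abs_le.2 hs
    have := (h.coords hδ hy (hs.trans h1)).2
    simpa [this] using hs
  · intro hz
    exact ⟨(h.ft z, h.sc z), ⟨h.ft_mem z, abs_le.1 hz⟩, h.pp_ft z⟩

lemma tube_bdd (h : Geo Ψ G S K c0 M) {δ : ℝ} (hδ : Adm K c0 M δ) :
    Bornology.IsBounded (h.tube δ) :=
  (h.isCompact_ctube δ).isBounded.subset fun _ hz => (h.mem_ctube_iff hδ le_rfl).2 (le_of_lt hz)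

/-- `Ψ` along normals -/
lemma psi_pp (h : Geo Ψ G S K c0 M) {y : Pt} (hy : y ∈ S) {s s' δ : ℝ}
    (hs : |s| ≤ δ) (hs' : |s'| ≤ δ) :
    |Ψ (pp G y s) - Ψ (pp G y s') - (s - s')| ≤ K * δ / c0 ^ 2 * |s - s'| := by
  have hc := h.c0_pos
  have hK := h.K_pos
  have hG := norm_pos_iff.2 (h.ne hy)
  have hd : ∀ t ∈ Set.Icc (-δ) δ, HasDerivWithinAt (fun t => Ψ (pp G y t) - t)
      (⟪G (pp G y t), ker (G y)⟫ - 1) (Set.Icc (-δ) δ) t := by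
    intro t _
    have h1 : HasDerivAt (fun t => pp G y t) (ker (G y)) t := by
      unfold pp
      simpa using ((hasDerivAt_id t).smul_const (ker (G y))).const_add y
    have h2 := (hasGradientAt_iff_hasFDerivAt.1 (h.grad (pp G y t))).comp_hasDerivAt t h1
    simp only [InnerProductSpace.toDual_apply_apply] at h2
    exact (h2.sub (hasDerivAt_id t)).hasDerivWithinAt
  have := (convex_Icc (-δ) δ).norm_image_sub_le_of_norm_hasDerivWithin_le (C := K * δ / c0 ^ 2) hd
    (fun t ht => ?_) (x := s') (y := s) (abs_le.1 hs') (abs_le.1 hs)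
  · rw [Real.norm_eq_abs, Real.norm_eq_abs] at this
    convert this using 2; ring
  · have e : ⟪G (pp G y t), ker (G y)⟫ - 1 = ⟪G (pp G y t) - G y, ker (G y)⟫ := by
      rw [inner_sub_left]
      congr 1
      rw [ker, real_inner_smul_right, real_inner_self_eq_norm_sq, inv_mul_cancel₀ (by positivity)]
    rw [e]
    refine (norm_inner_le_norm _ _).trans ?_
    have h1 := h.lip (pp G y t) y
    rw [show pp G y t - y = t • ker (G y) by simp [pp], norm_smul, Real.norm_eq_abs] at h1
    have h2 := h.normker hy
    have h3 : |t| ≤ δ := abs_le.2 ht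
    have h4 : 0 ≤ δ := (abs_nonneg t).trans h3
    calc _ ≤ (K * (|t| * ‖ker (G y)‖)) * ‖ker (G y)‖ := by gcongr
      _ ≤ (K * (δ * (1 / c0))) * (1 / c0) := by gcongr
      _ = _ := by field_simp

lemma psi_sign (h : Geo Ψ G S K c0 M) {y : Pt} (hy : y ∈ S) {s δ : ℝ}
    (hs : |s| ≤ δ) (hη : δ * K / c0 ^ 2 ≤ 1 / 10) : Ψ (pp G y s) < 0 ↔ s < 0 := by
  have h1 := h.psi_pp hy hs (s' := 0) (by simpa using (abs_nonneg s).trans hs)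
  have h0 : pp G y 0 = y := by simp [pp]
  rw [h0, h.zero y hy, sub_zero, sub_zero, mul_comm K] at h1
  have h2 : δ * K / c0 ^ 2 * |s| ≤ 1 / 10 * |s| := by gcongr
  have h3 := abs_le.1 (h1.trans h2)
  constructor
  · intro h4
    by_contra h5
    push Not at h5
    rw [abs_of_nonneg h5] at h3
    linarith
  · intro h4
    rw [abs_of_neg h4] at h3
    linarith

end Geo
end Trap

namespace Trap

/-! ### Measure estimates -/

lemma pt_apply0 (a b : ℝ) : (pt a b) 0 = a := rfl
lemma pt_apply1 (a b : ℝ) : (pt a b) 1 = b := rfl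

lemma pt_sub (a b a' b' : ℝ) : pt a b - pt a' b' = pt (a - a') (b - b') := by
  ext i; fin_cases i <;> rfl

lemma norm_pt_sq (a b : ℝ) : ‖pt a b‖ ^ 2 = a ^ 2 + b ^ 2 := by
  rw [EuclideanSpace.norm_sq_eq]; simp [pt_apply0, pt_apply1]

lemma pt_mp : MeasurePreserving (fun q : ℝ × ℝ => pt q.1 q.2) := by
  have h1 := (volume_preserving_finTwoArrow ℝ).symm
  have h2 := (EuclideanSpace.volume_preserving_symm_measurableEquiv_toLp (Fin 2)).symm
  have := h2.comp h1
  exact this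

lemma vol_slices {E : Set Pt} (hE : MeasurableSet E) :
    volume E = ∫⁻ s : ℝ, volume {a : ℝ | pt a s ∈ E} := by
  rw [← pt_mp.measure_preimage hE.nullMeasurableSet, Measure.volume_eq_prod,
    Measure.prod_apply_symm (pt_mp.measurable hE)]
  rfl

lemma haus_compare {α X Y : Type*} [MetricSpace X] [MetricSpace Y] [MeasurableSpace X]
    [BorelSpace X] [MeasurableSpace Y] [BorelSpace Y] {f : α → X} {g : α → Y} {B : Set α}
    {L : ℝ} (hL : 0 ≤ L) {d : ℝ} (hd : 0 ≤ d)
    (hfg : ∀ a ∈ B, ∀ b ∈ B, dist (f a) (f b) ≤ L * dist (g a) (g b)) :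
    μH[d] (f '' B) ≤ ENNReal.ofReal L ^ d * μH[d] (g '' B) := by
  rcases B.eq_empty_or_nonempty with rfl | ⟨b0, hb0⟩
  · simp
  have : Nonempty α := ⟨b0⟩
  set k := fun y => f (Function.invFunOn g B y) with hk
  have hlip : LipschitzOnWith (Real.toNNReal L) k (g '' B) := by
    refine LipschitzOnWith.of_dist_le_mul fun y hy y' hy' => ?_
    have h1 := Function.invFunOn_mem (f := g) (s := B) hy
    have h2 := Function.invFunOn_mem (f := g) (s := B) hy'
    have := hfg _ h1 _ h2
    rw [Function.invFunOn_eq hy, Function.invFunOn_eq hy'] at this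
    rw [Real.coe_toNNReal _ hL]
    exact this
  have hsub : f '' B ⊆ k '' (g '' B) := by
    rintro _ ⟨b, hb, rfl⟩
    refine ⟨g b, ⟨b, hb, rfl⟩, ?_⟩
    have hy : g b ∈ g '' B := ⟨b, hb, rfl⟩
    have h1 := Function.invFunOn_mem (f := g) (s := B) hy
    have := hfg _ h1 b hb
    rw [Function.invFunOn_eq hy, dist_self, mul_zero] at this
    exact dist_le_zero.1 this
  exact (measure_mono hsub).trans (hlip.hausdorffMeasure_image_le hd)

lemma vol_haus : ∃ c : NNReal, (volume : Measure Pt) = c • (μH[2] : Measure Pt) := by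
  have h : (μH[(2:ℝ)] : Measure Pt).IsAddHaarMeasure := by
    have := isAddHaarMeasure_hausdorffMeasure (E := Pt)
    simpa using this
  exact ⟨_, Measure.isAddLeftInvariant_eq_smul _ _⟩

lemma vol_compare {α : Type*} {f g : α → Pt} {B : Set α} {L : ℝ} (hL : 0 ≤ L)
    (hfg : ∀ a ∈ B, ∀ b ∈ B, dist (f a) (f b) ≤ L * dist (g a) (g b)) :
    volume (f '' B) ≤ ENNReal.ofReal L ^ 2 * volume (g '' B) := by
  obtain ⟨c, hc⟩ := vol_haus
  have := haus_compare hL (d := 2) (by norm_num) hfg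
  rw [hc]
  simp only [Measure.smul_apply]
  calc _ ≤ c • (ENNReal.ofReal L ^ (2:ℝ) * μH[2] (g '' B)) := by gcongr
    _ = _ := by rw [mul_smul_comm]; norm_num

/-- Weighted arclength. -/
def sig (G : Pt → Pt) (S : Set Pt) : Measure Pt :=
  (μH[1].restrict S).withDensity (fun y => ENNReal.ofReal ‖G y‖⁻¹)

section local_chart
variable {G : Pt → Pt} {S : Set Pt} {A : Set Pt} {g0 κ : ℝ}

lemma sig_le (hA : MeasurableSet A) (hAS : A ⊆ S) (hg : 0 < g0)
    (hw : ∀ y ∈ A, g0 ≤ κ * ‖G y‖) (hw0 : ∀ y ∈ A, 0 < ‖G y‖) :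
    sig G S A ≤ ENNReal.ofReal (κ / g0) * μH[1] A := by
  rw [sig, withDensity_apply _ hA, Measure.restrict_restrict hA, Set.inter_eq_left.2 hAS]
  refine (setLIntegral_mono' hA (g := fun _ => ENNReal.ofReal (κ / g0)) fun y hy => ?_).trans ?_
  · apply ENNReal.ofReal_le_ofReal
    have := hw0 y hy
    rw [le_div_iff₀ hg, ← div_eq_inv_mul, div_le_iff₀ this]
    exact hw y hy
  · simp

lemma le_sig (hA : MeasurableSet A) (hAS : A ⊆ S) (hκ : 0 < κ) (hg : 0 < g0)
    (hw : ∀ y ∈ A, ‖G y‖ ≤ κ * g0) (hw0 : ∀ y ∈ A, 0 < ‖G y‖) :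
    μH[1] A ≤ ENNReal.ofReal (κ * g0) * sig G S A := by
  have h1 : ENNReal.ofReal (κ * g0)⁻¹ * μH[1] A ≤ sig G S A := by
    rw [sig, withDensity_apply _ hA, Measure.restrict_restrict hA, Set.inter_eq_left.2 hAS]
    refine le_trans ?_ (setLIntegral_mono' hA (f := fun _ => ENNReal.ofReal (κ * g0)⁻¹) fun y hy => ?_)
    · simp
    · apply ENNReal.ofReal_le_ofReal
      have := hw0 y hy
      exact inv_anti₀ this (hw y hy)
  calc _ = ENNReal.ofReal (κ * g0) * (ENNReal.ofReal (κ * g0)⁻¹ * μH[1] A) := by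
        rw [← mul_assoc, ← ENNReal.ofReal_mul (by positivity), mul_inv_cancel₀ (by positivity)]
        simp
    _ ≤ _ := by gcongr

lemma local_measure [SFinite (sig G S)] {B : Set (Pt × ℝ)} (hB : MeasurableSet B)
    (hBS : ∀ q ∈ B, q.1 ∈ S)
    {p : Pt × ℝ → Pt} {a : Pt → ℝ} (ha : Measurable a) (hκ : 0 < κ) (hg : 0 < g0)
    (h1 : ∀ q ∈ B, ∀ q' ∈ B, dist (p q) (p q') ≤ κ / g0 * dist (pt (a q.1) q.2) (pt (a q'.1) q'.2))
    (h2 : ∀ q ∈ B, ∀ q' ∈ B, dist (pt (a q.1) q.2) (pt (a q'.1) q'.2) ≤ κ * g0 * dist (p q) (p q'))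
    (h3 : ∀ q ∈ B, ∀ q' ∈ B, dist (a q.1) (a q'.1) ≤ g0 * dist q.1 q'.1)
    (h4 : ∀ q ∈ B, ∀ q' ∈ B, dist q.1 q'.1 ≤ κ / g0 * dist (a q.1) (a q'.1))
    (hw1 : ∀ q ∈ B, ‖G q.1‖ ≤ κ * g0) (hw2 : ∀ q ∈ B, g0 ≤ κ * ‖G q.1‖)
    (hw0 : ∀ q ∈ B, 0 < ‖G q.1‖) :
    volume (p '' B) ≤ ENNReal.ofReal (κ ^ 3) * ((sig G S).prod volume) B ∧
    ((sig G S).prod volume) B ≤ ENNReal.ofReal (κ ^ 4) * volume (p '' B) := by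
  set T : Pt × ℝ → Pt := fun q => pt (a q.1) q.2 with hT
  have hTm : Measurable T := by
    have : Measurable fun q : Pt × ℝ => (a q.1, q.2) := by fun_prop
    exact pt_mp.measurable.comp this
  have hTi : Set.InjOn T B := by
    intro q hq q' hq' he
    have e0 : a q.1 = a q'.1 := congrArg (fun z : Pt => z 0) he
    have e1 : q.2 = q'.2 := congrArg (fun z : Pt => z 1) he
    have := h4 q hq q' hq'
    rw [e0, dist_self, mul_zero] at this
    exact Prod.ext (dist_le_zero.1 this) e1
  have hTB : MeasurableSet (T '' B) := hB.image_of_measurable_injOn hTm hTi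
  have hslice : ∀ s : ℝ, {x : ℝ | pt x s ∈ T '' B} = a '' {y | (y, s) ∈ B} := by
    intro s
    ext x
    constructor
    · rintro ⟨⟨y, s'⟩, hq, he⟩
      have e0 : a y = x := congrArg (fun z : Pt => z 0) he
      have e1 : s' = s := congrArg (fun z : Pt => z 1) he
      subst e1
      exact ⟨y, hq, e0⟩
    · rintro ⟨y, hy, rfl⟩
      exact ⟨(y, s), hy, rfl⟩
  have hvT : volume (T '' B) = ∫⁻ s : ℝ, volume (a '' {y | (y, s) ∈ B}) := by
    rw [vol_slices hTB]; simp_rw [hslice]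
  have hν : ((sig G S).prod volume) B = ∫⁻ s : ℝ, sig G S {y | (y, s) ∈ B} := by
    rw [Measure.prod_apply_symm hB]; rfl
  have hms : ∀ s : ℝ, MeasurableSet {y | (y, s) ∈ B} := fun s => measurable_prodMk_right hB
  have A1 : ∀ s : ℝ, volume (a '' {y | (y, s) ∈ B}) ≤
      ENNReal.ofReal (κ * g0 ^ 2) * sig G S {y | (y, s) ∈ B} := by
    intro s
    have := haus_compare (f := a) (g := fun y : Pt => y) (B := {y | (y, s) ∈ B}) hg.le (d := 1)
      (by norm_num) (fun y hy y' hy' => h3 (y, s) hy (y', s) hy')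
    rw [hausdorffMeasure_real, Set.image_id', ENNReal.rpow_one] at this
    have h5 := le_sig (G := G) (hms s) (fun y hy => hBS (y, s) hy) hκ hg (fun y hy => hw1 (y, s) hy)
      (fun y hy => hw0 (y, s) hy)
    calc _ ≤ _ := this
      _ ≤ ENNReal.ofReal g0 * (ENNReal.ofReal (κ * g0) * sig G S {y | (y, s) ∈ B}) := by gcongr
      _ = _ := by
        rw [← mul_assoc, ← ENNReal.ofReal_mul hg.le]; congr 2; ring
  have A2 : ∀ s : ℝ, sig G S {y | (y, s) ∈ B} ≤ ENNReal.ofReal ((κ / g0) ^ 2) *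
      volume (a '' {y | (y, s) ∈ B}) := by
    intro s
    have := haus_compare (g := a) (f := fun y : Pt => y) (B := {y | (y, s) ∈ B}) (L := κ / g0)
      (by positivity) (d := 1)
      (by norm_num) (fun y hy y' hy' => h4 (y, s) hy (y', s) hy')
    rw [hausdorffMeasure_real, Set.image_id', ENNReal.rpow_one] at this
    have h5 := sig_le (G := G) (hms s) (fun y hy => hBS (y, s) hy) hg (fun y hy => hw2 (y, s) hy)
      (fun y hy => hw0 (y, s) hy)
    calc _ ≤ _ := h5
      _ ≤ ENNReal.ofReal (κ / g0) * (ENNReal.ofReal (κ / g0) * volume (a '' {y | (y, s) ∈ B})) := by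
        gcongr
      _ = _ := by
        rw [← mul_assoc, ← ENNReal.ofReal_mul (by positivity)]; congr 2; ring
  constructor
  · calc _ ≤ ENNReal.ofReal (κ / g0) ^ 2 * volume (T '' B) := vol_compare (by positivity) h1
      _ ≤ ENNReal.ofReal (κ / g0) ^ 2 *
          ∫⁻ s : ℝ, ENNReal.ofReal (κ * g0 ^ 2) * sig G S {y | (y, s) ∈ B} := by
        rw [hvT]; exact mul_le_mul_right (lintegral_mono A1) _
      _ = _ := by
        rw [lintegral_const_mul' _ _ ENNReal.ofReal_ne_top, ← hν, ← mul_assoc,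
          ← ENNReal.ofReal_pow (by positivity), ← ENNReal.ofReal_mul (by positivity)]
        congr 2; field_simp
  · calc _ ≤ ∫⁻ s : ℝ, ENNReal.ofReal ((κ / g0) ^ 2) * volume (a '' {y | (y, s) ∈ B}) := by
          rw [hν]; exact lintegral_mono A2
      _ = ENNReal.ofReal ((κ / g0) ^ 2) * volume (T '' B) := by
        rw [lintegral_const_mul' _ _ ENNReal.ofReal_ne_top, ← hvT]
      _ ≤ ENNReal.ofReal ((κ / g0) ^ 2) * (ENNReal.ofReal (κ * g0) ^ 2 * volume (p '' B)) := by
        gcongr; exact vol_compare (by positivity) h2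
      _ = _ := by
        rw [← mul_assoc, ← ENNReal.ofReal_pow (by positivity), ← ENNReal.ofReal_mul (by positivity)]
        congr 2; field_simp

end local_chart
end Trap

namespace Trap

lemma inner_pt (v w : Pt) : ⟪v, w⟫ = v 0 * w 0 + v 1 * w 1 := by
  simp [PiLp.inner_apply, mul_comm]

lemma perp_inner_sq (v w : Pt) : ⟪perp v, w⟫ ^ 2 + ⟪v, w⟫ ^ 2 = (‖v‖ * ‖w‖) ^ 2 := by
  rw [mul_pow, EuclideanSpace.norm_sq_eq, EuclideanSpace.norm_sq_eq, inner_pt, inner_pt]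
  simp [perp, pt_apply0, pt_apply1]
  ring

variable {Ψ : Pt → ℝ} {G : Pt → Pt} {S : Set Pt} {K c0 M : ℝ}
namespace Geo

section chart
variable {θ r : ℝ} {y0 y y' : Pt}

lemma chart_w (h : Geo Ψ G S K c0 M) (hθ : 0 < θ) (hr : 3 * K * r / c0 ≤ θ / 2)
    (hy0 : y0 ∈ S) (hy : y ∈ S) (hyr : ‖y - y0‖ ≤ r) :
    ‖G y‖ ≤ (1 + θ) * ‖G y0‖ ∧ ‖G y0‖ ≤ (1 + θ) * ‖G y‖ := by
  have hc := h.c0_pos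
  have hK := h.K_pos
  rw [div_le_iff₀ hc] at hr
  have h1 := h.lip y y0
  have h2 := abs_norm_sub_norm_le (G y) (G y0)
  have h3 := abs_le.1 (h2.trans h1)
  have h4 : K * ‖y - y0‖ ≤ K * r := by gcongr
  have h6 : 0 ≤ K * r := by have := (norm_nonneg _).trans hyr; positivity
  have h5 := h.lo y hy
  have h7 := h.lo y0 hy0
  constructor <;> nlinarith

lemma chart_a (h : Geo Ψ G S K c0 M) (hθ : 0 < θ) (hθ1 : θ ≤ 1) (hr : 3 * K * r / c0 ≤ θ / 2)
    (hy0 : y0 ∈ S) (hy : y ∈ S) (hyr : ‖y - y0‖ ≤ r) (hy' : y' ∈ S) (hyr' : ‖y' - y0‖ ≤ r) :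
    ‖G y0‖ ^ 2 * ‖y - y'‖ ^ 2 ≤ (1 + θ) ^ 2 * ⟪perp (G y0), y - y'⟫ ^ 2 := by
  have hc := h.c0_pos
  have hK := h.K_pos
  have hid := perp_inner_sq (G y0) (y - y')
  rw [div_le_iff₀ hc] at hr
  have hr0 : 0 ≤ r := (norm_nonneg _).trans hyr
  have h7 := h.lo y0 hy0
  set d := ‖y - y'‖ with hd
  have hd0 : 0 ≤ d := norm_nonneg _
  have hd2 : d ≤ 2 * r := by
    have := norm_sub_le_norm_sub_add_norm_sub y y0 y'
    rw [norm_sub_rev y0] at this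
    linarith
  have hin : |⟪G y0, y - y'⟫| ≤ 3 * K * r * d := by
    have e : ⟪G y0, y - y'⟫ = ⟪y - y', G y⟫ + ⟪G y0 - G y, y - y'⟫ := by
      rw [inner_sub_left (G y0), real_inner_comm (G y) (y - y')]; ring
    rw [e]
    refine (abs_add_le _ _).trans ?_
    have h1 := h.tangent hy hy'
    have h2 := (abs_real_inner_le_norm (G y0 - G y) (y - y'))
    have h3 := h.lip y0 y
    rw [norm_sub_rev y0] at h3
    calc _ ≤ K * d ^ 2 + (K * r) * d := by
          refine add_le_add h1 (h2.trans ?_)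
          gcongr
          exact h3.trans (by gcongr)
      _ ≤ K * (2 * r * d) + K * r * d := by gcongr; nlinarith
      _ = _ := by ring
  have hin2 : ⟪G y0, y - y'⟫ ^ 2 ≤ (θ / 2 * (‖G y0‖ * d)) ^ 2 := by
    rw [← sq_abs]
    gcongr
    refine hin.trans ?_
    calc _ ≤ θ / 2 * c0 * d := by gcongr
      _ ≤ θ / 2 * ‖G y0‖ * d := by gcongr
      _ = _ := by ring
  rw [mul_pow] at hid
  have hx : 0 ≤ ‖G y0‖ ^ 2 * d ^ 2 := by positivity
  set X := ‖G y0‖ ^ 2 * d ^ 2 with hX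
  have hin3 : ⟪G y0, y - y'⟫ ^ 2 ≤ θ ^ 2 / 4 * X := by
    refine hin2.trans (le_of_eq ?_); rw [hX]; ring
  have hP : X - θ ^ 2 / 4 * X ≤ ⟪perp (G y0), y - y'⟫ ^ 2 := by linarith
  have h9 : 1 ≤ (1 + θ) ^ 2 * (1 - θ ^ 2 / 4) := by
    nlinarith [mul_nonneg hθ.le hθ.le, mul_nonneg hθ.le (sub_nonneg.2 hθ1), mul_nonneg (mul_nonneg hθ.le hθ.le) (sub_nonneg.2 hθ1), mul_nonneg (mul_nonneg (mul_nonneg hθ.le hθ.le) hθ.le) (sub_nonneg.2 hθ1)]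
  calc X ≤ ((1 + θ) ^ 2 * (1 - θ ^ 2 / 4)) * X := by nlinarith
    _ = (1 + θ) ^ 2 * (X - θ ^ 2 / 4 * X) := by ring
    _ ≤ _ := by gcongr

lemma chart_a' (y0 y y' : Pt) :
    |⟪perp (G y0), y⟫ - ⟪perp (G y0), y'⟫| ≤ ‖G y0‖ * ‖y - y'‖ := by
  rw [← inner_sub_right]
  apply abs_le_of_sq_le_sq _ (by positivity)
  nlinarith [perp_inner_sq (G y0) (y - y'), sq_nonneg ⟪G y0, y - y'⟫]

lemma chart_a2 (h : Geo Ψ G S K c0 M) (hθ : 0 < θ) (hθ1 : θ ≤ 1) (hr : 3 * K * r / c0 ≤ θ / 2)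
    (hy0 : y0 ∈ S) (hy : y ∈ S) (hyr : ‖y - y0‖ ≤ r) (hy' : y' ∈ S) (hyr' : ‖y' - y0‖ ≤ r) :
    ‖y - y'‖ ≤ (1 + θ) / ‖G y0‖ * |⟪perp (G y0), y⟫ - ⟪perp (G y0), y'⟫| := by
  have := h.chart_a hθ hθ1 hr hy0 hy hyr hy' hyr'
  have hG := norm_pos_iff.2 (h.ne hy0)
  rw [div_mul_eq_mul_div, le_div_iff₀ hG, ← inner_sub_right]
  apply le_of_sq_le_sq _ (by positivity)
  rw [mul_pow, mul_pow, sq_abs]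
  linarith

set_option maxHeartbeats 1000000 in
lemma chart_T (h : Geo Ψ G S K c0 M) (hθ : 0 < θ) (hθ1 : θ ≤ 1) (hr : 3 * K * r / c0 ≤ θ / 2)
    (hy0 : y0 ∈ S) (hy : y ∈ S) (hyr : ‖y - y0‖ ≤ r) (hy' : y' ∈ S) (hyr' : ‖y' - y0‖ ≤ r)
    {s s' δ : ℝ} (hs : |s| ≤ δ) (hs' : |s'| ≤ δ) (hη : δ * K / c0 ^ 2 ≤ θ / 10) :
    ‖pp G y s - pp G y' s'‖ ≤ (1 + θ) ^ 2 / ‖G y0‖ *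
        ‖pt ⟪perp (G y0), y⟫ s - pt ⟪perp (G y0), y'⟫ s'‖ ∧
    ‖pt ⟪perp (G y0), y⟫ s - pt ⟪perp (G y0), y'⟫ s'‖ ≤
        (1 + θ) ^ 2 * ‖G y0‖ * ‖pp G y s - pp G y' s'‖ := by
  have hG0 := norm_pos_iff.2 (h.ne hy0)
  have hG := norm_pos_iff.2 (h.ne hy)
  have hb := abs_le.1 (h.bilip hy hy' hs hs' (hη.trans (by linarith)))
  set Q := Qd G y s y' s' with hQ
  have hQ0 : 0 ≤ Q := Real.sqrt_nonneg _
  have hQ2 : Q ^ 2 = ‖y - y'‖ ^ 2 + ((s - s') / ‖G y‖) ^ 2 := Real.sq_sqrt (by positivity)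
  have h5 : 5 * (δ * K / c0 ^ 2) * Q ≤ θ / 2 * Q := by gcongr; linarith
  have p1 : ‖pp G y s - pp G y' s'‖ ≤ (1 + θ) * Q := by nlinarith
  have p2 : Q ≤ (1 + θ) * ‖pp G y s - pp G y' s'‖ := by
    have h6 : (1 - θ / 2) * Q ≤ ‖pp G y s - pp G y' s'‖ := by linarith
    have h7 : 1 ≤ (1 + θ) * (1 - θ / 2) := by nlinarith
    calc Q ≤ ((1 + θ) * (1 - θ / 2)) * Q := by nlinarith
      _ = (1 + θ) * ((1 - θ / 2) * Q) := by ring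
      _ ≤ _ := by gcongr
  obtain ⟨w1, w2⟩ := h.chart_w hθ hr hy0 hy hyr
  have ca := h.chart_a hθ hθ1 hr hy0 hy hyr hy' hyr'
  have ca' := chart_a' (G := G) y0 y y'
  rw [← inner_sub_right] at ca'
  have ca2 : ⟪perp (G y0), y - y'⟫ ^ 2 ≤ ‖G y0‖ ^ 2 * ‖y - y'‖ ^ 2 := by
    rw [← mul_pow, ← sq_abs]; gcongr
  rw [pt_sub, ← inner_sub_right]
  set P := ⟪perp (G y0), y - y'⟫ with hP
  have hT2 := norm_pt_sq P (s - s')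
  set T := ‖pt P (s - s')‖ with hT
  have hT0 : 0 ≤ T := norm_nonneg _
  have t1 : T ≤ (1 + θ) * (‖G y0‖ * Q) := by
    apply le_of_sq_le_sq _ (by positivity)
    have e : ((1 + θ) * (‖G y0‖ * Q)) ^ 2 = (1 + θ) ^ 2 * (‖G y0‖ ^ 2 * ‖y - y'‖ ^ 2) +
        (((1 + θ) * ‖G y0‖) / ‖G y‖) ^ 2 * (s - s') ^ 2 := by
      rw [mul_pow, mul_pow, hQ2]; field_simp
    rw [hT2, e]
    have f1 : 1 ≤ (1 + θ) ^ 2 := by nlinarith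
    have f2 : 1 ≤ (((1 + θ) * ‖G y0‖) / ‖G y‖) ^ 2 := by
      apply one_le_pow₀; rw [one_le_div hG]; exact w1
    have f3 : 0 ≤ ‖G y0‖ ^ 2 * ‖y - y'‖ ^ 2 := by positivity
    nlinarith [sq_nonneg (s - s')]
  have t2 : ‖G y0‖ * Q ≤ (1 + θ) * T := by
    apply le_of_sq_le_sq _ (by positivity)
    have e : (‖G y0‖ * Q) ^ 2 = (‖G y0‖ ^ 2 * ‖y - y'‖ ^ 2) +
        ((‖G y0‖) / ‖G y‖) ^ 2 * (s - s') ^ 2 := by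
      rw [mul_pow, hQ2]; field_simp
    rw [e, mul_pow, hT2]
    have f2 : ((‖G y0‖) / ‖G y‖) ^ 2 ≤ (1 + θ) ^ 2 := by
      gcongr; rw [div_le_iff₀ hG]; exact w2
    nlinarith [sq_nonneg (s - s')]
  constructor
  · rw [div_mul_eq_mul_div, le_div_iff₀ hG0]
    calc _ ≤ (1 + θ) * Q * ‖G y0‖ := by gcongr
      _ = (1 + θ) * (‖G y0‖ * Q) := by ring
      _ ≤ (1 + θ) * ((1 + θ) * T) := by gcongr
      _ = _ := by ring
  · calc T ≤ _ := t1
      _ ≤ (1 + θ) * (‖G y0‖ * ((1 + θ) * ‖pp G y s - pp G y' s'‖)) := by gcongr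
      _ = _ := by ring

end chart

lemma haus_ball (h : Geo Ψ G S K c0 M) {r : ℝ} (hr0 : 0 < r) (hr : 3 * K * r / c0 ≤ 1 / 2) {y0 : Pt}
    (hy0 : y0 ∈ S) : μH[1] (S ∩ closedBall y0 r) ≤ ENNReal.ofReal (4 * r) := by
  have hG0 := norm_pos_iff.2 (h.ne hy0)
  have := haus_compare (f := fun y : Pt => y) (g := fun y : Pt => ⟪perp (G y0), y⟫)
    (B := S ∩ closedBall y0 r) (L := 2 / ‖G y0‖) (by positivity) (d := 1) (by norm_num)
    (fun y hy y' hy' => by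
      have := h.chart_a2 (θ := 1) one_pos le_rfl hr hy0 hy.1 (by simpa [dist_eq_norm] using hy.2)
        hy'.1 (by simpa [dist_eq_norm] using hy'.2)
      rw [dist_eq_norm, dist_eq_norm, Real.norm_eq_abs]
      norm_num at this ⊢
      exact this)
  rw [hausdorffMeasure_real, Set.image_id', ENNReal.rpow_one] at this
  refine this.trans ?_
  have hsub : (fun y : Pt => ⟪perp (G y0), y⟫) '' (S ∩ closedBall y0 r) ⊆
      closedBall ⟪perp (G y0), y0⟫ (‖G y0‖ * r) := by
    rintro _ ⟨y, hy, rfl⟩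
    have h1 := chart_a' (G := G) y0 y y0
    have h2 : ‖y - y0‖ ≤ r := by simpa [dist_eq_norm] using hy.2
    rw [mem_closedBall, Real.dist_eq]
    exact h1.trans (by gcongr)
  calc _ ≤ ENNReal.ofReal (2 / ‖G y0‖) * ENNReal.ofReal (2 * (‖G y0‖ * r)) := by
        gcongr
        exact (measure_mono hsub).trans (by rw [Real.volume_closedBall])
    _ = _ := by
      rw [← ENNReal.ofReal_mul (by positivity)]; congr 1; field_simp; ring

lemma exists_rad (h : Geo Ψ G S K c0 M) {θ : ℝ} (hθ : 0 < θ) :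
    ∃ r > 0, 3 * K * r / c0 ≤ θ / 2 := by
  have hc := h.c0_pos
  have hK := h.K_pos
  refine ⟨θ * c0 / (6 * K), by positivity, le_of_eq ?_⟩
  field_simp; norm_num

lemma haus_lt_top (h : Geo Ψ G S K c0 M) : μH[1] S < ⊤ := by
  obtain ⟨r, hr0, hr⟩ := h.exists_rad one_pos
  refine h.compact.measure_lt_top_of_nhdsWithin fun y hy => ?_
  refine ⟨S ∩ closedBall y r, inter_mem_nhdsWithin _ (closedBall_mem_nhds y hr0), ?_⟩
  exact (h.haus_ball hr0 hr hy).trans_lt ENNReal.ofReal_lt_top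

lemma sig_le_haus (h : Geo Ψ G S K c0 M) {A : Set Pt} (hA : MeasurableSet A) :
    sig G S A ≤ ENNReal.ofReal (1 / c0) * μH[1] (A ∩ S) := by
  have e : sig G S A = sig G S (A ∩ S) := by
    rw [sig, withDensity_apply _ hA, withDensity_apply _ (hA.inter h.compact.measurableSet),
      Measure.restrict_restrict hA, Measure.restrict_restrict (hA.inter h.compact.measurableSet),
      Set.inter_assoc, Set.inter_self]
  rw [e]
  exact sig_le (hA.inter h.compact.measurableSet) Set.inter_subset_right h.c0_pos
    (fun y hy => by simpa using h.lo y hy.2) (fun y hy => norm_pos_iff.2 (h.ne hy.2))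

lemma sig_finite (h : Geo Ψ G S K c0 M) : IsFiniteMeasure (sig G S) := by
  refine ⟨(h.sig_le_haus MeasurableSet.univ).trans_lt ?_⟩
  rw [Set.univ_inter]
  exact ENNReal.mul_lt_top ENNReal.ofReal_lt_top h.haus_lt_top

lemma sig_compl (h : Geo Ψ G S K c0 M) : sig G S Sᶜ = 0 := by
  have := h.sig_le_haus h.compact.measurableSet.compl
  simpa using this

lemma sig_ball (h : Geo Ψ G S K c0 M) :
    ∃ C : ℝ, 0 < C ∧ ∀ (x : Pt) (r : ℝ), 0 < r → sig G S (closedBall x r) ≤ ENNReal.ofReal (C * r) := by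
  have := h.sig_finite
  have hc := h.c0_pos
  obtain ⟨r1, hr0, hr⟩ := h.exists_rad one_pos
  set m := (sig G S).real Set.univ with hm
  have hm0 : 0 ≤ m := measureReal_nonneg
  refine ⟨8 / c0 + 2 * m / r1, by positivity, fun x r hrp => ?_⟩
  rcases le_or_gt (2 * r) r1 with hle | hlt
  · rcases (closedBall x r ∩ S).eq_empty_or_nonempty with he | ⟨y, hyx, hyS⟩
    · have := h.sig_le_haus (A := closedBall x r) measurableSet_closedBall
      rw [he] at this
      simp at this
      simp [this]
    have hsub : closedBall x r ∩ S ⊆ S ∩ closedBall y (2 * r) := by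
      rintro z ⟨hz, hzS⟩
      refine ⟨hzS, ?_⟩
      rw [mem_closedBall] at *
      have := dist_triangle_right z y x
      linarith
    have h2 : 3 * K * (2 * r) / c0 ≤ 1 / 2 := by
      have := h.K_pos
      refine le_trans ?_ hr
      gcongr
    calc _ ≤ _ := h.sig_le_haus (A := closedBall x r) measurableSet_closedBall
      _ ≤ ENNReal.ofReal (1 / c0) * ENNReal.ofReal (4 * (2 * r)) := by
        gcongr
        exact (measure_mono hsub).trans (h.haus_ball (by positivity) h2 hyS)
      _ = ENNReal.ofReal (8 / c0 * r) := by
        rw [← ENNReal.ofReal_mul (by positivity)]; congr 1; ring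
      _ ≤ _ := by
        apply ENNReal.ofReal_le_ofReal
        gcongr
        linarith [show 0 ≤ 2 * m / r1 by positivity]
  · calc _ ≤ sig G S Set.univ := measure_mono (Set.subset_univ _)
      _ = ENNReal.ofReal m := by rw [hm, ofReal_measureReal]
      _ ≤ _ := by
        apply ENNReal.ofReal_le_ofReal
        have : m ≤ 2 * m / r1 * r := by
          rw [div_mul_eq_mul_div, le_div_iff₀ hr0]; nlinarith
        have : 0 ≤ 8 / c0 * r := by positivity
        linarith

end Geo
end Trap

namespace Trap

variable {Ψ : Pt → ℝ} {G : Pt → Pt} {S : Set Pt} {K c0 M : ℝ}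
namespace Geo

/-- uncurried normal coordinates -/
def pq (G : Pt → Pt) (q : Pt × ℝ) : Pt := pp G q.1 q.2

lemma pq_meas_image (h : Geo Ψ G S K c0 M) {δ : ℝ} (hδ : δ * K / c0 ^ 2 ≤ 1 / 10)
    {B : Set (Pt × ℝ)} (hB : MeasurableSet B) (hBS : ∀ q ∈ B, q.1 ∈ S ∧ |q.2| ≤ δ) :
    MeasurableSet (pq G '' B) ∧ Set.InjOn (pq G) B := by
  have hi : Set.InjOn (pq G) B := by
    intro q hq q' hq' he
    have := h.pp_inj (hBS q hq).1 (hBS q' hq').1 (hBS q hq).2 (hBS q' hq').2 hδ he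
    exact Prod.ext this.1 this.2
  exact ⟨hB.image_of_measurable_injOn h.meas_pp hi, hi⟩

lemma E2 (h : Geo Ψ G S K c0 M) {ε : ℝ} (hε : 0 < ε) : ∃ δ0 > 0, δ0 * K / c0 ^ 2 ≤ 1 / 10 ∧
    ∀ B : Set (Pt × ℝ), MeasurableSet B → (∀ q ∈ B, q.1 ∈ S ∧ |q.2| ≤ δ0) →
      volume (pq G '' B) ≤ ENNReal.ofReal (1 + ε) * ((sig G S).prod volume) B ∧
      ((sig G S).prod volume) B ≤ ENNReal.ofReal (1 + ε) * volume (pq G '' B) := by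
  have := h.sig_finite
  have hc := h.c0_pos
  have hK := h.K_pos
  obtain ⟨θ, hθ0, hθ1, hθ⟩ : ∃ θ : ℝ, 0 < θ ∧ θ ≤ 1 ∧ (1 + θ) ^ 8 ≤ 1 + ε := by
    have hc : ContinuousAt (fun θ : ℝ => (1 + θ) ^ 8) 0 := by fun_prop
    have h1 : ∀ᶠ θ : ℝ in 𝓝[>] 0, (1 + θ) ^ 8 < 1 + ε :=
      (hc.eventually (gt_mem_nhds (by simpa using hε))).filter_mono nhdsWithin_le_nhds
    have h2 : ∀ᶠ θ : ℝ in 𝓝[>] 0, θ ≤ 1 := by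
      have : ∀ᶠ θ : ℝ in 𝓝 0, θ ≤ 1 := eventually_le_nhds one_pos
      exact this.filter_mono nhdsWithin_le_nhds
    obtain ⟨θ, h3, h4, h5⟩ := (h1.and (h2.and self_mem_nhdsWithin)).exists
    exact ⟨θ, h5, h4, h3.le⟩
  obtain ⟨r, hr0, hr⟩ := h.exists_rad hθ0
  set δ0 := θ * c0 ^ 2 / (10 * K) with hδ0
  have hη : δ0 * K / c0 ^ 2 ≤ θ / 10 := le_of_eq (by rw [hδ0]; field_simp)
  refine ⟨δ0, by positivity, hη.trans (by linarith), ?_⟩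
  have key : ∃ A : Set Pt, S ⊆ A ∧ MeasurableSet A ∧ ∀ B : Set (Pt × ℝ), MeasurableSet B →
      (∀ q ∈ B, q.1 ∈ S ∧ |q.2| ≤ δ0) → (∀ q ∈ B, q.1 ∈ A) →
      volume (pq G '' B) ≤ ENNReal.ofReal (1 + ε) * ((sig G S).prod volume) B ∧
      ((sig G S).prod volume) B ≤ ENNReal.ofReal (1 + ε) * volume (pq G '' B) := by
    refine h.compact.induction_on (p := fun s => ∃ A : Set Pt, s ⊆ A ∧ MeasurableSet A ∧
      ∀ B : Set (Pt × ℝ), MeasurableSet B →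
      (∀ q ∈ B, q.1 ∈ S ∧ |q.2| ≤ δ0) → (∀ q ∈ B, q.1 ∈ A) →
      volume (pq G '' B) ≤ ENNReal.ofReal (1 + ε) * ((sig G S).prod volume) B ∧
      ((sig G S).prod volume) B ≤ ENNReal.ofReal (1 + ε) * volume (pq G '' B)) ?_ ?_ ?_ ?_
    · refine ⟨∅, subset_rfl, MeasurableSet.empty, fun B _ _ hB => ?_⟩
      have : B = ∅ := Set.eq_empty_iff_forall_notMem.2 fun q hq => hB q hq
      simp [this]
    · rintro s t hst ⟨A, hA, hAm, hP⟩
      exact ⟨A, hst.trans hA, hAm, hP⟩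
    · rintro s t ⟨A, hA, hAm, hP⟩ ⟨A', hA', hAm', hP'⟩
      refine ⟨A ∪ A', Set.union_subset_union hA hA', hAm.union hAm', fun B hB hBS hBA => ?_⟩
      set B1 := B ∩ Prod.fst ⁻¹' A with hB1
      set B2 := B \ Prod.fst ⁻¹' A with hB2
      have mA : MeasurableSet (Prod.fst ⁻¹' A : Set (Pt × ℝ)) := measurable_fst hAm
      have m1 : MeasurableSet B1 := hB.inter mA
      have m2 : MeasurableSet B2 := hB.diff mA
      have e1 := hP B1 m1 (fun q hq => hBS q hq.1) (fun q hq => hq.2)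
      have e2 := hP' B2 m2 (fun q hq => hBS q hq.1) (fun q hq => (hBA q hq.1).resolve_left hq.2)
      have eB : B = B1 ∪ B2 := (Set.inter_union_sdiff _ _).symm
      have dB : Disjoint B1 B2 := Set.disjoint_sdiff_inter.symm
      obtain ⟨-, hinj⟩ := h.pq_meas_image (hη.trans (by linarith)) hB hBS
      obtain ⟨im2, -⟩ := h.pq_meas_image (hη.trans (by linarith)) m2 (fun q hq => hBS q hq.1)
      have dI : Disjoint (pq G '' B1) (pq G '' B2) := by
        rw [Set.disjoint_left]
        rintro z ⟨q, hq, rfl⟩ ⟨q', hq', he⟩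
        have := hinj hq'.1 hq.1 he
        rw [this] at hq'
        exact Set.disjoint_left.1 dB hq hq'
      have v1 : volume (pq G '' B) = volume (pq G '' B1) + volume (pq G '' B2) := by
        rw [← measure_union dI im2, ← Set.image_union, ← eB]
      have v2 : ((sig G S).prod volume) B =
          ((sig G S).prod volume) B1 + ((sig G S).prod volume) B2 := by
        rw [← measure_union dB m2, ← eB]
      rw [v1, v2, mul_add, mul_add]
      exact ⟨add_le_add e1.1 e2.1, add_le_add e1.2 e2.2⟩
    · intro y0 hy0
      refine ⟨closedBall y0 r, mem_nhdsWithin_of_mem_nhds (closedBall_mem_nhds y0 hr0),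
        closedBall y0 r, subset_rfl, measurableSet_closedBall, fun B hB hBS hBA => ?_⟩
      have hBA' : ∀ q ∈ B, ‖q.1 - y0‖ ≤ r := fun q hq => by
        simpa [dist_eq_norm] using hBA q hq
      have hG0 := norm_pos_iff.2 (h.ne hy0)
      have k1 : 1 + θ ≤ (1 + θ) ^ 2 := by nlinarith
      have := local_measure (G := G) (S := S) (κ := (1 + θ) ^ 2) (g0 := ‖G y0‖) (p := pq G)
        (a := fun y => ⟪perp (G y0), y⟫) hB (fun q hq => (hBS q hq).1)
        (by fun_prop) (by positivity) hG0 ?_ ?_ ?_ ?_ ?_ ?_ ?_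
      · have f1 : ((1 + θ) ^ 2) ^ 3 ≤ 1 + ε := by
          refine le_trans ?_ hθ
          rw [← pow_mul]; exact pow_le_pow_right₀ (by linarith) (by norm_num)
        have f2 : ((1 + θ) ^ 2) ^ 4 ≤ 1 + ε := by rw [← pow_mul]; exact hθ
        refine ⟨this.1.trans ?_, this.2.trans ?_⟩ <;> gcongr
      · intro q hq q' hq'
        rw [dist_eq_norm, dist_eq_norm]
        exact (h.chart_T hθ0 hθ1 hr hy0 (hBS q hq).1 (hBA' q hq) (hBS q' hq').1 (hBA' q' hq')
          (hBS q hq).2 (hBS q' hq').2 hη).1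
      · intro q hq q' hq'
        rw [dist_eq_norm, dist_eq_norm]
        exact (h.chart_T hθ0 hθ1 hr hy0 (hBS q hq).1 (hBA' q hq) (hBS q' hq').1 (hBA' q' hq')
          (hBS q hq).2 (hBS q' hq').2 hη).2
      · intro q hq q' hq'
        rw [Real.dist_eq, dist_eq_norm]
        exact chart_a' y0 q.1 q'.1
      · intro q hq q' hq'
        rw [Real.dist_eq, dist_eq_norm]
        refine (h.chart_a2 hθ0 hθ1 hr hy0 (hBS q hq).1 (hBA' q hq) (hBS q' hq').1
          (hBA' q' hq')).trans ?_
        gcongr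
      · intro q hq
        refine (h.chart_w hθ0 hr hy0 (hBS q hq).1 (hBA' q hq)).1.trans ?_
        gcongr
      · intro q hq
        refine (h.chart_w hθ0 hr hy0 (hBS q hq).1 (hBA' q hq)).2.trans ?_
        gcongr
      · intro q hq
        exact norm_pos_iff.2 (h.ne (hBS q hq).1)
  obtain ⟨A, hSA, -, hP⟩ := key
  exact fun B hB hBS => hP B hB hBS (fun q hq => hSA (hBS q hq).1)

/-- model measure in normal coordinates -/
def nu (G : Pt → Pt) (S : Set Pt) (δ : ℝ) : Measure (Pt × ℝ) :=
  (sig G S).prod (volume.restrict (Set.Ioo (-δ) δ))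

lemma nu_apply (h : Geo Ψ G S K c0 M) (δ : ℝ) {B : Set (Pt × ℝ)} (hB : MeasurableSet B) :
    nu G S δ B = ((sig G S).prod volume) (B ∩ S ×ˢ Set.Ioo (-δ) δ) := by
  have := h.sig_finite
  have hS := h.compact.measurableSet
  have e : (sig G S).restrict S = sig G S := by
    apply Measure.restrict_eq_self_of_ae_mem
    rw [ae_iff]; exact h.sig_compl
  rw [nu, ← e, Measure.prod_restrict, Measure.restrict_apply hB, e]

lemma ae_nu (h : Geo Ψ G S K c0 M) (δ : ℝ) :
    ∀ᵐ q ∂(nu G S δ), q.1 ∈ S ∧ q.2 ∈ Set.Ioo (-δ) δ := by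
  have hm : MeasurableSet (S ×ˢ Set.Ioo (-δ) δ) := h.compact.measurableSet.prod measurableSet_Ioo
  have : nu G S δ (S ×ˢ Set.Ioo (-δ) δ)ᶜ = 0 := by
    rw [h.nu_apply δ hm.compl]; simp
  rw [ae_iff]
  exact this

lemma nu_finite (h : Geo Ψ G S K c0 M) (δ : ℝ) : IsFiniteMeasure (nu G S δ) := by
  have := h.sig_finite
  unfold nu
  infer_instance

lemma tube_measure (h : Geo Ψ G S K c0 M) {ε : ℝ} (hε : 0 < ε) : ∃ δ0 > 0, ∀ δ, δ ≤ δ0 →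
    Adm2 K c0 M δ →
    volume.restrict (h.tube δ) ≤ ENNReal.ofReal (1 + ε) • (nu G S δ).map (pq G) ∧
    (nu G S δ).map (pq G) ≤ ENNReal.ofReal (1 + ε) • volume.restrict (h.tube δ) := by
  obtain ⟨δ0, hδ0, -, hE⟩ := h.E2 hε
  refine ⟨δ0, hδ0, fun δ hδ hadm => ?_⟩
  have hS := h.compact.measurableSet
  have main : ∀ A : Set Pt, MeasurableSet A →
      volume.restrict (h.tube δ) A ≤ ENNReal.ofReal (1 + ε) * (nu G S δ).map (pq G) A ∧
      (nu G S δ).map (pq G) A ≤ ENNReal.ofReal (1 + ε) * volume.restrict (h.tube δ) A := by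
    intro A hA
    have hpm : Measurable (pq G) := h.meas_pp
    have hm := hpm hA
    rw [Measure.map_apply hpm hA, h.nu_apply δ hm, Measure.restrict_apply hA]
    have him : pq G '' (pq G ⁻¹' A ∩ S ×ˢ Set.Ioo (-δ) δ) = A ∩ h.tube δ := by
      ext z
      constructor
      · rintro ⟨q, ⟨hq1, hq2, hq3⟩, rfl⟩
        exact ⟨hq1, h.mem_tube_pp (Adm2.adm h hadm) hq2 (abs_lt.2 hq3)⟩
      · rintro ⟨hzA, hz⟩
        have e : pq G (h.ft z, h.sc z) = z := h.pp_ft z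
        refine ⟨(h.ft z, h.sc z), ⟨?_, h.ft_mem z, abs_lt.1 hz⟩, e⟩
        rw [Set.mem_preimage, e]; exact hzA
    have := hE (pq G ⁻¹' A ∩ S ×ˢ Set.Ioo (-δ) δ) (hm.inter (hS.prod measurableSet_Ioo))
      (fun q hq => ⟨hq.2.1, (abs_lt.2 hq.2.2).le.trans hδ⟩)
    rwa [him] at this
  exact ⟨Measure.le_iff.2 fun A hA => (main A hA).1, Measure.le_iff.2 fun A hA => (main A hA).2⟩

lemma slice_sub (h : Geo Ψ G S K c0 M) {δ s : ℝ} (hδ : Adm K c0 M δ) (hs : |s| ≤ δ) (x : Pt)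
    {r : ℝ} : ∃ y1 : Pt, {y | y ∈ S ∧ pp G y s ∈ closedBall x r} ⊆ closedBall y1 (4 * r) := by
  rcases Set.eq_empty_or_nonempty {y | y ∈ S ∧ pp G y s ∈ closedBall x r} with he | ⟨y1, h1, h2⟩
  · exact ⟨0, by rw [he]; exact Set.empty_subset _⟩
  refine ⟨y1, fun y hy => ?_⟩
  have := h.half_dist hy.1 h1 hs hs (h.adm_le hδ)
  have h4 := hy.2
  rw [mem_closedBall] at *
  have h3 := dist_triangle_right (pp G y s) (pp G y1 s) x
  rw [dist_eq_norm] at h3 ⊢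
  linarith

lemma tube_ball (h : Geo Ψ G S K c0 M) : ∃ δ0 > 0, ∃ C > 0, ∀ δ, δ ≤ δ0 → Adm2 K c0 M δ →
    (volume (h.tube δ) ≤ ENNReal.ofReal (C * δ)) ∧ ∀ (x : Pt) (r : ℝ), 0 < r →
      volume (h.tube δ ∩ closedBall x r) ≤ ENNReal.ofReal (C * δ * r) := by
  have := h.sig_finite
  obtain ⟨δ0, hδ0, hE⟩ := h.tube_measure one_pos
  obtain ⟨C, hC, hball⟩ := h.sig_ball
  set m := (sig G S).real Set.univ with hm
  have hm0 : 0 ≤ m := measureReal_nonneg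
  have hpm : Measurable (pq G) := h.meas_pp
  have hml : m ≤ 4 * C + m := by linarith
  refine ⟨δ0, hδ0, 4 * (4 * C + m), by positivity, fun δ hδ hadm => ?_⟩
  have hδp := hadm.1
  obtain ⟨h1, -⟩ := hE δ hδ hadm
  constructor
  · calc volume (h.tube δ) = volume.restrict (h.tube δ) Set.univ := by simp
      _ ≤ (ENNReal.ofReal (1 + 1) • (nu G S δ).map (pq G)) Set.univ := h1 _
      _ = ENNReal.ofReal (1 + 1) * (ENNReal.ofReal m * ENNReal.ofReal (2 * δ)) := by
        rw [Measure.smul_apply, Measure.map_apply hpm MeasurableSet.univ, Set.preimage_univ, nu,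
          ← Set.univ_prod_univ, Measure.prod_prod, Measure.restrict_apply_univ, Real.volume_Ioo,
          hm, ofReal_measureReal, smul_eq_mul]
        congr 3; ring
      _ = ENNReal.ofReal (4 * m * δ) := by
        rw [← ENNReal.ofReal_mul hm0, ← ENNReal.ofReal_mul (by norm_num)]; congr 1; ring
      _ ≤ _ := by gcongr
  · intro x r hr
    have hs : ∀ s ∈ Set.Ioo (-δ) δ, sig G S {y | pp G y s ∈ closedBall x r} ≤
        ENNReal.ofReal (4 * C * r) := by
      intro s hs
      obtain ⟨y1, hy1⟩ := h.slice_sub (Adm2.adm h hadm) (abs_lt.2 hs).le x (r := r)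
      calc _ ≤ sig G S ({y | y ∈ S ∧ pp G y s ∈ closedBall x r} ∪ Sᶜ) := by
            apply measure_mono
            intro y hy
            by_cases hyS : y ∈ S
            · exact Or.inl ⟨hyS, hy⟩
            · exact Or.inr hyS
        _ ≤ sig G S (closedBall y1 (4 * r)) + 0 := by
            refine (measure_union_le _ _).trans ?_
            rw [h.sig_compl]
            gcongr
        _ ≤ _ := by
            rw [add_zero]
            refine (hball y1 (4 * r) (by positivity)).trans (le_of_eq ?_)
            congr 1; ring
    calc volume (h.tube δ ∩ closedBall x r) = volume.restrict (h.tube δ) (closedBall x r) := by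
          rw [Measure.restrict_apply measurableSet_closedBall, Set.inter_comm]
      _ ≤ (ENNReal.ofReal (1 + 1) • (nu G S δ).map (pq G)) (closedBall x r) := h1 _
      _ = ENNReal.ofReal (1 + 1) *
          ∫⁻ s in Set.Ioo (-δ) δ, sig G S {y | pp G y s ∈ closedBall x r} := by
        rw [Measure.smul_apply, Measure.map_apply hpm measurableSet_closedBall, nu,
          Measure.prod_apply_symm (hpm measurableSet_closedBall)]
        rfl
      _ ≤ ENNReal.ofReal (1 + 1) * ∫⁻ s in Set.Ioo (-δ) δ, ENNReal.ofReal (4 * C * r) := by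
        gcongr ENNReal.ofReal (1 + 1) * ?_
        exact setLIntegral_mono' measurableSet_Ioo hs
      _ = ENNReal.ofReal (4 * (4 * C) * δ * r) := by
        rw [setLIntegral_const, Real.volume_Ioo, ← ENNReal.ofReal_mul (by positivity),
          ← ENNReal.ofReal_mul (by norm_num)]
        congr 1; ring
      _ ≤ _ := by gcongr; linarith

end Geo
end Trap

namespace Trap

lemma lint_tail {a B : ℝ} (ha : 0 < a) (hB : 0 ≤ B) :
    ∫⁻ t in Set.Ioi a, ENNReal.ofReal (B * t ^ (-2 : ℝ)) = ENNReal.ofReal (B / a) := by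
  have hi : IntegrableOn (fun t : ℝ => B * t ^ (-2 : ℝ)) (Set.Ioi a) :=
    (integrableOn_Ioi_rpow_of_lt (by norm_num) ha).const_mul B
  rw [← ofReal_integral_eq_lintegral_ofReal hi, integral_const_mul,
    integral_Ioi_rpow_of_lt (by norm_num) ha]
  · congr 1
    norm_num
    rw [Real.rpow_neg_one, div_eq_mul_inv]
  · filter_upwards [ae_restrict_mem measurableSet_Ioi] with t ht
    have : (0:ℝ) < t := ha.trans ht
    show (0:ℝ) ≤ B * t ^ (-2 : ℝ)
    positivity

lemma lint_inv {b B : ℝ} (hb : 1 ≤ b) (hB : 0 ≤ B) :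
    ∫⁻ t in Set.Ioc 1 b, ENNReal.ofReal (B * t⁻¹) = ENNReal.ofReal (B * log b) := by
  have hi : IntervalIntegrable (fun t : ℝ => B * t⁻¹) volume 1 b := by
    apply IntervalIntegrable.const_mul
    apply intervalIntegral.intervalIntegrable_inv
    · intro x hx
      rw [Set.uIcc_of_le hb] at hx
      linarith [hx.1]
    · fun_prop
  rw [← ofReal_integral_eq_lintegral_ofReal hi.1, ← intervalIntegral.integral_of_le hb,
    intervalIntegral.integral_const_mul, integral_inv_of_pos one_pos (by linarith), div_one]
  filter_upwards [ae_restrict_mem measurableSet_Ioc] with t ht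
  have : (0:ℝ) < t := by linarith [ht.1]
  show (0:ℝ) ≤ B * t⁻¹
  positivity

lemma lt_inv_norm {x z : Pt} {t : ℝ} (ht : 0 < t) (h : t < ‖x - z‖⁻¹) : z ∈ closedBall x t⁻¹ := by
  rw [mem_closedBall, dist_comm, dist_eq_norm]
  have h0 : 0 < ‖x - z‖ := by
    by_contra h1
    have : ‖x - z‖ = 0 := le_antisymm (not_lt.1 h1) (norm_nonneg _)
    rw [this] at h; simp at h; linarith
  rw [lt_inv_comm₀ ht h0] at h
  exact h.le

variable {Ψ : Pt → ℝ} {G : Pt → Pt} {S : Set Pt} {K c0 M : ℝ}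
namespace Geo

lemma E1 (h : Geo Ψ G S K c0 M) : ∃ δ0 > 0, ∃ C > 0, ∀ δ, δ ≤ δ0 → δ ≤ 1 → Adm2 K c0 M δ →
    ∀ x : Pt, ∫⁻ z in h.tube δ, ENNReal.ofReal (‖x - z‖⁻¹) ≤
      ENNReal.ofReal (C * (δ * (1 + log δ⁻¹))) := by
  obtain ⟨δ0, hδ0, C, hC, hE⟩ := h.tube_ball
  obtain ⟨V, hV0, hV⟩ : ∃ V : ℝ, 0 ≤ V ∧ ∀ (x : Pt) (r : ℝ), 0 < r →
      volume (closedBall x r) = ENNReal.ofReal (V * r ^ 2) := by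
    refine ⟨volume.real (ball (0:Pt) 1), measureReal_nonneg, fun x r hr => ?_⟩
    rw [Measure.addHaar_closedBall _ _ hr.le, mul_comm, ENNReal.ofReal_mul measureReal_nonneg,
      ofReal_measureReal measure_ball_lt_top.ne]
    simp
  refine ⟨δ0, hδ0, C + V, by positivity, fun δ hδ hδ1 hadm x => ?_⟩
  have hδp := hadm.1
  obtain ⟨h1, h2⟩ := hE δ hδ hadm
  have hb : 1 ≤ δ⁻¹ := (one_le_inv₀ hδp).2 hδ1
  have hlog : 0 ≤ log δ⁻¹ := log_nonneg hb
  rw [lintegral_eq_lintegral_meas_lt _ (Eventually.of_forall fun z => by positivity)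
    (by fun_prop)]
  have hsplit : Set.Ioi (0:ℝ) ⊆ Set.Ioc 0 1 ∪ (Set.Ioc 1 δ⁻¹ ∪ Set.Ioi δ⁻¹) := by
    intro t ht
    by_cases a : t ≤ 1
    · exact Or.inl ⟨ht, a⟩
    by_cases b : t ≤ δ⁻¹
    · exact Or.inr (Or.inl ⟨not_le.1 a, b⟩)
    · exact Or.inr (Or.inr (not_le.1 b))
  refine (lintegral_mono_set hsplit).trans ?_
  refine (lintegral_union_le _ _ _).trans ?_
  have i1 : ∫⁻ t in Set.Ioc (0:ℝ) 1, volume.restrict (h.tube δ) {z | t < ‖x - z‖⁻¹} ≤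
      ENNReal.ofReal (C * δ) := by
    calc _ ≤ ∫⁻ t in Set.Ioc (0:ℝ) 1, ENNReal.ofReal (C * δ) := by
          apply lintegral_mono
          intro t
          refine (measure_mono (Set.subset_univ _)).trans ?_
          rw [Measure.restrict_apply_univ]; exact h1
      _ = _ := by simp
  have i2 : ∫⁻ t in Set.Ioc (1:ℝ) δ⁻¹, volume.restrict (h.tube δ) {z | t < ‖x - z‖⁻¹} ≤
      ENNReal.ofReal (C * δ * log δ⁻¹) := by
    rw [← lint_inv hb (by positivity)]
    apply setLIntegral_mono' measurableSet_Ioc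
    intro t ht
    have ht0 : 0 < t := one_pos.trans ht.1
    refine le_trans ?_ (h2 x t⁻¹ (by positivity))
    rw [Set.inter_comm, ← Measure.restrict_apply measurableSet_closedBall]
    exact measure_mono fun z hz => lt_inv_norm ht0 hz
  have i3 : ∫⁻ t in Set.Ioi δ⁻¹, volume.restrict (h.tube δ) {z | t < ‖x - z‖⁻¹} ≤
      ENNReal.ofReal (V / δ⁻¹) := by
    rw [← lint_tail (by positivity) hV0]
    apply setLIntegral_mono' measurableSet_Ioi
    intro t ht
    have ht0 : 0 < t := (by positivity : 0 < δ⁻¹).trans ht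
    calc _ ≤ volume.restrict (h.tube δ) (closedBall x t⁻¹) :=
          measure_mono fun z hz => lt_inv_norm ht0 hz
      _ ≤ volume (closedBall x t⁻¹) := Measure.restrict_apply_le _ _
      _ = _ := by
          rw [hV x _ (by positivity)]
          congr 2
          rw [Real.rpow_neg ht0.le]; simp
  calc _ ≤ ENNReal.ofReal (C * δ) + (ENNReal.ofReal (C * δ * log δ⁻¹) +
        ENNReal.ofReal (V / δ⁻¹)) :=
        add_le_add i1 ((lintegral_union_le _ _ _).trans (add_le_add i2 i3))
    _ = ENNReal.ofReal (C * δ + (C * δ * log δ⁻¹ + V / δ⁻¹)) := by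
        rw [← ENNReal.ofReal_add (by positivity) (by positivity),
          ← ENNReal.ofReal_add (by positivity) (by positivity)]
    _ ≤ _ := by
        apply ENNReal.ofReal_le_ofReal
        rw [div_inv_eq_mul]
        have : 0 ≤ V * δ * log δ⁻¹ := by positivity
        nlinarith

lemma sig_sqrt (h : Geo Ψ G S K c0 M) : ∃ C > 0, ∀ x : Pt,
    ∫⁻ y, ENNReal.ofReal (√‖x - y‖)⁻¹ ∂(sig G S) ≤ ENNReal.ofReal C := by
  have := h.sig_finite
  obtain ⟨C, hC, hball⟩ := h.sig_ball
  have hm0 : 0 ≤ (sig G S).real Set.univ := measureReal_nonneg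
  refine ⟨(sig G S).real Set.univ + C, by positivity, fun x => ?_⟩
  rw [lintegral_eq_lintegral_meas_lt _ (Eventually.of_forall fun z => by positivity)
    (by fun_prop)]
  have hsplit : Set.Ioi (0:ℝ) ⊆ Set.Ioc 0 1 ∪ Set.Ioi 1 := by
    rw [Set.Ioc_union_Ioi_eq_Ioi zero_le_one]
  refine (lintegral_mono_set hsplit).trans ?_
  refine (lintegral_union_le _ _ _).trans ?_
  rw [ENNReal.ofReal_add hm0 hC.le, ofReal_measureReal]
  refine add_le_add ?_ ?_
  · calc _ ≤ ∫⁻ t in Set.Ioc (0:ℝ) 1, sig G S Set.univ := by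
          apply lintegral_mono
          intro t
          exact measure_mono (Set.subset_univ _)
      _ = _ := by simp
  · rw [← div_one C, ← lint_tail one_pos hC.le]
    apply setLIntegral_mono' measurableSet_Ioi
    intro t ht
    have ht0 : 0 < t := one_pos.trans ht
    refine le_trans ?_ (hball x (t ^ (-2:ℝ)) (by positivity))
    apply measure_mono
    intro y hy
    have hy : t < (√‖x - y‖)⁻¹ := hy
    have h0 : 0 < √‖x - y‖ := by
      by_contra h1
      have : √‖x - y‖ = 0 := le_antisymm (not_lt.1 h1) (sqrt_nonneg _)
      rw [this] at hy; simp at hy; linarith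
    rw [lt_inv_comm₀ ht0 h0, Real.sqrt_lt' (by positivity)] at hy
    rw [mem_closedBall, dist_comm, dist_eq_norm, Real.rpow_neg ht0.le]
    simpa using hy.le

end Geo
end Trap

namespace Trap

lemma compare_nonneg {α : Type*} [MeasurableSpace α] {l μ : Measure α} {ε : ℝ} (hε : 0 ≤ ε)
    (h1 : l ≤ ENNReal.ofReal (1 + ε) • μ) (h2 : μ ≤ ENNReal.ofReal (1 + ε) • l) {f : α → ℝ}
    (hf : Integrable f μ) (h0 : ∀ x, 0 ≤ f x) :
    Integrable f l ∧ |∫ x, f x ∂l - ∫ x, f x ∂μ| ≤ ε * ∫ x, f x ∂μ := by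
  have i1 : Integrable f (ENNReal.ofReal (1 + ε) • μ) := hf.smul_measure ENNReal.ofReal_ne_top
  have i2 : Integrable f l := i1.mono_measure h1
  have i3 : Integrable f (ENNReal.ofReal (1 + ε) • l) := i2.smul_measure ENNReal.ofReal_ne_top
  refine ⟨i2, ?_⟩
  have e1 := integral_mono_measure h1 (Eventually.of_forall h0) i1
  have e2 := integral_mono_measure h2 (Eventually.of_forall h0) i3
  rw [integral_smul_measure, ENNReal.toReal_ofReal (by linarith), smul_eq_mul] at e1 e2
  have e3 : 0 ≤ ∫ x, f x ∂μ := integral_nonneg h0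
  have e4 : 0 ≤ ∫ x, f x ∂l := integral_nonneg h0
  rw [abs_le]
  constructor <;> nlinarith

lemma compare_meas {α : Type*} [MeasurableSpace α] {l μ : Measure α} {ε : ℝ} (hε : 0 ≤ ε)
    (h1 : l ≤ ENNReal.ofReal (1 + ε) • μ) (h2 : μ ≤ ENNReal.ofReal (1 + ε) • l) {f : α → ℝ}
    (hf : Integrable f μ) :
    |∫ x, f x ∂l - ∫ x, f x ∂μ| ≤ ε * ∫ x, |f x| ∂μ := by
  obtain ⟨i1, e1⟩ := compare_nonneg hε h1 h2 hf.pos_part (fun x => le_max_right _ _)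
  obtain ⟨i2, e2⟩ := compare_nonneg hε h1 h2 hf.neg_part (fun x => le_max_right _ _)
  have ef : ∀ x, f x = max (f x) 0 - max (-f x) 0 := fun x => by
    rcases le_total 0 (f x) with h | h
    · rw [max_eq_left h, max_eq_right (by linarith)]; ring
    · rw [max_eq_right h, max_eq_left (by linarith)]; ring
  have ea : ∀ x, |f x| = max (f x) 0 + max (-f x) 0 := fun x => by
    rcases le_total 0 (f x) with h | h
    · rw [max_eq_left h, max_eq_right (by linarith), abs_of_nonneg h]; ring
    · rw [max_eq_right h, max_eq_left (by linarith), abs_of_nonpos h]; ring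
  have e3 : ∫ x, f x ∂l = ∫ x, max (f x) 0 ∂l - ∫ x, max (-f x) 0 ∂l := by
    rw [← integral_sub i1 i2]; exact integral_congr_ae (Eventually.of_forall ef)
  have e4 : ∫ x, f x ∂μ = ∫ x, max (f x) 0 ∂μ - ∫ x, max (-f x) 0 ∂μ := by
    rw [← integral_sub hf.pos_part hf.neg_part]
    exact integral_congr_ae (Eventually.of_forall ef)
  have e5 : ∫ x, |f x| ∂μ = ∫ x, max (f x) 0 ∂μ + ∫ x, max (-f x) 0 ∂μ := by
    rw [← integral_add hf.pos_part hf.neg_part]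
    exact integral_congr_ae (Eventually.of_forall ea)
  rw [e3, e4, e5]
  rw [abs_le] at *
  constructor <;> linarith

lemma int_if {δ a : ℝ} (ha : |a| ≤ δ) :
    ∫ s in Set.Ioo (-δ) δ, (if s < a then (1:ℝ) else 0) = a + δ := by
  have : (fun s : ℝ => if s < a then (1:ℝ) else 0) = (Set.Iio a).indicator 1 := by
    ext s; simp [Set.indicator]
  rw [abs_le] at ha
  rw [this, setIntegral_indicator measurableSet_Iio, Set.Ioo_inter_Iio, min_eq_right ha.2]
  simp [Measure.real]
  linarith [ha.1]

lemma integrable_if (δ a : ℝ) :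
    IntegrableOn (fun s : ℝ => if s < a then (1:ℝ) else 0) (Set.Ioo (-δ) δ) := by
  refine Measure.integrableOn_of_bounded (M := 1) (by simp) ?_ ?_
  · exact (Measurable.ite measurableSet_Iio measurable_const measurable_const).aestronglyMeasurable
  · refine Eventually.of_forall fun s => ?_
    split_ifs <;> simp

/-- signed indicator of the region between two graphs -/
def XX (u1 u2 : Pt → ℝ) (q : Pt × ℝ) : ℝ :=
  (if q.2 < u1 q.1 then 1 else 0) - (if q.2 < u2 q.1 then 1 else 0)

lemma XX_meas {u1 u2 : Pt → ℝ} (h1 : Measurable u1) (h2 : Measurable u2) :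
    Measurable (XX u1 u2) := by
  refine Measurable.sub ?_ ?_
  · exact Measurable.ite (measurableSet_lt measurable_snd (h1.comp measurable_fst))
      measurable_const measurable_const
  · exact Measurable.ite (measurableSet_lt measurable_snd (h2.comp measurable_fst))
      measurable_const measurable_const

lemma XX_abs_le (u1 u2 : Pt → ℝ) (q) : |XX u1 u2 q| ≤ 1 := by
  unfold XX; split_ifs <;> simp

lemma int_XX {u1 u2 : Pt → ℝ} {δ : ℝ} {y : Pt} (h1 : |u1 y| ≤ δ) (h2 : |u2 y| ≤ δ) :
    ∫ s in Set.Ioo (-δ) δ, XX u1 u2 (y, s) = u1 y - u2 y := by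
  unfold XX
  simp only
  rw [integral_sub (integrable_if _ _) (integrable_if _ _), int_if h1, int_if h2]
  ring

lemma int_abs_XX {u1 u2 : Pt → ℝ} {δ : ℝ} {y : Pt} (h1 : |u1 y| ≤ δ) (h2 : |u2 y| ≤ δ) :
    ∫ s in Set.Ioo (-δ) δ, |XX u1 u2 (y, s)| = |u1 y - u2 y| := by
  rcases le_total (u2 y) (u1 y) with h | h
  · rw [abs_of_nonneg (sub_nonneg.2 h), ← int_XX h1 h2]
    congr 1; ext s
    apply abs_of_nonneg
    unfold XX
    simp only
    split_ifs <;> first | linarith | norm_num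
  · rw [abs_of_nonpos (sub_nonpos.2 h), ← int_XX h1 h2, ← integral_neg]
    congr 1; ext s
    apply abs_of_nonpos
    unfold XX
    simp only
    split_ifs <;> first | linarith | norm_num

lemma abs_log_le_sqrt {b D : ℝ} (hb : 0 < b) (hD : b ≤ D) : |log b| ≤ 2 * (D + 1) * (√b)⁻¹ := by
  have hs := Real.sqrt_pos.2 hb
  have := abs_log_le hs.le
  rw [Real.log_sqrt hb.le] at this
  have e : √b = b * (√b)⁻¹ := by
    rw [eq_mul_inv_iff_mul_eq₀ hs.ne']; exact Real.mul_self_sqrt hb.le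
  have e2 : b * (√b)⁻¹ ≤ D * (√b)⁻¹ := by gcongr
  rw [abs_div, abs_of_pos (by norm_num : (0:ℝ) < 2)] at this
  nlinarith

variable {Ψ : Pt → ℝ} {G : Pt → Pt} {S : Set Pt} {K c0 M : ℝ}
namespace Geo

lemma sig_ne (h : Geo Ψ G S K c0 M) (x : Pt) : ∀ᵐ y ∂(sig G S), y ≠ x := by
  obtain ⟨C, hC, hb⟩ := h.sig_ball
  rw [ae_iff]
  simp only [ne_eq, not_not, Set.ofPred_eq_eq_singleton]
  refine le_antisymm ?_ bot_le
  have ht : Tendsto (fun r : ℝ => ENNReal.ofReal (C * r)) (𝓝[>] 0) (𝓝 0) := by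
    have : Continuous fun r : ℝ => ENNReal.ofReal (C * r) :=
      ENNReal.continuous_ofReal.comp (by fun_prop)
    have := (this.tendsto 0).mono_left (nhdsWithin_le_nhds (s := Set.Ioi 0))
    simpa using this
  refine ge_of_tendsto ht ?_
  filter_upwards [self_mem_nhdsWithin] with r hr
  refine le_trans (measure_mono ?_) (hb x r hr)
  rintro y rfl
  exact mem_closedBall_self (le_of_lt hr)

lemma sig_sqrt_int (h : Geo Ψ G S K c0 M) : ∃ C > 0, ∀ x : Pt,
    Integrable (fun y => (√‖x - y‖)⁻¹) (sig G S) ∧ ∫ y, (√‖x - y‖)⁻¹ ∂(sig G S) ≤ C := by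
  obtain ⟨C, hC, hb⟩ := h.sig_sqrt
  have hm : ∀ x : Pt, Measurable fun y : Pt => (√‖x - y‖)⁻¹ := fun x => by fun_prop
  refine ⟨C, hC, fun x => ⟨⟨(hm x).aestronglyMeasurable, ?_⟩, ?_⟩⟩
  · rw [hasFiniteIntegral_iff_ofReal (Eventually.of_forall fun y => by positivity)]
    exact (hb x).trans_lt ENNReal.ofReal_lt_top
  · rw [integral_eq_lintegral_of_nonneg_ae (Eventually.of_forall fun y => by positivity)
      (hm x).aestronglyMeasurable]
    exact ENNReal.toReal_le_of_le_ofReal hC.le (hb x)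

/-- integrals against the model measure -/
lemma nu_XX (h : Geo Ψ G S K c0 M) {δ d : ℝ} {u1 u2 : Pt → ℝ} (m1 : Measurable u1)
    (m2 : Measurable u2) (b1 : ∀ y, |u1 y| ≤ δ) (b2 : ∀ y, |u2 y| ≤ δ)
    (hd : ∀ y ∈ S, |u1 y - u2 y| ≤ d) {g : Pt → ℝ} (hg : Integrable g (sig G S)) :
    Integrable (fun q => XX u1 u2 q * g q.1) (nu G S δ) ∧
    ∫ q, XX u1 u2 q * g q.1 ∂(nu G S δ) = ∫ y, (u1 y - u2 y) * g y ∂(sig G S) ∧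
    ((∀ y, 0 ≤ g y) → ∫ q, |XX u1 u2 q| * g q.1 ∂(nu G S δ) ≤ d * ∫ y, g y ∂(sig G S)) := by
  have := h.sig_finite
  have hgf : Integrable (fun q : Pt × ℝ => g q.1) (nu G S δ) := by
    unfold nu; exact hg.comp_fst _
  have hX : Measurable (XX u1 u2) := XX_meas m1 m2
  have i1 : Integrable (fun q => XX u1 u2 q * g q.1) (nu G S δ) := by
    refine hgf.mono (hX.aestronglyMeasurable.mul hgf.aestronglyMeasurable) ?_
    refine Eventually.of_forall fun q => ?_
    rw [norm_mul]
    exact mul_le_of_le_one_left (norm_nonneg _) (XX_abs_le _ _ _)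
  have i2 : Integrable (fun q => |XX u1 u2 q| * g q.1) (nu G S δ) := by
    refine hgf.mono (hX.abs.aestronglyMeasurable.mul hgf.aestronglyMeasurable) ?_
    refine Eventually.of_forall fun q => ?_
    rw [norm_mul, norm_abs_eq_norm]
    exact mul_le_of_le_one_left (norm_nonneg _) (XX_abs_le _ _ _)
  refine ⟨i1, ?_, fun g0 => ?_⟩
  · unfold nu at i1 ⊢
    rw [integral_prod _ i1]
    congr 1; ext y
    simp only
    rw [integral_mul_const, int_XX (b1 y) (b2 y)]
  · have e : ∫ q, |XX u1 u2 q| * g q.1 ∂(nu G S δ) = ∫ y, |u1 y - u2 y| * g y ∂(sig G S) := by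
      unfold nu at i2 ⊢
      rw [integral_prod _ i2]
      congr 1; ext y
      simp only
      rw [integral_mul_const, int_abs_XX (b1 y) (b2 y)]
    rw [e, ← integral_const_mul]
    have hS : ∀ᵐ y ∂(sig G S), y ∈ S := by rw [ae_iff]; exact h.sig_compl
    refine integral_mono_of_nonneg (Eventually.of_forall fun y => ?_) (hg.const_mul d) ?_
    · exact mul_nonneg (abs_nonneg _) (g0 y)
    · filter_upwards [hS] with y hy
      exact mul_le_mul_of_nonneg_right (hd y hy) (g0 y)

/-- pointwise kernel comparison -/
lemma log_pp (h : Geo Ψ G S K c0 M) {δ : ℝ} (hδ : Adm K c0 M δ) {y0 y : Pt} (hy0 : y0 ∈ S)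
    (hy : y ∈ S) {s0 s : ℝ} (hs0 : |s0| ≤ δ) (hs : |s| ≤ δ) (hne : y ≠ y0) :
    |log ‖pp G y0 s0 - pp G y s‖ - log ‖y0 - y‖| ≤ 6 * √(2 * δ / c0) * (√‖y0 - y‖)⁻¹ := by
  have hc := h.c0_pos
  have hb : 0 < ‖y0 - y‖ := norm_pos_iff.2 (sub_ne_zero.2 hne.symm)
  have hd := h.half_dist hy0 hy hs0 hs (h.adm_le hδ)
  have ha : 0 < ‖pp G y0 s0 - pp G y s‖ := by linarith
  refine (abs_log_sub_le_sqrt ha hb).trans ?_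
  have e1 : (√‖pp G y0 s0 - pp G y s‖)⁻¹ ≤ 2 * (√‖y0 - y‖)⁻¹ := by
    rw [← div_eq_mul_inv, inv_le_comm₀ (Real.sqrt_pos.2 ha) (by positivity), inv_div,
      div_le_iff₀ two_pos]
    have : (2:ℝ) = √4 := by
      rw [show (4:ℝ) = 2 ^ 2 by norm_num]; rw [Real.sqrt_sq (by norm_num)]
    rw [this, ← Real.sqrt_mul ha.le]
    apply Real.sqrt_le_sqrt
    linarith
  have e2 : |‖pp G y0 s0 - pp G y s‖ - ‖y0 - y‖| ≤ 2 * δ / c0 := by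
    refine (abs_norm_sub_norm_le _ _).trans ?_
    have : pp G y0 s0 - pp G y s - (y0 - y) = s0 • ker (G y0) - s • ker (G y) := by
      unfold pp; abel
    rw [this]
    refine (norm_sub_le _ _).trans ?_
    rw [norm_smul, norm_smul, Real.norm_eq_abs, Real.norm_eq_abs]
    have := mul_le_mul hs0 (h.normker hy0) (norm_nonneg _) hδ.1.le
    have := mul_le_mul hs (h.normker hy) (norm_nonneg _) hδ.1.le
    have e : 2 * δ / c0 = δ * (1 / c0) + δ * (1 / c0) := by ring
    linarith
  have e3 := Real.sqrt_le_sqrt e2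
  calc _ ≤ 2 * √(2 * δ / c0) * (2 * (√‖y0 - y‖)⁻¹ + (√‖y0 - y‖)⁻¹) := by gcongr
    _ = _ := by ring

/-- the signed indicator on the tube, in original coordinates -/
def chi (h : Geo Ψ G S K c0 M) (u1 u2 : Pt → ℝ) (z : Pt) : ℝ := XX u1 u2 (h.ft z, h.sc z)

open Classical in
lemma chi_meas (h : Geo Ψ G S K c0 M) {δ : ℝ} (hδ : Adm2 K c0 M δ) {u1 u2 : Pt → ℝ}
    (m1 : Measurable u1) (m2 : Measurable u2) :
    ∃ χ : Pt → ℝ, Measurable χ ∧ ∀ z ∈ h.tube δ, χ z = h.chi u1 u2 z := by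
  obtain ⟨c1, c2⟩ := h.contOn_tube hδ
  have ho := (h.isOpen_tube hδ).measurableSet
  have M1 : Measurable ((h.tube δ).piecewise h.ft (fun _ => 0)) :=
    c1.measurable_piecewise continuousOn_const ho
  have M2 : Measurable ((h.tube δ).piecewise h.sc (fun _ => 0)) :=
    c2.measurable_piecewise continuousOn_const ho
  refine ⟨fun z => XX u1 u2 ((h.tube δ).piecewise h.ft (fun _ => 0) z,
    (h.tube δ).piecewise h.sc (fun _ => 0) z), (XX_meas m1 m2).comp (M1.prodMk M2),
    fun z hz => ?_⟩
  simp [hz, chi]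

/-- linearization of the logarithmic potential of a thin layer -/
lemma lin (h : Geo Ψ G S K c0 M) {ε : ℝ} (hε : 0 < ε) : ∃ δ0 > 0, ∀ δ, δ ≤ δ0 →
    Adm2 K c0 M δ → ∀ u1 u2 : Pt → ℝ, Measurable u1 → Measurable u2 → (∀ y, |u1 y| ≤ δ) →
    (∀ y, |u2 y| ≤ δ) → ∀ d, (∀ y ∈ S, |u1 y - u2 y| ≤ d) → ∀ y0 ∈ S, ∀ s0, |s0| ≤ δ →
    |(∫ z in h.tube δ, h.chi u1 u2 z * log ‖pp G y0 s0 - z‖) -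
      ∫ y, (u1 y - u2 y) * log ‖y0 - y‖ ∂(sig G S)| ≤ ε * d := by
  have hc := h.c0_pos
  have := h.sig_finite
  have hS : ∀ᵐ y ∂(sig G S), y ∈ S := by rw [ae_iff]; exact h.sig_compl
  obtain ⟨CA, hCA, hsq⟩ := h.sig_sqrt_int
  obtain ⟨D, hD0, hD⟩ : ∃ D > 0, ∀ y ∈ S, ∀ y' ∈ S, ‖y - y'‖ ≤ D := by
    obtain ⟨D, hD⟩ := h.compact.isBounded.exists_norm_le
    refine ⟨2 * |D| + 1, by positivity, fun y hy y' hy' => (norm_sub_le _ _).trans ?_⟩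
    have := hD y hy
    have := hD y' hy'
    linarith [le_abs_self D]
  set A1 := 2 * (D + 1) + 6 * √(2 / c0) with hA1
  have hA1p : 0 < A1 := by positivity
  set ε1 := ε / (2 * (A1 * CA)) with hε1
  have hepsp_one : 0 < ε1 := by positivity
  obtain ⟨δ1, hδ1, hT⟩ := h.tube_measure hepsp_one
  set δ2 := (ε / (12 * √(2 / c0) * CA)) ^ 2 with hδ2
  have hq : 0 < √(2 / c0) := Real.sqrt_pos.2 (by positivity)
  have hdelp_two : 0 < δ2 := by positivity
  refine ⟨min (min δ1 δ2) 1, by positivity, fun δ hδ hadm u1 u2 m1 m2 b1 b2 d hd y0 hy0 s0 hs0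
    => ?_⟩
  have hδ1' : δ ≤ δ1 := hδ.trans ((min_le_left _ _).trans (min_le_left _ _))
  have hδ2' : δ ≤ δ2 := hδ.trans ((min_le_left _ _).trans (min_le_right _ _))
  have hδ3' : δ ≤ 1 := hδ.trans (min_le_right _ _)
  have hδp := hadm.1
  have hd0 : 0 ≤ d := (abs_nonneg _).trans (hd y0 hy0)
  obtain ⟨T1, T2⟩ := hT δ hδ1' hadm
  have ha := Adm2.adm h hadm
  obtain ⟨χ, χm, χe⟩ := h.chi_meas hadm m1 m2
  set x := pp G y0 s0 with hx
  have hpm : Measurable (pq G) := h.meas_pp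
  have hsδ : √(2 * δ / c0) = √(2 / c0) * √δ := by
    rw [← Real.sqrt_mul (by positivity)]; congr 1; ring
  have hsq1 : √δ ≤ 1 := by rw [Real.sqrt_le_left one_pos.le]; simpa using hδ3'
  -- reduction to the measurable version
  have r1 : ∫ z in h.tube δ, h.chi u1 u2 z * log ‖x - z‖ = ∫ z in h.tube δ, χ z * log ‖x - z‖ :=
    setIntegral_congr_fun (h.isOpen_tube hadm).measurableSet fun z hz => by
      show _ = χ z * _; rw [χe z hz]
  set f : Pt → ℝ := fun z => χ z * log ‖x - z‖ with hf
  have fm : Measurable f := χm.mul (by fun_prop)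
  -- a.e. facts
  have ae1 : ∀ᵐ q ∂(nu G S δ), q.1 ≠ y0 := by
    unfold nu
    exact Measure.quasiMeasurePreserving_fst.ae (h.sig_ne y0)
  have ae2 : ∀ᵐ q ∂(nu G S δ), f (pq G q) = XX u1 u2 q * log ‖x - pq G q‖ ∧
      |log ‖x - pq G q‖ - log ‖y0 - q.1‖| ≤ 6 * √(2 * δ / c0) * (√‖y0 - q.1‖)⁻¹ ∧
      |log ‖y0 - q.1‖| ≤ 2 * (D + 1) * (√‖y0 - q.1‖)⁻¹ := by
    filter_upwards [h.ae_nu δ, ae1] with q hq hne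
    have hs : |q.2| < δ := abs_lt.2 hq.2
    have hz := h.mem_tube_pp ha hq.1 hs
    refine ⟨?_, h.log_pp ha hy0 hq.1 hs0 hs.le hne, ?_⟩
    · show χ (pp G q.1 q.2) * _ = _
      rw [χe _ hz, chi, (h.coords ha hq.1 hs.le).1, (h.coords ha hq.1 hs.le).2]
    · exact abs_log_le_sqrt (norm_pos_iff.2 (sub_ne_zero.2 hne.symm)) (hD _ hy0 _ hq.1)
  obtain ⟨g1, g2⟩ := hsq y0
  obtain ⟨j1, -, j3⟩ := h.nu_XX m1 m2 b1 b2 hd g1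
  have j3 := j3 (fun y => by positivity)
  have j1' : Integrable (fun q : Pt × ℝ => |XX u1 u2 q| * (√‖y0 - q.1‖)⁻¹) (nu G S δ) := by
    refine j1.norm.congr (Eventually.of_forall fun q => ?_)
    simp only [norm_mul, Real.norm_eq_abs]
    rw [abs_of_nonneg (by positivity : (0:ℝ) ≤ (√‖y0 - q.1‖)⁻¹)]
  have j4 : ∫ q, |XX u1 u2 q| * (√‖y0 - q.1‖)⁻¹ ∂(nu G S δ) ≤ d * CA :=
    j3.trans (by gcongr)
  have hlogi : Integrable (fun y => log ‖y0 - y‖) (sig G S) := by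
    refine (g1.const_mul (2 * (D + 1))).mono' (Measurable.aestronglyMeasurable (by fun_prop)) ?_
    filter_upwards [hS, h.sig_ne y0] with y hy hne
    exact abs_log_le_sqrt (norm_pos_iff.2 (sub_ne_zero.2 hne.symm)) (hD _ hy0 _ hy)
  obtain ⟨k1, k2, -⟩ := h.nu_XX m1 m2 b1 b2 hd hlogi
  -- domination of f
  have bf : ∀ᵐ q ∂(nu G S δ), |f (pq G q)| ≤ A1 * (|XX u1 u2 q| * (√‖y0 - q.1‖)⁻¹) := by
    filter_upwards [ae2] with q ⟨e1, e2, e3⟩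
    rw [e1, abs_mul]
    have : |log ‖x - pq G q‖| ≤ A1 * (√‖y0 - q.1‖)⁻¹ := by
      have : 6 * √(2 * δ / c0) * (√‖y0 - q.1‖)⁻¹ ≤ 6 * √(2 / c0) * (√‖y0 - q.1‖)⁻¹ := by
        rw [hsδ]
        gcongr 6 * ?_ * _
        exact mul_le_of_le_one_right hq.le hsq1
      have := abs_sub_abs_le_abs_sub (log ‖x - pq G q‖) (log ‖y0 - q.1‖)
      rw [hA1]; linarith
    calc _ ≤ |XX u1 u2 q| * (A1 * (√‖y0 - q.1‖)⁻¹) := by gcongr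
      _ = _ := by ring
  have fi : Integrable (fun q => f (pq G q)) (nu G S δ) :=
    (j1'.const_mul A1).mono' (fm.comp hpm).aestronglyMeasurable bf
  have fi' : Integrable f ((nu G S δ).map (pq G)) :=
    (integrable_map_measure fm.aestronglyMeasurable hpm.aemeasurable).2 fi
  have s1 := compare_meas hepsp_one.le T1 T2 fi'
  rw [integral_map hpm.aemeasurable fm.aestronglyMeasurable,
    integral_map hpm.aemeasurable fm.abs.aestronglyMeasurable] at s1
  have s2 : ∫ q, |f (pq G q)| ∂(nu G S δ) ≤ A1 * (d * CA) := by
    calc _ ≤ ∫ q, A1 * (|XX u1 u2 q| * (√‖y0 - q.1‖)⁻¹) ∂(nu G S δ) :=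
          integral_mono_ae fi.abs (j1'.const_mul A1) bf
      _ ≤ _ := by rw [integral_const_mul]; gcongr
  have s3 : |∫ q, f (pq G q) ∂(nu G S δ) - ∫ q, XX u1 u2 q * log ‖y0 - q.1‖ ∂(nu G S δ)| ≤
      6 * √(2 * δ / c0) * (d * CA) := by
    rw [← integral_sub fi k1, ← Real.norm_eq_abs]
    calc _ ≤ ∫ q, 6 * √(2 * δ / c0) * (|XX u1 u2 q| * (√‖y0 - q.1‖)⁻¹) ∂(nu G S δ) := by
          refine norm_integral_le_of_norm_le (j1'.const_mul _) ?_
          filter_upwards [ae2] with q ⟨e1, e2, e3⟩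
          rw [e1, ← mul_sub, norm_mul, Real.norm_eq_abs, Real.norm_eq_abs]
          calc _ ≤ |XX u1 u2 q| * (6 * √(2 * δ / c0) * (√‖y0 - q.1‖)⁻¹) := by gcongr
            _ = _ := by ring
      _ ≤ _ := by rw [integral_const_mul]; gcongr
  rw [k2] at s3
  rw [r1]
  have t1 : ε1 * (A1 * (d * CA)) = ε / 2 * d := by rw [hε1]; field_simp
  have t2 : 6 * √(2 * δ / c0) * (d * CA) ≤ ε / 2 * d := by
    have : √δ ≤ ε / (12 * √(2 / c0) * CA) := by
      rw [Real.sqrt_le_left (by positivity)]; exact hδ2'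
    calc _ = (12 * √(2 / c0) * CA * √δ) / 2 * d := by rw [hsδ]; ring
      _ ≤ (12 * √(2 / c0) * CA * (ε / (12 * √(2 / c0) * CA))) / 2 * d := by gcongr
      _ = _ := by field_simp
  have t3 : ε1 * ∫ q, |f (pq G q)| ∂(nu G S δ) ≤ ε / 2 * d := by
    rw [← t1]; gcongr
  have := abs_sub_le (∫ z in h.tube δ, f z) (∫ q, f (pq G q) ∂(nu G S δ))
    (∫ y, (u1 y - u2 y) * log ‖y0 - y‖ ∂(sig G S))
  calc _ ≤ _ := this
    _ ≤ ε / 2 * d + ε / 2 * d := add_le_add (s1.trans t3) (s3.trans t2)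
    _ = _ := by ring

end Geo
end Trap

namespace Trap

variable {Ψ : Pt → ℝ} {G : Pt → Pt} {S : Set Pt} {K c0 M : ℝ}
namespace Geo

/-- compatibility of a patch with normal coordinates in the tube of size `δ`. -/
structure Pch (h : Geo Ψ G S K c0 M) (P : Set Pt) (δ : ℝ) : Prop where
  adm2 : Adm2 K c0 M δ
  opn : IsOpen P
  bdd : Bornology.IsBounded P
  front : frontier P = S
  mem : ∀ z ∈ h.tube δ, (z ∈ P ↔ h.sc z < 0)

/-- perturbed patch -/
def WW (h : Geo Ψ G S K c0 M) (P : Set Pt) (δ : ℝ) (u : Pt → ℝ) : Set Pt :=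
  {z | (z ∈ h.tube δ ∧ h.sc z < u (h.ft z)) ∨ (z ∉ h.tube δ ∧ z ∈ P)}

variable {h : Geo Ψ G S K c0 M} {P : Set Pt} {δ δ' : ℝ} {u u1 u2 : Pt → ℝ}

lemma mem_WW_tube {z : Pt} (hz : z ∈ h.tube δ) : z ∈ h.WW P δ u ↔ h.sc z < u (h.ft z) := by
  simp [WW, hz]

lemma mem_WW_out {z : Pt} (hz : z ∉ h.tube δ) : z ∈ h.WW P δ u ↔ z ∈ P := by
  simp [WW, hz]

lemma WW_zero (hp : h.Pch P δ) : h.WW P δ (fun _ => 0) = P := by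
  ext z
  by_cases hz : z ∈ h.tube δ
  · rw [mem_WW_tube hz, hp.mem z hz]
  · rw [mem_WW_out hz]

lemma tube_mono {a b : ℝ} (hab : a ≤ b) : h.tube a ⊆ h.tube b :=
  fun _ hz => lt_of_lt_of_le (show |_| < a from hz) hab

lemma WW_out_ctube (hp : h.Pch P δ) (hδ' : δ' < δ) (hu : ∀ y, |u y| ≤ δ') {z : Pt}
    (hz : z ∉ ctube G S δ') : z ∈ h.WW P δ u ↔ z ∈ P := by
  by_cases ht : z ∈ h.tube δ
  · rw [mem_WW_tube ht, hp.mem z ht]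
    rw [h.mem_ctube_iff (Adm2.adm h hp.adm2) hδ'.le, not_le, lt_abs] at hz
    have := abs_le.1 (hu (h.ft z))
    have := (abs_nonneg _).trans (hu 0)
    rcases hz with hz | hz
    · constructor <;> intro <;> linarith
    · constructor <;> intro <;> linarith
  · rw [mem_WW_out ht]

lemma ctube_sub (hp : h.Pch P δ) (hδ' : δ' < δ) : ctube G S δ' ⊆ h.tube δ := fun z hz => by
  rw [h.mem_ctube_iff (Adm2.adm h hp.adm2) hδ'.le] at hz
  exact lt_of_le_of_lt hz hδ'

lemma cont_uft (hp : h.Pch P δ) (cu : ContinuousOn u S) :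
    ContinuousOn (fun z => u (h.ft z)) (h.tube δ) :=
  cu.comp (h.contOn_tube hp.adm2).1 fun z _ => h.ft_mem z

lemma isOpen_WW (hp : h.Pch P δ) (hδ' : δ' < δ) (hu : ∀ y, |u y| ≤ δ') (cu : ContinuousOn u S) :
    IsOpen (h.WW P δ u) := by
  have e : h.WW P δ u = (h.tube δ ∩ (fun z => u (h.ft z) - h.sc z) ⁻¹' Set.Ioi 0) ∪
      (P ∩ (ctube G S δ')ᶜ) := by
    ext z
    constructor
    · intro hz
      by_cases ht : z ∈ h.tube δ
      · left; rw [mem_WW_tube ht] at hz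
        exact ⟨ht, by simpa using hz⟩
      · right
        have hn : z ∉ ctube G S δ' := fun hc => ht (ctube_sub hp hδ' hc)
        exact ⟨(mem_WW_out ht).1 hz, hn⟩
    · rintro (⟨ht, hz⟩ | ⟨hz, hn⟩)
      · rw [mem_WW_tube ht]; simpa using hz
      · exact (WW_out_ctube hp hδ' hu hn).2 hz
  rw [e]
  refine IsOpen.union ?_ (hp.opn.inter (h.isCompact_ctube δ').isClosed.isOpen_compl)
  exact ((cont_uft hp cu).sub (h.contOn_tube hp.adm2).2).isOpen_inter_preimage
    (h.isOpen_tube hp.adm2) isOpen_Ioi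

lemma frontier_WW (hp : h.Pch P δ) (hδ' : δ' < δ) (hu : ∀ y, |u y| ≤ δ') (cu : ContinuousOn u S) :
    frontier (h.WW P δ u) = {z | z ∈ h.tube δ ∧ h.sc z = u (h.ft z)} := by
  have hadm := Adm2.adm h hp.adm2
  have ho := isOpen_WW hp hδ' hu cu
  have hδ0 : 0 ≤ δ' := (abs_nonneg _).trans (hu 0)
  ext z
  constructor
  · intro hz
    have ht : z ∈ h.tube δ := by
      by_contra ht
      have hn : z ∈ (ctube G S δ')ᶜ := fun hc => ht (ctube_sub hp hδ' hc)
      have hcl : IsOpen (ctube G S δ')ᶜ := (h.isCompact_ctube δ').isClosed.isOpen_compl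
      have e : h.WW P δ u ∩ (ctube G S δ')ᶜ = P ∩ (ctube G S δ')ᶜ := by
        ext w
        constructor
        · rintro ⟨a, b⟩; exact ⟨(WW_out_ctube hp hδ' hu b).1 a, b⟩
        · rintro ⟨a, b⟩; exact ⟨(WW_out_ctube hp hδ' hu b).2 a, b⟩
      have : z ∈ frontier (h.WW P δ u) ∩ (ctube G S δ')ᶜ := ⟨hz, hn⟩
      rw [← frontier_inter_open_inter hcl, e, frontier_inter_open_inter hcl, hp.front] at this
      refine hn ⟨(z, 0), ⟨this.1, by simpa using hδ0⟩, by simp [pp]⟩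
    refine ⟨ht, ?_⟩
    rw [ho.frontier_eq] at hz
    have h1 : u (h.ft z) ≤ h.sc z := not_lt.1 fun hlt => hz.2 ((mem_WW_tube ht).2 hlt)
    refine le_antisymm (not_lt.1 fun hlt => ?_) h1
    have hO : IsOpen (h.tube δ ∩ (fun z => h.sc z - u (h.ft z)) ⁻¹' Set.Ioi 0) :=
      ((h.contOn_tube hp.adm2).2.sub (cont_uft hp cu)).isOpen_inter_preimage
        (h.isOpen_tube hp.adm2) isOpen_Ioi
    obtain ⟨w, ⟨hw1, hw2⟩, hw3⟩ := mem_closure_iff.1 hz.1 _ hO ⟨ht, by simpa using hlt⟩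
    rw [mem_WW_tube hw1] at hw3
    simp at hw2; linarith
  · rintro ⟨ht, he⟩
    rw [ho.frontier_eq]
    refine ⟨?_, fun hz => by rw [mem_WW_tube ht] at hz; linarith⟩
    have hc : Tendsto (fun t : ℝ => pp G (h.ft z) (h.sc z - t)) (𝓝[>] 0) (𝓝 z) := by
      have : Continuous fun t : ℝ => pp G (h.ft z) (h.sc z - t) := by unfold pp; fun_prop
      have := this.tendsto 0
      rw [sub_zero, h.pp_ft] at this
      exact this.mono_left nhdsWithin_le_nhds
    refine mem_closure_of_tendsto hc ?_
    have h1 : |h.sc z| < δ := ht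
    have h2 : ∀ᶠ t : ℝ in 𝓝[>] 0, |h.sc z - t| < δ := by
      have : Continuous fun t : ℝ => |h.sc z - t| := by fun_prop
      exact (this.tendsto 0).mono_left nhdsWithin_le_nhds (gt_mem_nhds (by simpa using h1))
    filter_upwards [h2, self_mem_nhdsWithin] with t ht' ht0
    rw [mem_WW_tube (h.mem_tube_pp hadm (h.ft_mem z) ht'),
      (h.coords hadm (h.ft_mem z) ht'.le).1, (h.coords hadm (h.ft_mem z) ht'.le).2, ← he]
    have : 0 < t := ht0
    linarith

lemma WW_sub {D : ℝ} (h1 : P ⊆ closedBall 0 D) (h2 : h.tube δ ⊆ closedBall 0 D) :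
    h.WW P δ u ⊆ closedBall 0 D := by
  rintro z (⟨hz, -⟩ | ⟨-, hz⟩)
  · exact h2 hz
  · exact h1 hz

lemma meas_WW (hp : h.Pch P δ) (mu : Measurable u) : MeasurableSet (h.WW P δ u) := by
  obtain ⟨χ, mχ, hχ⟩ := h.chi_meas hp.adm2 mu (measurable_const (a := -δ))
  have ht := (h.isOpen_tube hp.adm2).measurableSet
  have e : h.WW P δ u = (h.tube δ ∩ χ ⁻¹' {1}) ∪ (P \ h.tube δ) := by
    ext z
    by_cases hz : z ∈ h.tube δ
    · rw [mem_WW_tube hz]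
      have : ¬ h.sc z < -δ := by
        have : |h.sc z| < δ := hz
        rw [abs_lt] at this; linarith
      simp [hz, hχ z hz, chi, XX, this]
    · rw [mem_WW_out hz]; simp [hz]
  rw [e]
  exact (ht.inter (mχ (measurableSet_singleton _))).union (hp.opn.measurableSet.diff ht)

lemma chi_eq {z : Pt} (hz : z ∈ h.tube δ) : h.chi u1 u2 z =
    (h.WW P δ u1).indicator 1 z - (h.WW P δ u2).indicator 1 z := by
  classical
  simp only [Set.indicator_apply, mem_WW_tube hz]
  simp only [chi, XX, Pi.one_apply]

lemma ind_eq (z : Pt) : (h.WW P δ u1).indicator (1 : Pt → ℝ) z -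
    (h.WW P δ u2).indicator 1 z = (h.tube δ).indicator (h.chi u1 u2) z := by
  classical
  by_cases hz : z ∈ h.tube δ
  · rw [Set.indicator_of_mem hz, chi_eq (P := P) hz]
  · rw [Set.indicator_of_notMem hz]
    simp only [Set.indicator_apply, mem_WW_out hz, sub_self]

/-- difference of integrals over two perturbed patches -/
lemma int_WW_sub {E : Type*} [NormedAddCommGroup E] [NormedSpace ℝ E] (hp : h.Pch P δ)
    (m1 : Measurable u1) (m2 : Measurable u2)
    {F : Pt → E} (i1 : IntegrableOn F (h.WW P δ u1)) (i2 : IntegrableOn F (h.WW P δ u2)) :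
    (∫ z in h.WW P δ u1, F z) - ∫ z in h.WW P δ u2, F z =
      ∫ z in h.tube δ, h.chi u1 u2 z • F z := by
  have w1 := meas_WW hp m1
  have w2 := meas_WW hp m2
  have ht := (h.isOpen_tube hp.adm2).measurableSet
  rw [← integral_indicator w1, ← integral_indicator w2, ← integral_sub, ← integral_indicator ht]
  · congr 1; ext z
    have := ind_eq (h := h) (P := P) (δ := δ) (u1 := u1) (u2 := u2) z
    have e : ∀ (A : Set Pt), A.indicator F z = A.indicator (1 : Pt → ℝ) z • F z := fun A => by
      by_cases hz : z ∈ A <;> simp [hz]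
    rw [e, e, ← sub_smul, this]
    by_cases hz : z ∈ h.tube δ <;> simp [hz]
  · rwa [integrable_indicator_iff w1]
  · rwa [integrable_indicator_iff w2]

lemma chi_abs_le (z : Pt) : |h.chi u1 u2 z| ≤ 1 := XX_abs_le _ _ _

lemma chi_aem (hadm : Adm2 K c0 M δ) (m1 : Measurable u1) (m2 : Measurable u2) :
    AEStronglyMeasurable (h.chi u1 u2) (volume.restrict (h.tube δ)) := by
  obtain ⟨χ, mχ, hχ⟩ := h.chi_meas hadm m1 m2
  refine mχ.aestronglyMeasurable.congr ?_
  filter_upwards [ae_restrict_mem (h.isOpen_tube hadm).measurableSet] with z hz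
  exact hχ z hz

lemma tube_vol (hadm : Adm2 K c0 M δ) : volume (h.tube δ) ≠ ⊤ :=
  bounded_vol (h.tube_bdd (Adm2.adm h hadm))

lemma chi_integrable (hadm : Adm2 K c0 M δ) (m1 : Measurable u1) (m2 : Measurable u2) :
    IntegrableOn (h.chi u1 u2) (h.tube δ) :=
  Integrable.mono' (integrableOn_const (C := (1:ℝ)) (tube_vol hadm)) (chi_aem hadm m1 m2)
    (Eventually.of_forall fun z => chi_abs_le z)

variable (h) in
lemma chi_int : ∃ δ0 > 0, ∃ C > 0, ∀ δ, δ ≤ δ0 → Adm2 K c0 M δ → ∀ u1 u2 : Pt → ℝ,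
    Measurable u1 → Measurable u2 → (∀ y, |u1 y| ≤ δ) →
    (∀ y, |u2 y| ≤ δ) → ∀ d, (∀ y ∈ S, |u1 y - u2 y| ≤ d) →
    ∫ z in h.tube δ, |h.chi u1 u2 z| ≤ C * d := by
  have := h.sig_finite
  obtain ⟨δ0, hδ0, hT⟩ := h.tube_measure one_pos
  have hm0 : 0 ≤ (sig G S).real Set.univ := measureReal_nonneg
  refine ⟨δ0, hδ0, 2 * (sig G S).real Set.univ + 1, by positivity,
    fun δ hδ hadm u1 u2 m1 m2 b1 b2 d hd => ?_⟩
  obtain ⟨y0, hy0⟩ := h.nonempty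
  have hd0 : 0 ≤ d := (abs_nonneg _).trans (hd y0 hy0)
  obtain ⟨T1, T2⟩ := hT δ hδ hadm
  have ha := Adm2.adm h hadm
  have hpm : Measurable (pq G) := h.meas_pp
  obtain ⟨χ, mχ, hχ⟩ := h.chi_meas hadm m1 m2
  have e1 : ∫ z in h.tube δ, |h.chi u1 u2 z| = ∫ z in h.tube δ, |χ z| :=
    setIntegral_congr_fun (h.isOpen_tube hadm).measurableSet fun z hz => by
      show _ = |χ z|; rw [hχ z hz]
  have ae2 : ∀ᵐ q ∂(nu G S δ), |χ (pq G q)| = |XX u1 u2 q| * 1 := by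
    filter_upwards [h.ae_nu δ] with q hq
    have hs : |q.2| < δ := abs_lt.2 hq.2
    show |χ (pp G q.1 q.2)| = _
    rw [hχ _ (h.mem_tube_pp ha hq.1 hs), chi, (h.coords ha hq.1 hs.le).1,
      (h.coords ha hq.1 hs.le).2, mul_one]
  obtain ⟨j1, -, j3⟩ := h.nu_XX m1 m2 b1 b2 hd (integrable_const (1:ℝ))
  have j3 := j3 (fun _ => zero_le_one)
  have i1 : Integrable (fun q => |χ (pq G q)|) (nu G S δ) := by
    refine (j1.abs).congr ?_
    filter_upwards [ae2] with q hq
    rw [hq]; simp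
  have i2 : Integrable (fun z => |χ z|) ((nu G S δ).map (pq G)) :=
    (integrable_map_measure mχ.abs.aestronglyMeasurable hpm.aemeasurable).2 i1
  obtain ⟨-, s1⟩ := compare_nonneg zero_le_one T1 T2 i2 (fun z => abs_nonneg _)
  rw [integral_map hpm.aemeasurable mχ.abs.aestronglyMeasurable, integral_congr_ae ae2] at s1
  rw [e1]
  have := (abs_le.1 s1).2
  simp only [integral_const, smul_eq_mul, mul_one] at this j3
  nlinarith

/-- real form of the Riesz bound on thin tubes -/
lemma E1' (h : Geo Ψ G S K c0 M) : ∃ δ0 > 0, ∃ C > 0, ∀ δ, δ ≤ δ0 → δ ≤ 1 → Adm2 K c0 M δ →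
    ∀ x : Pt, ∫ z in h.tube δ, ‖x - z‖⁻¹ ≤ C * (δ * (1 + log δ⁻¹)) := by
  obtain ⟨δ0, hδ0, C, hC, hE⟩ := h.E1
  refine ⟨δ0, hδ0, C, hC, fun δ h1 h2 hadm x => ?_⟩
  rw [integral_eq_lintegral_of_nonneg_ae (Eventually.of_forall fun z => by positivity)
    (Measurable.aestronglyMeasurable (by fun_prop))]
  refine ENNReal.toReal_le_of_le_ofReal ?_ (hE δ h1 h2 hadm x)
  have hlog : 0 ≤ log δ⁻¹ := log_nonneg ((one_le_inv₀ hadm.1).2 h2)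
  have := hadm.1
  positivity

lemma smul_bdd {E : Type*} [NormedAddCommGroup E] [NormedSpace ℝ E] (hadm : Adm2 K c0 M δ)
    (m1 : Measurable u1) (m2 : Measurable u2) {F : Pt → E} (hF : IntegrableOn F (h.tube δ)) :
    IntegrableOn (fun z => h.chi u1 u2 z • F z) (h.tube δ) := by
  refine Integrable.mono hF ((chi_aem hadm m1 m2).smul hF.aestronglyMeasurable) ?_
  refine Eventually.of_forall fun z => ?_
  rw [norm_smul]
  exact mul_le_of_le_one_left (norm_nonneg _) (chi_abs_le z)

end Geo
end Trap

namespace Trap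

variable {Ψ : Pt → ℝ} {G : Pt → Pt} {S : Set Pt} {K c0 M : ℝ}
namespace Geo

variable {h : Geo Ψ G S K c0 M} {P : Set Pt} {δ δ' : ℝ} {u u1 u2 : Pt → ℝ}

/-- perturbed stream function -/
def PsiR (h : Geo Ψ G S K c0 M) (P : Set Pt) (δ R : ℝ) (u : Pt → ℝ) (x : Pt) : ℝ :=
  Ψ x + (1 / (2 * π)) * (newt (h.WW P δ u) x - newt P x) + hpot R (h.WW P δ u) x

/-- perturbed stream function on the graph -/
def FR (h : Geo Ψ G S K c0 M) (P : Set Pt) (δ R : ℝ) (u : Pt → ℝ) (y : Pt) : ℝ :=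
  h.PsiR P δ R u (pp G y (u y))

lemma dlog {δ : ℝ} (h0 : 0 < δ) (h1 : δ ≤ 1) : δ * (1 + log δ⁻¹) ≤ 3 * √δ := by
  have hs := Real.sqrt_pos.2 h0
  have hs1 : √δ ≤ 1 := by rw [Real.sqrt_le_left one_pos.le]; simpa using h1
  have e : log δ⁻¹ = 2 * log (√δ)⁻¹ := by
    rw [Real.log_inv, Real.log_inv, Real.log_sqrt h0.le]; ring
  have := Real.log_le_sub_one_of_pos (inv_pos.2 hs)
  have e2 : δ * (√δ)⁻¹ = √δ := by
    rw [mul_inv_eq_iff_eq_mul₀ hs.ne']; exact (Real.mul_self_sqrt h0.le).symm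
  have e3 : δ = √δ * √δ := (Real.mul_self_sqrt h0.le).symm
  have : δ * (1 + log δ⁻¹) ≤ δ * (1 + 2 * (√δ)⁻¹) := by rw [e]; gcongr; linarith
  have e4 : δ * (1 + 2 * (√δ)⁻¹) = δ + 2 * √δ := by linear_combination 2 * e2
  nlinarith

lemma pp_mem (hp : h.Pch P δ) {D : ℝ} (h2 : h.tube δ ⊆ closedBall 0 D) {y : Pt} (hy : y ∈ S)
    {s : ℝ} (hs : |s| < δ) : ‖pp G y s‖ ≤ D := by
  simpa using h2 (h.mem_tube_pp (Adm2.adm h hp.adm2) hy hs)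

lemma newt_diff (hadm : Adm2 K c0 M δ) (m1 : Measurable u1) (m2 : Measurable u2) (x1 x2 : Pt) :
    |(∫ z in h.tube δ, h.chi u1 u2 z • log ‖x1 - z‖) -
      ∫ z in h.tube δ, h.chi u1 u2 z • log ‖x2 - z‖| ≤
    ‖x1 - x2‖ * ((∫ z in h.tube δ, ‖x1 - z‖⁻¹) + ∫ z in h.tube δ, ‖x2 - z‖⁻¹) := by
  have hb := h.tube_bdd (Adm2.adm h hadm)
  have j1 := riesz_int_one (tube_vol (h := h) hadm) x1
  have j2 := riesz_int_one (tube_vol (h := h) hadm) x2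
  rw [← integral_sub (smul_bdd hadm m1 m2 (integrableOn_log hb x1))
    (smul_bdd hadm m1 m2 (integrableOn_log hb x2)), ← integral_add j1 j2, ← integral_const_mul,
    ← Real.norm_eq_abs]
  refine norm_integral_le_of_norm_le ((j1.add j2).const_mul _) ?_
  filter_upwards [ae_sub_ne (h.tube δ) x1, ae_sub_ne (h.tube δ) x2] with z h1 h2
  rw [← smul_sub, norm_smul]
  refine (mul_le_of_le_one_left (norm_nonneg _) (chi_abs_le z)).trans ?_
  refine (abs_log_sub_le (norm_pos_iff.2 h1) (norm_pos_iff.2 h2)).trans ?_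
  gcongr
  refine (abs_norm_sub_norm_le _ _).trans (le_of_eq ?_)
  congr 1; abel

lemma hpot_diff (hp : h.Pch P δ) (m1 : Measurable u1) (m2 : Measurable u2) {R D : ℝ}
    (h1 : P ⊆ closedBall 0 D) (h2 : h.tube δ ⊆ closedBall 0 D) (hR : 0 < R) (hD : 4 * D ≤ R)
    {x : Pt} (hx : ‖x‖ ≤ 2 * R) :
    |hpot R (h.WW P δ u1) x - hpot R (h.WW P δ u2) x| ≤
      D / R ^ 2 * ‖x‖ * ∫ z in h.tube δ, |h.chi u1 u2 z| := by
  have i1 := integrableOn_hk (meas_WW hp m1) (WW_sub h1 h2) hR hD hx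
  have i2 := integrableOn_hk (meas_WW hp m2) (WW_sub h1 h2) hR hD hx
  rw [hpot, hpot, int_WW_sub hp m1 m2 i1 i2, ← integral_const_mul, ← Real.norm_eq_abs]
  refine norm_integral_le_of_norm_le ((chi_integrable hp.adm2 m1 m2).abs.const_mul _) ?_
  filter_upwards [ae_norm_le (h.isOpen_tube hp.adm2).measurableSet h2] with z hz
  rw [norm_smul, Real.norm_eq_abs, Real.norm_eq_abs, mul_comm]
  gcongr
  exact hk_abs hR hD hx hz

variable (h) in
lemma Best {ε : ℝ} (hε : 0 < ε) : ∃ δ0 > 0, ∀ (P : Set Pt) (δ : ℝ), δ ≤ δ0 → h.Pch P δ →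
    ∀ D, P ⊆ closedBall 0 D → h.tube δ ⊆ closedBall 0 D → ∃ R0 : ℝ, ∀ R, R0 ≤ R →
    ∀ u1 u2 : Pt → ℝ, Measurable u1 → Measurable u2 → (∀ y, |u1 y| < δ) →
    (∀ y, |u2 y| < δ) → ∀ d, (∀ y ∈ S, |u1 y - u2 y| ≤ d) → ∀ y ∈ S,
    |h.FR P δ R u1 y - h.FR P δ R u2 y - ((u1 y - u2 y) +
      (1 / (2 * π)) * ∫ y', (u1 y' - u2 y') * log ‖y - y'‖ ∂(sig G S))| ≤ ε * d := by
  have hc := h.c0_pos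
  have hK := h.K_pos
  obtain ⟨δ1, hδ1, hlin⟩ := h.lin (ε := ε / 5) (by positivity)
  obtain ⟨δ2, hδ2, C2, hC2, hE⟩ := h.E1'
  obtain ⟨δ3, hδ3, C3, hC3, hchi⟩ := h.chi_int
  set δ4 := ε * c0 ^ 2 / (5 * K) with hδ4
  set δ5 := (ε * c0 / (30 * C2)) ^ 2 with hδ5
  have hdelp_four : 0 < δ4 := by positivity
  have hdelp_five : 0 < δ5 := by positivity
  refine ⟨min (min (min δ1 δ2) (min δ3 δ4)) (min δ5 1), by positivity,
    fun P δ hδ hp D hPD hTD => ?_⟩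
  simp only [le_min_iff] at hδ
  obtain ⟨⟨⟨d1, d2⟩, ⟨d3, d4⟩⟩, d5, d6⟩ := hδ
  have hδp := hp.adm2.1
  have hadm := hp.adm2
  have hD0 : 0 ≤ D := by
    obtain ⟨y, hy⟩ := h.nonempty
    exact (norm_nonneg _).trans (pp_mem hp hTD hy (s := 0) (by simpa using hδp))
  set V := volume.real (closedBall (0:Pt) D) with hV
  have hV0 : 0 ≤ V := measureReal_nonneg
  set A := D * D * C3 + D * V / c0 with hA
  have hA0 : 0 ≤ A := by positivity
  refine ⟨max 1 (max (4 * D) (A * (5 / (2 * ε)))), fun R hR u1 u2 m1 m2 b1 b2 d hd y hy => ?_⟩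
  simp only [max_le_iff] at hR
  obtain ⟨hR1, hR2, hR3⟩ := hR
  have hR0 : 0 < R := by linarith
  have hd0 : 0 ≤ d := (abs_nonneg _).trans (hd y hy)
  have hAR : A / R ^ 2 ≤ 2 * ε / 5 := by
    rw [div_le_iff₀ (by positivity)]
    have : A ≤ 2 * ε / 5 * R := by
      have := mul_le_mul_of_nonneg_left hR3 (by positivity : 0 ≤ 2 * ε / 5)
      calc A = 2 * ε / 5 * (A * (5 / (2 * ε))) := by field_simp
        _ ≤ _ := this
    refine this.trans ?_
    gcongr
    nlinarith
  set x1 := pp G y (u1 y) with hx1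
  set x2 := pp G y (u2 y) with hx2
  have n1 : ‖x1‖ ≤ D := pp_mem hp hTD hy (b1 y)
  have n2 : ‖x2‖ ≤ D := pp_mem hp hTD hy (b2 y)
  have n1' : ‖x1‖ ≤ 2 * R := by linarith
  have n2' : ‖x2‖ ≤ 2 * R := by linarith
  have x12 : ‖x1 - x2‖ ≤ d / c0 := by
    have : x1 - x2 = (u1 y - u2 y) • ker (G y) := by rw [hx1, hx2, pp, pp, sub_smul]; abel
    rw [this, norm_smul, Real.norm_eq_abs, div_eq_mul_one_div]
    exact mul_le_mul (hd y hy) (h.normker hy) (norm_nonneg _) hd0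
  have bW : ∀ u, Bornology.IsBounded (h.WW P δ u) := fun u =>
    isBounded_closedBall.subset (WW_sub hPD hTD)
  -- T1
  have T1 : |Ψ x1 - Ψ x2 - (u1 y - u2 y)| ≤ ε / 5 * d := by
    refine (h.psi_pp hy (b1 y).le (b2 y).le).trans ?_
    have : K * δ / c0 ^ 2 ≤ ε / 5 := by
      rw [div_le_iff₀ (by positivity)]
      calc K * δ ≤ K * δ4 := by gcongr
        _ = _ := by rw [hδ4]; field_simp
    exact mul_le_mul this (hd y hy) (abs_nonneg _) (by positivity)
  have pi1 : 1 / (2 * π) ≤ 1 := by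
    rw [div_le_one (by positivity)]; linarith [Real.pi_gt_three]
  have pi0 : 0 ≤ 1 / (2 * π) := by positivity
  -- T2
  have e2 : newt (h.WW P δ u1) x1 - newt (h.WW P δ u2) x1 =
      ∫ z in h.tube δ, h.chi u1 u2 z * log ‖x1 - z‖ :=
    int_WW_sub hp m1 m2 (integrableOn_log (bW _) x1) (integrableOn_log (bW _) x1)
  have T2 := hlin δ d1 hadm u1 u2 m1 m2 (fun y => (b1 y).le) (fun y => (b2 y).le) d hd y hy (u1 y)
    (b1 y).le
  rw [← e2] at T2
  -- T3
  have e3 : ∀ x, newt (h.WW P δ u2) x - newt P x =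
      ∫ z in h.tube δ, h.chi u2 (fun _ => 0) z • log ‖x - z‖ := fun x => by
    conv_lhs => rw [← WW_zero hp]
    have := int_WW_sub hp m2 (measurable_const (a := (0:ℝ))) (integrableOn_log (bW u2) x)
      (integrableOn_log (bW (fun _ => 0)) x)
    rw [WW_zero hp] at this ⊢
    exact this
  have T3 : |(newt (h.WW P δ u2) x1 - newt P x1) - (newt (h.WW P δ u2) x2 - newt P x2)| ≤
      ε / 5 * d := by
    rw [e3, e3]
    refine (newt_diff hadm m2 measurable_const x1 x2).trans ?_
    have r1 := hE δ d2 d6 hadm x1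
    have r2 := hE δ d2 d6 hadm x2
    have r3 := dlog hδp d6
    have r4 : √δ ≤ ε * c0 / (30 * C2) := by
      rw [Real.sqrt_le_left (by positivity)]; exact d5
    calc _ ≤ d / c0 * (C2 * (3 * (ε * c0 / (30 * C2))) + C2 * (3 * (ε * c0 / (30 * C2)))) := by
          gcongr
          · exact r1.trans (mul_le_mul_of_nonneg_left (r3.trans (by linarith)) hC2.le)
          · exact r2.trans (mul_le_mul_of_nonneg_left (r3.trans (by linarith)) hC2.le)
      _ = ε / 5 * d := by field_simp; ring
  -- T4, T5
  have T4 := hpot_diff hp m1 m2 hPD hTD hR0 hR2 n1'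
  have T4b := hchi δ d3 hadm u1 u2 m1 m2 (fun y => (b1 y).le) (fun y => (b2 y).le) d hd
  have T5 := hpot_lip (meas_WW hp m2) (WW_sub hPD hTD) hR0 hR2 n1' n2'
  have vW : volume.real (h.WW P δ u2) ≤ V :=
    measureReal_mono (WW_sub hPD hTD) (bounded_vol isBounded_closedBall)
  have T45 : |hpot R (h.WW P δ u1) x1 - hpot R (h.WW P δ u2) x1| +
      |hpot R (h.WW P δ u2) x1 - hpot R (h.WW P δ u2) x2| ≤ 2 * ε / 5 * d := by
    calc _ ≤ D / R ^ 2 * D * (C3 * d) + D / R ^ 2 * (d / c0) * V := by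
          refine add_le_add (T4.trans ?_) (T5.trans ?_) <;> gcongr
      _ = A / R ^ 2 * d := by rw [hA]; field_simp
      _ ≤ _ := by gcongr
  have key : h.FR P δ R u1 y - h.FR P δ R u2 y - ((u1 y - u2 y) +
      (1 / (2 * π)) * ∫ y', (u1 y' - u2 y') * log ‖y - y'‖ ∂(sig G S)) =
      (Ψ x1 - Ψ x2 - (u1 y - u2 y)) +
      (1 / (2 * π)) * (newt (h.WW P δ u1) x1 - newt (h.WW P δ u2) x1 -
        ∫ y', (u1 y' - u2 y') * log ‖y - y'‖ ∂(sig G S)) +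
      (1 / (2 * π)) * ((newt (h.WW P δ u2) x1 - newt P x1) -
        (newt (h.WW P δ u2) x2 - newt P x2)) +
      (hpot R (h.WW P δ u1) x1 - hpot R (h.WW P δ u2) x1) +
      (hpot R (h.WW P δ u2) x1 - hpot R (h.WW P δ u2) x2) := by
    simp only [FR, PsiR]; ring
  have sc : ∀ a : ℝ, |a| ≤ ε / 5 * d → |1 / (2 * π) * a| ≤ ε / 5 * d := fun a ha => by
    rw [abs_mul, abs_of_nonneg pi0]
    exact (mul_le_of_le_one_left (abs_nonneg _) pi1).trans ha
  have T2' := sc _ T2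
  have T3' := sc _ T3
  rw [key]
  refine (abs_add_le _ _).trans ?_
  have a1 := abs_add_le ((Ψ x1 - Ψ x2 - (u1 y - u2 y)) +
      (1 / (2 * π)) * (newt (h.WW P δ u1) x1 - newt (h.WW P δ u2) x1 -
        ∫ y', (u1 y' - u2 y') * log ‖y - y'‖ ∂(sig G S)) +
      (1 / (2 * π)) * ((newt (h.WW P δ u2) x1 - newt P x1) -
        (newt (h.WW P δ u2) x2 - newt P x2))) (hpot R (h.WW P δ u1) x1 - hpot R (h.WW P δ u2) x1)
  have a2 := abs_add_le ((Ψ x1 - Ψ x2 - (u1 y - u2 y)) +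
      (1 / (2 * π)) * (newt (h.WW P δ u1) x1 - newt (h.WW P δ u2) x1 -
        ∫ y', (u1 y' - u2 y') * log ‖y - y'‖ ∂(sig G S)))
      ((1 / (2 * π)) * ((newt (h.WW P δ u2) x1 - newt P x1) -
        (newt (h.WW P δ u2) x2 - newt P x2)))
  have a3 := abs_add_le (Ψ x1 - Ψ x2 - (u1 y - u2 y))
      ((1 / (2 * π)) * (newt (h.WW P δ u1) x1 - newt (h.WW P δ u2) x1 -
        ∫ y', (u1 y' - u2 y') * log ‖y - y'‖ ∂(sig G S)))
  linarith

lemma FR_zero (hp : h.Pch P δ) {R D : ℝ} (h1 : P ⊆ closedBall 0 D) (h2 : h.tube δ ⊆ closedBall 0 D)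
    (hR : 0 < R) (hD : 4 * D ≤ R) {y : Pt} (hy : y ∈ S) :
    |h.FR P δ R (fun _ => 0) y| ≤ D * D * volume.real P / R ^ 2 := by
  have hy' : ‖y‖ ≤ D := by
    have := pp_mem hp h2 hy (s := 0) (by simpa using hp.adm2.1)
    simpa [pp] using this
  have e : h.FR P δ R (fun _ => 0) y = hpot R P y - hpot R P 0 := by
    have : hpot R P 0 = 0 := by simp [hpot, hk_zero]
    rw [FR, PsiR, WW_zero hp, this]
    simp [pp, h.zero y hy]
  rw [e]
  have hD0 := (norm_nonneg y).trans hy'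
  refine (hpot_lip hp.opn.measurableSet h1 hR hD (by linarith) (by simp; linarith)).trans ?_
  rw [sub_zero]
  calc _ ≤ D / R ^ 2 * D * volume.real P := by gcongr
    _ = _ := by ring

lemma PsiR_grad (hp : h.Pch P δ) (m : Measurable u) {R D : ℝ}
    (h1 : P ⊆ closedBall 0 D) (h2 : h.tube δ ⊆ closedBall 0 D) (hR : 0 < R) (hD : 4 * D ≤ R)
    {x : Pt} (hx : ‖x‖ < 2 * R) : HasGradientAt (h.PsiR P δ R u)
      (G x + (1 / (2 * π)) • (bs (h.WW P δ u) x - bs P x) + gpot R (h.WW P δ u) x) x := by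
  have b : Bornology.IsBounded (h.WW P δ u) := isBounded_closedBall.subset (WW_sub h1 h2)
  have g1 := h.grad x
  have g2 := newt_hasGradientAt b x
  have g3 := newt_hasGradientAt hp.bdd x
  have g4 := hpot_hasGradientAt (meas_WW hp m) (WW_sub h1 h2) hR hD hx
  rw [hasGradientAt_iff_hasFDerivAt] at *
  have := (g1.add ((g2.sub g3).const_mul (1 / (2 * π)))).add g4
  simp only [map_add, map_smul, map_sub]
  exact this

lemma FR_cont (hp : h.Pch P δ) (m : Measurable u) (cu : ContinuousOn u S) (bu : ∀ y, |u y| < δ)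
    {R D : ℝ} (h1 : P ⊆ closedBall 0 D) (h2 : h.tube δ ⊆ closedBall 0 D) (hR : 0 < R)
    (hD : 4 * D ≤ R) : ContinuousOn (h.FR P δ R u) S := by
  have c1 : ContinuousOn (h.PsiR P δ R u) (ball 0 (2 * R)) := fun x hx =>
    (PsiR_grad hp m h1 h2 hR hD (by simpa using hx)).continuousAt.continuousWithinAt
  have c2 : ContinuousOn (fun y => pp G y (u y)) S :=
    h.contOn_pp.comp (continuousOn_id.prodMk cu) fun y hy => ⟨hy, trivial⟩
  refine c1.comp c2 fun y hy => ?_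
  have := pp_mem hp h2 hy (bu y)
  rw [mem_ball_zero_iff]
  have := (norm_nonneg _).trans this
  linarith

end Geo
end Trap

namespace Trap

variable {Ψ : Pt → ℝ} {G : Pt → Pt} {S : Set Pt} {K c0 M : ℝ} {P : Set Pt}

/-- a linear isometry preserving all the data -/
structure Sym (J : Pt ≃ₗᵢ[ℝ] Pt) (Ψ : Pt → ℝ) (S P : Set Pt) : Prop where
  psi : ∀ x, Ψ (J x) = Ψ x
  mS : ∀ x, J x ∈ S ↔ x ∈ S
  mP : ∀ x, J x ∈ P ↔ x ∈ P

variable {J : Pt ≃ₗᵢ[ℝ] Pt}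

lemma setInt_inv {W : Set Pt} (hW : ∀ x, J x ∈ W ↔ x ∈ W) (f : Pt → ℝ) :
    ∫ z in W, f (J z) = ∫ z in W, f z := by
  have hpre : J ⁻¹' W = W := by ext x; exact hW x
  have := J.measurePreserving.setIntegral_preimage_emb
    J.toHomeomorph.measurableEmbedding f W
  rw [hpre] at this
  exact this

lemma newt_inv {W : Set Pt} (hW : ∀ x, J x ∈ W ↔ x ∈ W) (x : Pt) : newt W (J x) = newt W x := by
  rw [newt, newt, ← setInt_inv hW]
  simp only [← map_sub, J.norm_map]

lemma hpot_inv {W : Set Pt} (hW : ∀ x, J x ∈ W ↔ x ∈ W) (R : ℝ) (x : Pt) :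
    hpot R W (J x) = hpot R W x := by
  rw [hpot, hpot, ← setInt_inv hW]
  simp only [hk, den, J.norm_map, J.inner_map_map]

namespace Geo
variable {h : Geo Ψ G S K c0 M} {δ δ' : ℝ} {u u1 u2 : Pt → ℝ}

lemma G_inv (h : Geo Ψ G S K c0 M) (sy : Sym J Ψ S P) (x : Pt) : G (J x) = J (G x) := by
  have h1 := (h.grad (J x)).hasFDerivAt
  have h2 : HasFDerivAt (fun y => Ψ (J y)) _ x := h1.comp x (J : Pt →L[ℝ] Pt).hasFDerivAt
  have h3 : (fun y => Ψ (J y)) = Ψ := funext sy.psi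
  rw [h3] at h2
  have h4 := h2.unique (h.grad x).hasFDerivAt
  refine ext_inner_right ℝ fun v => ?_
  obtain ⟨w, rfl⟩ := J.surjective v
  rw [J.inner_map_map]
  have := DFunLike.congr_fun h4 w
  simpa using this

lemma ker_inv (a : Pt) : ker (J a) = J (ker a) := by simp [ker]

lemma pp_inv (h : Geo Ψ G S K c0 M) (sy : Sym J Ψ S P) (y : Pt) (s : ℝ) :
    pp G (J y) s = J (pp G y s) := by
  simp [pp, h.G_inv sy, ker_inv]

lemma coords_inv (h : Geo Ψ G S K c0 M) (sy : Sym J Ψ S P) (hδ : Adm K c0 M δ) {z : Pt}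
    (hz : z ∈ h.tube δ) : h.ft (J z) = J (h.ft z) ∧ h.sc (J z) = h.sc z := by
  have hz' : |h.sc z| < δ := hz
  have := h.coords hδ ((sy.mS _).2 (h.ft_mem z)) hz'.le
  rwa [h.pp_inv sy, h.pp_ft] at this

lemma tube_inv1 (h : Geo Ψ G S K c0 M) (sy : Sym J Ψ S P) (hδ : Adm K c0 M δ) {z : Pt}
    (hz : z ∈ h.tube δ) : J z ∈ h.tube δ := by
  have := (h.coords_inv sy hδ hz).2
  simp only [tube, Set.mem_setOf_eq] at hz ⊢
  rwa [this]

lemma Sym_symm (sy : Sym J Ψ S P) : Sym J.symm Ψ S P where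
  psi x := by rw [← sy.psi, J.apply_symm_apply]
  mS x := by rw [← sy.mS, J.apply_symm_apply]
  mP x := by rw [← sy.mP, J.apply_symm_apply]

lemma tube_inv (h : Geo Ψ G S K c0 M) (sy : Sym J Ψ S P) (hδ : Adm K c0 M δ) (z : Pt) :
    J z ∈ h.tube δ ↔ z ∈ h.tube δ := by
  refine ⟨fun hz => ?_, h.tube_inv1 sy hδ⟩
  have := h.tube_inv1 (Sym_symm sy) hδ hz
  rwa [J.symm_apply_apply] at this

lemma WW_inv (hp : h.Pch P δ) (sy : Sym J Ψ S P) (hu : ∀ y ∈ S, u (J y) = u y) (z : Pt) :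
    J z ∈ h.WW P δ u ↔ z ∈ h.WW P δ u := by
  have ha := Adm2.adm h hp.adm2
  by_cases hz : z ∈ h.tube δ
  · rw [mem_WW_tube hz, mem_WW_tube ((h.tube_inv sy ha z).2 hz), (h.coords_inv sy ha hz).1,
      (h.coords_inv sy ha hz).2, hu _ (h.ft_mem z)]
  · rw [mem_WW_out hz, mem_WW_out (fun hh => hz ((h.tube_inv sy ha z).1 hh)), sy.mP]

lemma PsiR_inv (hp : h.Pch P δ) (sy : Sym J Ψ S P) (hu : ∀ y ∈ S, u (J y) = u y) (R : ℝ) (x : Pt) :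
    h.PsiR P δ R u (J x) = h.PsiR P δ R u x := by
  rw [PsiR, PsiR, sy.psi, newt_inv (WW_inv hp sy hu), newt_inv sy.mP, hpot_inv (WW_inv hp sy hu)]

lemma FR_inv (hp : h.Pch P δ) (sy : Sym J Ψ S P) (hu : ∀ y ∈ S, u (J y) = u y) (R : ℝ) {y : Pt}
    (hy : y ∈ S) : h.FR P δ R u (J y) = h.FR P δ R u y := by
  rw [FR, FR, hu y hy, h.pp_inv sy, PsiR_inv hp sy hu]

lemma sig_inv (h : Geo Ψ G S K c0 M) (sy : Sym J Ψ S P) :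
    MeasurePreserving J (sig G S) (sig G S) := by
  refine ⟨J.continuous.measurable, ?_⟩
  have hS := h.compact.measurableSet
  have hpre : J ⁻¹' S = S := by ext x; exact sy.mS x
  have mp : MeasurePreserving J (μH[1] : Measure Pt) μH[1] :=
    J.toIsometryEquiv.measurePreserving_hausdorffMeasure 1
  have emb := J.toHomeomorph.measurableEmbedding
  have mp2 : MeasurePreserving J ((μH[1] : Measure Pt).restrict S) (μH[1].restrict S) := by
    have := mp.restrict_preimage hS
    rwa [hpre] at this
  ext A hA
  rw [Measure.map_apply J.continuous.measurable hA, sig, withDensity_apply _ hA,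
    withDensity_apply _ (J.continuous.measurable hA)]
  rw [← mp2.setLIntegral_comp_preimage_emb emb (fun y => ENNReal.ofReal ‖G y‖⁻¹) A]
  simp only [h.G_inv sy, J.norm_map]

end Geo
end Trap

namespace Trap

variable {Ψ : Pt → ℝ} {G : Pt → Pt} {S : Set Pt} {K c0 M : ℝ} {P : Set Pt}

/-- single layer potential -/
def slp (G : Pt → Pt) (S : Set Pt) (f : Pt → ℝ) (x : Pt) : ℝ :=
  (1 / (2 * π)) * ∫ y, f y * log ‖x - y‖ ∂(sig G S)

lemma pi_le_one : 1 / (2 * π) ≤ 1 := by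
  rw [div_le_one (by positivity)]; linarith [Real.pi_gt_three]

namespace Geo

lemma slp_bd (h : Geo Ψ G S K c0 M) : ∃ A ≥ 0, ∀ (f : Pt → ℝ) (B : ℝ), Measurable f →
    (∀ y, |f y| ≤ B) → (∀ x ∈ S, Integrable (fun y => f y * log ‖x - y‖) (sig G S)) ∧
    (∀ x ∈ S, |slp G S f x| ≤ A * B) ∧
    (∀ x ∈ S, ∀ x' ∈ S, |slp G S f x - slp G S f x'| ≤ A * B * √‖x - x'‖) := by
  obtain ⟨C, hC, hs⟩ := h.sig_sqrt_int
  obtain ⟨D, hD⟩ := h.compact.isBounded.subset_closedBall 0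
  obtain ⟨y0, hy0⟩ := h.nonempty
  have hD0 : 0 ≤ D := (norm_nonneg _).trans (by simpa using hD hy0)
  have aeS : ∀ᵐ y ∂(sig G S), y ∈ S := by
    rw [ae_iff]; exact h.sig_compl
  have dist_le : ∀ x ∈ S, ∀ y ∈ S, ‖x - y‖ ≤ 2 * D := fun x hx y hy => by
    have h1 : ‖x‖ ≤ D := by simpa using hD hx
    have h2 : ‖y‖ ≤ D := by simpa using hD hy
    linarith [norm_sub_le x y]
  have pi0 : 0 ≤ 1 / (2 * π) := by positivity
  have pis : ∀ a b : ℝ, |a| ≤ b → |1 / (2 * π) * a| ≤ b := fun a b hab => by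
    rw [abs_mul, abs_of_nonneg pi0]
    exact (mul_le_of_le_one_left (abs_nonneg _) pi_le_one).trans hab
  refine ⟨2 * (2 * D + 1) * C + 4 * C, by positivity, fun f B mf bf => ?_⟩
  have hB : 0 ≤ B := (abs_nonneg _).trans (bf 0)
  have b1 : ∀ x ∈ S, ∀ᵐ y ∂(sig G S), ‖f y * log ‖x - y‖‖ ≤
      (B * (2 * (2 * D + 1))) * (√‖x - y‖)⁻¹ := fun x hx => by
    filter_upwards [aeS, h.sig_ne x] with y hy hne
    rw [norm_mul, Real.norm_eq_abs, Real.norm_eq_abs, mul_assoc]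
    refine mul_le_mul (bf y) ?_ (abs_nonneg _) hB
    exact abs_log_le_sqrt (norm_pos_iff.2 (sub_ne_zero.2 hne.symm)) (dist_le x hx y hy)
  have int : ∀ x ∈ S, Integrable (fun y => f y * log ‖x - y‖) (sig G S) := fun x hx =>
    ((hs x).1.const_mul (B * (2 * (2 * D + 1)))).mono'
      (Measurable.aestronglyMeasurable (by fun_prop)) (b1 x hx)
  refine ⟨int, fun x hx => ?_, fun x hx x' hx' => ?_⟩
  · refine pis _ _ ?_
    rw [← Real.norm_eq_abs]
    refine (norm_integral_le_of_norm_le ((hs x).1.const_mul (B * (2 * (2 * D + 1))))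
      (b1 x hx)).trans ?_
    rw [integral_const_mul]
    have := mul_le_mul_of_nonneg_left (hs x).2 (by positivity : 0 ≤ B * (2 * (2 * D + 1)))
    nlinarith [mul_nonneg hB hC.le]
  · rw [slp, slp, ← mul_sub]
    refine pis _ _ ?_
    rw [← integral_sub (int x hx) (int x' hx'), ← Real.norm_eq_abs]
    refine (norm_integral_le_of_norm_le (((hs x).1.add (hs x').1).const_mul
      (B * (2 * √‖x - x'‖))) ?_).trans ?_
    · filter_upwards [h.sig_ne x, h.sig_ne x'] with y hy hy'
      rw [← mul_sub, norm_mul, Real.norm_eq_abs, Real.norm_eq_abs, mul_assoc]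
      refine mul_le_mul (bf y) ?_ (abs_nonneg _) hB
      refine (abs_log_sub_le_sqrt (norm_pos_iff.2 (sub_ne_zero.2 hy.symm))
        (norm_pos_iff.2 (sub_ne_zero.2 hy'.symm))).trans ?_
      simp only [Pi.add_apply]
      gcongr
      refine (abs_norm_sub_norm_le _ _).trans (le_of_eq ?_)
      congr 1; abel
    · rw [integral_const_mul]
      simp only [Pi.add_apply]
      rw [integral_add (hs x).1 (hs x').1]
      calc _ ≤ B * (2 * √‖x - x'‖) * (C + C) := by
            gcongr
            · exact (hs x).2
            · exact (hs x').2
        _ = 4 * C * B * √‖x - x'‖ := by ring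
        _ ≤ _ := by gcongr; linarith [show 0 ≤ 2 * (2 * D + 1) * C by positivity]

open BoundedContinuousFunction

open Classical in
/-- extension by zero -/
def ext0 (S : Set Pt) (φ : S →ᵇ ℝ) (y : Pt) : ℝ := if hy : y ∈ S then φ ⟨y, hy⟩ else 0

lemma ext0_apply (φ : S →ᵇ ℝ) {y : Pt} (hy : y ∈ S) : ext0 S φ y = φ ⟨y, hy⟩ := by
  simp [ext0, hy]

lemma ext0_cont (φ : S →ᵇ ℝ) : ContinuousOn (ext0 S φ) S := by
  rw [continuousOn_iff_continuous_domRestrict]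
  convert φ.continuous using 1
  ext y
  simp [ext0_apply φ y.2]

lemma ext0_meas (h : Geo Ψ G S K c0 M) (φ : S →ᵇ ℝ) : Measurable (ext0 S φ) := by
  classical
  exact Measurable.dite (s := S) (f := fun y => φ y) (g := fun _ => (0:ℝ)) φ.continuous.measurable
    measurable_const h.compact.measurableSet

lemma ext0_abs (φ : S →ᵇ ℝ) (y : Pt) : |ext0 S φ y| ≤ ‖φ‖ := by
  by_cases hy : y ∈ S
  · rw [ext0_apply φ hy]; exact φ.norm_coe_le_norm _
  · simp [ext0, hy]

lemma ext0_sub (φ ψ : S →ᵇ ℝ) (y : Pt) : ext0 S (φ - ψ) y = ext0 S φ y - ext0 S ψ y := by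
  by_cases hy : y ∈ S <;> simp [ext0, hy]

lemma ext0_add (φ ψ : S →ᵇ ℝ) (y : Pt) : ext0 S (φ + ψ) y = ext0 S φ y + ext0 S ψ y := by
  by_cases hy : y ∈ S <;> simp [ext0, hy]

lemma ext0_smul (c : ℝ) (φ : S →ᵇ ℝ) (y : Pt) : ext0 S (c • φ) y = c * ext0 S φ y := by
  by_cases hy : y ∈ S <;> simp [ext0, hy]

lemma op (h : Geo Ψ G S K c0 M) : ∃ T : (S →ᵇ ℝ) →L[ℝ] (S →ᵇ ℝ), IsCompactOperator T ∧
    ∀ φ (x : S), T φ x = slp G S (ext0 S φ) x := by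
  obtain ⟨A, hA, hb⟩ := h.slp_bd
  have hb' := fun φ : S →ᵇ ℝ => hb (ext0 S φ) ‖φ‖ (h.ext0_meas φ) (ext0_abs φ)
  have cs : CompactSpace S := isCompact_iff_compactSpace.1 h.compact
  have cont : ∀ φ : S →ᵇ ℝ, Continuous fun x : S => slp G S (ext0 S φ) x := fun φ => by
    rw [continuous_iff_continuousAt]
    intro x
    rw [ContinuousAt, tendsto_iff_norm_sub_tendsto_zero]
    have : Tendsto (fun y : S => A * ‖φ‖ * √‖(y:Pt) - x‖) (𝓝 x) (𝓝 0) := by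
      have : Continuous (fun y : S => A * ‖φ‖ * √‖(y:Pt) - x‖) := by fun_prop
      simpa using this.tendsto x
    refine squeeze_zero (fun _ => norm_nonneg _) (fun y => ?_) this
    exact (hb' φ).2.2 y y.2 x x.2
  let T0 : (S →ᵇ ℝ) →ₗ[ℝ] (S →ᵇ ℝ) :=
    { toFun := fun φ => mkOfCompact ⟨fun x : S => slp G S (ext0 S φ) x, cont φ⟩
      map_add' := fun φ ψ => by
        ext x
        simp only [mkOfCompact_apply, ContinuousMap.coe_mk, BoundedContinuousFunction.coe_add, Pi.add_apply, slp, ext0_add,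
          add_mul]
        rw [integral_add ((hb' φ).1 x x.2) ((hb' ψ).1 x x.2), mul_add]
      map_smul' := fun c φ => by
        ext x
        simp only [mkOfCompact_apply, ContinuousMap.coe_mk, BoundedContinuousFunction.coe_smul, slp, ext0_smul,
          mul_assoc, RingHom.id_apply, smul_eq_mul]
        rw [integral_const_mul]
        ring }
  have T0a : ∀ φ (x : S), T0 φ x = slp G S (ext0 S φ) x := fun φ x => rfl
  let T : (S →ᵇ ℝ) →L[ℝ] (S →ᵇ ℝ) := T0.mkContinuous A fun φ => by
    rw [BoundedContinuousFunction.norm_le (by positivity)]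
    intro x
    rw [T0a]
    exact (hb' φ).2.1 x x.2
  refine ⟨T, ?_, fun φ x => rfl⟩
  have : IsCompactOperator T0 := by
    rw [isCompactOperator_iff_isCompact_closure_image_closedBall T0 one_pos]
    refine arzela_ascoli (closedBall 0 A) (isCompact_closedBall _ _) _ ?_ ?_
    · rintro _ x ⟨φ, hφ, rfl⟩
      rw [mem_closedBall_zero_iff] at hφ
      rw [T0a, mem_closedBall_zero_iff, Real.norm_eq_abs]
      refine ((hb' φ).2.1 x x.2).trans ?_
      exact mul_le_of_le_one_right hA hφ
    · refine Metric.equicontinuous_of_continuity_modulus (fun t => A * √t) ?_ _ ?_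
      · have : Continuous (fun t : ℝ => A * √t) := by fun_prop
        simpa using this.tendsto 0
      · rintro x y ⟨_, φ, hφ, rfl⟩
        rw [mem_closedBall_zero_iff] at hφ
        rw [Real.dist_eq]
        refine ((hb' φ).2.2 x x.2 y y.2).trans ?_
        rw [Subtype.dist_eq, dist_eq_norm]
        gcongr
        exact mul_le_of_le_one_right hA hφ
  exact this

end Geo

lemma fixpt {X : Type*} [NormedAddCommGroup X] [NormedSpace ℝ X] [CompleteSpace X]
    (L Li : X → X) (h1 : ∀ x, Li (L x) = x) (h2 : ∀ x, L (Li x) = x)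
    (map_sub : ∀ a b, Li (a - b) = Li a - Li b) {N r : ℝ} (hN : 0 ≤ N) (bd : ∀ a, ‖Li a‖ ≤ N * ‖a‖)
    (F : X → X) (hF : ∀ u v, ‖u‖ ≤ r → ‖v‖ ≤ r → N * ‖F u - F v - L (u - v)‖ ≤ 1 / 2 * ‖u - v‖)
    (h0 : N * ‖F 0‖ ≤ r / 2) : ∃ u, ‖u‖ ≤ r ∧ F u = 0 := by
  have hr : 0 ≤ r := by nlinarith [mul_nonneg hN (norm_nonneg (F 0))]
  have key : ∀ u v, ‖u‖ ≤ r → ‖v‖ ≤ r →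
      ‖(u - Li (F u)) - (v - Li (F v))‖ ≤ 1 / 2 * ‖u - v‖ := fun u v hu hv => by
    have e : (u - Li (F u)) - (v - Li (F v)) = - Li (F u - F v - L (u - v)) := by
      rw [map_sub, map_sub, h1]; abel
    rw [e, norm_neg]
    exact (bd _).trans (hF u v hu hv)
  have hmap : Set.MapsTo (fun u => u - Li (F u)) (closedBall 0 r) (closedBall 0 r) := fun u hu => by
    rw [mem_closedBall_zero_iff] at hu ⊢
    have := key u 0 hu (by simpa using hr)
    have e : u - Li (F u) = ((u - Li (F u)) - (0 - Li (F 0))) + (- Li (F 0)) := by abel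
    show ‖u - Li (F u)‖ ≤ r
    rw [e]
    refine (norm_add_le _ _).trans ?_
    rw [norm_neg]
    rw [sub_zero] at this
    linarith [bd (F 0)]
  have hc : ContractingWith (1 / 2) (hmap.restrict _ _ _) := by
    refine ⟨by simpa using NNReal.half_lt_self one_ne_zero, LipschitzWith.of_dist_le_mul ?_⟩
    rintro ⟨u, hu⟩ ⟨v, hv⟩
    rw [mem_closedBall_zero_iff] at hu hv
    have := key u v hu hv
    simpa [Subtype.dist_eq, dist_eq_norm] using this
  obtain ⟨u, hu, hfix, -⟩ := ContractingWith.exists_fixedPoint' (isClosed_closedBall.isComplete)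
    hmap hc (mem_closedBall_self hr) (edist_ne_top _ _)
  refine ⟨u, by simpa using hu, ?_⟩
  have : u - Li (F u) = u := hfix
  have : Li (F u) = 0 := by simpa using this
  have h00 : Li 0 = 0 := by simpa using map_sub 0 0
  rw [← h2 (F u), this, ← h00, h2, h00]

end Trap

namespace Trap

variable {Ψ : Pt → ℝ} {G : Pt → Pt} {S : Set Pt} {K c0 M : ℝ} {P : Set Pt}
open BoundedContinuousFunction

lemma fred {X : Type*} [NormedAddCommGroup X] [NormedSpace ℝ X] [CompleteSpace X]
    (T : X →L[ℝ] X) (hT : IsCompactOperator T) (inj : ∀ x, x + T x = 0 → x = 0) :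
    ∃ L Li : X → X, (∀ x, Li (L x) = x) ∧ (∀ x, L (Li x) = x) ∧
    (∀ a b, Li (a - b) = Li a - Li b) ∧ (∃ N : ℝ, 0 ≤ N ∧ ∀ a, ‖Li a‖ ≤ N * ‖a‖) ∧ ∀ x, L x = x + T x := by
  have hev : ¬ Module.End.HasEigenvalue (T : Module.End ℝ X) (-1) := by
    intro he
    obtain ⟨φ, hφ⟩ := he.exists_hasEigenvector
    have e : T φ = (-1 : ℝ) • φ := hφ.apply_eq_smul
    exact hφ.2 (inj φ (by rw [e]; simp))
  have hres := (IsCompactOperator.hasEigenvalue_or_mem_resolventSet hT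
    (show (-1:ℝ) ≠ 0 by norm_num)).resolve_left hev
  rw [spectrum.mem_resolventSet_iff] at hres
  obtain ⟨U, hU⟩ := hres
  have hU2 : ∀ φ, (U : X →L[ℝ] X) φ = -φ - T φ := fun φ => by
    rw [hU]; simp [Algebra.algebraMap_eq_smul_one]
  refine ⟨(-(U : X →L[ℝ] X) : X →L[ℝ] X), (-(↑U⁻¹ : X →L[ℝ] X) : X →L[ℝ] X), ?_, ?_, fun a b => map_sub _ a b,
    ⟨‖(-(↑U⁻¹ : X →L[ℝ] X) : X →L[ℝ] X)‖, norm_nonneg _, fun a => ContinuousLinearMap.le_opNorm (-(↑U⁻¹ : X →L[ℝ] X) : X →L[ℝ] X) a⟩, ?_⟩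
  · intro x
    have := DFunLike.congr_fun (U.inv_mul) x
    simp only [_root_.neg_apply, map_neg, neg_neg]
    exact this
  · intro x
    have := DFunLike.congr_fun (U.mul_inv) x
    simp only [_root_.neg_apply, map_neg, neg_neg]
    exact this
  · intro φ
    rw [_root_.neg_apply, hU2]
    abel

namespace Geo

/-- symmetric functions -/
def symSub (S : Set Pt) (J : Set (Pt ≃ₗᵢ[ℝ] Pt)) : Submodule ℝ (S →ᵇ ℝ) where
  carrier := {φ | ∀ j ∈ J, ∀ y y' : S, (y' : Pt) = j y → φ y' = φ y}
  add_mem' := fun {a b} ha hb j hj y y' hy => by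
    simp [ha j hj y y' hy, hb j hj y y' hy]
  zero_mem' := fun j hj y y' hy => by simp
  smul_mem' := fun c a ha j hj y y' hy => by simp [ha j hj y y' hy]

lemma symSub_closed (S : Set Pt) (J : Set (Pt ≃ₗᵢ[ℝ] Pt)) :
    IsClosed (symSub S J : Set (S →ᵇ ℝ)) := by
  have : (symSub S J : Set (S →ᵇ ℝ)) =
      ⋂ j ∈ J, ⋂ y : S, ⋂ y' : S, ⋂ _ : (y' : Pt) = j y, {φ | φ y' = φ y} := by
    ext φ
    simp [symSub]
  rw [this]
  refine isClosed_biInter fun j _ => isClosed_iInter fun y => isClosed_iInter fun y' =>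
    isClosed_iInter fun _ => ?_
  exact isClosed_eq (continuous_eval_const (F := S →ᵇ ℝ) y')
    (continuous_eval_const (F := S →ᵇ ℝ) y)

lemma symSub_ext {J : Set (Pt ≃ₗᵢ[ℝ] Pt)} (sy : ∀ j ∈ J, Sym j Ψ S P) {φ : S →ᵇ ℝ}
    (hφ : φ ∈ symSub S J) {j : Pt ≃ₗᵢ[ℝ] Pt} (hj : j ∈ J) (y : Pt) :
    ext0 S φ (j y) = ext0 S φ y := by
  by_cases hy : y ∈ S
  · have hy' := ((sy j hj).mS y).2 hy
    rw [ext0_apply φ hy, ext0_apply φ hy']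
    exact hφ j hj ⟨y, hy⟩ ⟨j y, hy'⟩ rfl
  · have hy' : j y ∉ S := fun hh => hy (((sy j hj).mS y).1 hh)
    simp [ext0, hy, hy']

lemma int_sig (h : Geo Ψ G S K c0 M) (f : Pt → ℝ) :
    ∫ y, f y ∂(sig G S) = ∫ y in S, f y * ‖G y‖⁻¹ ∂μH[1] := by
  rw [sig, integral_withDensity_eq_integral_toReal_smul]
  · refine integral_congr_ae (Eventually.of_forall fun y => ?_)
    simp only [smul_eq_mul]
    rw [ENNReal.toReal_ofReal (by positivity), mul_comm]
  · have := h.measG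
    fun_prop
  · exact Eventually.of_forall fun y => ENNReal.ofReal_lt_top

lemma linv (h : Geo Ψ G S K c0 M) (J : Set (Pt ≃ₗᵢ[ℝ] Pt)) (sy : ∀ j ∈ J, Sym j Ψ S P)
    (nd : ∀ φ : Pt → ℝ, ContinuousOn φ S → (∀ x ∈ S, ∀ j ∈ J, φ (j x) = φ x) →
      (∀ x ∈ S, φ x + ∫ y in S, (1 / (2 * π)) * Real.log ‖x - y‖ * (φ y / ‖G y‖) ∂μH[1] = 0) →
      ∀ x ∈ S, φ x = 0) :
    ∃ L Li : symSub S J → symSub S J, (∀ x, Li (L x) = x) ∧ (∀ x, L (Li x) = x) ∧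
      (∀ a b, Li (a - b) = Li a - Li b) ∧ (∃ N : ℝ, 0 ≤ N ∧ ∀ a, ‖Li a‖ ≤ N * ‖a‖) ∧
      ∀ (φ : symSub S J) (x : S), (L φ : S →ᵇ ℝ) x = (φ : S →ᵇ ℝ) x +
        slp G S (ext0 S φ) x := by
  obtain ⟨T, hT, hTa⟩ := h.op
  have hV : ∀ φ ∈ symSub S J, T φ ∈ symSub S J := fun φ hφ j hj y y' hy => by
    rw [hTa, hTa, slp, slp, hy,
      ← ((h.sig_inv (sy j hj)).integral_comp j.toHomeomorph.measurableEmbedding)]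
    congr 1
    refine integral_congr_ae (Eventually.of_forall fun z => ?_)
    simp only [← map_sub, j.norm_map, symSub_ext sy hφ hj]
  have hcl := symSub_closed S J
  have : CompleteSpace (symSub S J) := hcl.completeSpace_coe
  let T1 : symSub S J →L[ℝ] symSub S J := T.restrict hV
  have T1a : ∀ φ : symSub S J, (T1 φ : S →ᵇ ℝ) = T φ := fun φ => rfl
  have T1c : IsCompactOperator T1 :=
    IsCompactOperator.restrict (f := (T : (S →ᵇ ℝ) →ₗ[ℝ] (S →ᵇ ℝ))) hT hV hcl
  have inj : ∀ φ : symSub S J, φ + T1 φ = 0 → φ = 0 := fun φ e => by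
    have e2 : ∀ x : S, T φ x = - (φ : S →ᵇ ℝ) x := fun x => by
      have := congrArg (fun ψ : symSub S J => (ψ : S →ᵇ ℝ) x) e
      have : (φ : S →ᵇ ℝ) x + T φ x = 0 := this
      linarith
    have := nd (ext0 S φ) (ext0_cont _) (fun x _ j hj => symSub_ext sy φ.2 hj x) (fun x hx => by
      have := e2 ⟨x, hx⟩
      rw [hTa, slp, h.int_sig, ← integral_const_mul] at this
      rw [ext0_apply _ hx, add_comm, ← eq_neg_iff_add_eq_zero, ← this]
      refine integral_congr_ae (Eventually.of_forall fun y => ?_)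
      simp only [div_eq_mul_inv]
      ring)
    ext x
    have := this x x.2
    rw [ext0_apply _ x.2] at this
    simpa using this
  obtain ⟨L, Li, h1, h2, h4, h5, h3⟩ := fred (X := symSub S J) T1 T1c inj
  refine ⟨L, Li, h1, h2, h4, h5, fun φ x => ?_⟩
  rw [h3, ← hTa]
  rfl

end Geo

end Trap

namespace Trap

variable {Ψ : Pt → ℝ} {G : Pt → Pt} {S : Set Pt} {K c0 M : ℝ} {P : Set Pt}
open BoundedContinuousFunction

namespace Geo

lemma exists_fix (h : Geo Ψ G S K c0 M) (J : Set (Pt ≃ₗᵢ[ℝ] Pt)) (sy : ∀ j ∈ J, Sym j Ψ S P)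
    (nd : ∀ φ : Pt → ℝ, ContinuousOn φ S → (∀ x ∈ S, ∀ j ∈ J, φ (j x) = φ x) →
      (∀ x ∈ S, φ x + ∫ y in S, (1 / (2 * π)) * Real.log ‖x - y‖ * (φ y / ‖G y‖) ∂μH[1] = 0) →
      ∀ x ∈ S, φ x = 0) :
    ∃ δ0 > 0, ∃ B > 0, ∀ δ ≤ δ0, h.Pch P δ → ∀ D, P ⊆ closedBall 0 D → h.tube δ ⊆ closedBall 0 D →
      ∃ R0 : ℝ, ∀ R, R0 ≤ R → ∃ u : Pt → ℝ, Measurable u ∧ ContinuousOn u S ∧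
        (∀ y, |u y| ≤ B * (D * D * volume.real P) / R ^ 2) ∧
        (∀ j ∈ J, ∀ y ∈ S, u (j y) = u y) ∧ ∀ y ∈ S, h.FR P δ R u y = 0 := by
  obtain ⟨L, Li, hl1, hl2, hl3, ⟨N, hN0, hl4⟩, hL⟩ := h.linv J sy nd
  have : CompleteSpace (symSub S J) := (symSub_closed S J).completeSpace_coe
  have cs : CompactSpace S := isCompact_iff_compactSpace.1 h.compact
  obtain ⟨δ0, hδ0, hB⟩ := h.Best (ε := 1 / (2 * (N + 1))) (by positivity)
  refine ⟨δ0, hδ0, 2 * N + 1, by positivity, fun δ hδ hp D h1 h2 => ?_⟩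
  obtain ⟨R1, hR1⟩ := hB P δ hδ hp D h1 h2
  have hδp := hp.adm2.1
  set A := D * D * volume.real P with hA
  have hA0 : 0 ≤ A := mul_nonneg (mul_self_nonneg D) measureReal_nonneg
  refine ⟨max (max R1 1) (max (4 * D) (((2 * N + 1) * A + 1) / δ)), fun R hR => ?_⟩
  simp only [max_le_iff] at hR
  obtain ⟨⟨r1, r2⟩, r3, r4⟩ := hR
  have hR0 : 0 < R := by linarith
  set r := (2 * N + 1) * A / R ^ 2 with hr
  have hr0 : 0 ≤ r := by positivity
  have hrδ : r < δ := by
    rw [hr, div_lt_iff₀ (by positivity)]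
    rw [div_le_iff₀ hδp] at r4
    have : R ≤ R ^ 2 := by nlinarith
    nlinarith
  have bnd : ∀ u : symSub S J, ‖u‖ ≤ r → ∀ y, |ext0 S u y| < δ := fun u hu y =>
    lt_of_le_of_lt ((ext0_abs _ y).trans hu) hrδ
  have hF : ∀ u : symSub S J, ∃ v : symSub S J, ‖u‖ ≤ r →
      ∀ x : S, (v : S →ᵇ ℝ) x = h.FR P δ R (ext0 S u) x := fun u => by
    by_cases hu : ‖u‖ ≤ r
    · have c := FR_cont hp (h.ext0_meas u) (ext0_cont _) (bnd u hu) h1 h2 hR0 r3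
      rw [continuousOn_iff_continuous_domRestrict] at c
      refine ⟨⟨mkOfCompact ⟨_, c⟩, fun j hj y y' hy => ?_⟩, fun _ x => rfl⟩
      simp only [mkOfCompact_apply, ContinuousMap.coe_mk, Set.domRestrict_apply, hy]
      exact FR_inv hp (sy j hj) (fun y _ => symSub_ext sy u.2 hj y) R y.2
    · exact ⟨0, fun hh => absurd hh hu⟩
  choose F hF using hF
  obtain ⟨u, hu, hFu⟩ := fixpt (X := symSub S J) L Li hl1 hl2 hl3 (r := r) hN0 hl4 F (fun u v hu hv => by
      have : ‖F u - F v - L (u - v)‖ ≤ 1 / (2 * (N + 1)) * ‖u - v‖ := by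
        refine (BoundedContinuousFunction.norm_le (by positivity)).2 fun x => ?_
        have := hR1 R r1 (ext0 S u) (ext0 S v) (h.ext0_meas u) (h.ext0_meas v) (bnd u hu) (bnd v hv)
          ‖u - v‖ (fun y _ => by rw [← ext0_sub]; exact ext0_abs _ y) x x.2
        have e : ((F u - F v - L (u - v) : symSub S J) : S →ᵇ ℝ) x =
          (F u : S →ᵇ ℝ) x - (F v : S →ᵇ ℝ) x - (L (u - v) : S →ᵇ ℝ) x := rfl
        show ‖((F u - F v - L (u - v) : symSub S J) : S →ᵇ ℝ) x‖ ≤ _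
        rw [e, hF u hu, hF v hv, hL, slp, Real.norm_eq_abs]
        convert this using 5
        · show (u : S →ᵇ ℝ) x - (v : S →ᵇ ℝ) x = _
          rw [ext0_apply _ x.2, ext0_apply _ x.2]
        · refine integral_congr_ae (Eventually.of_forall fun y => ?_)
          show ext0 S ((u : S →ᵇ ℝ) - v) y * _ = _
          rw [ext0_sub]
      calc _ ≤ N * (1 / (2 * (N + 1)) * ‖u - v‖) := by gcongr
        _ = (N / (N + 1)) * (1 / 2 * ‖u - v‖) := by field_simp
        _ ≤ _ := mul_le_of_le_one_left (by positivity)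
          ((div_le_one (by positivity)).2 (by linarith)))
    (by
      have : ‖F 0‖ ≤ A / R ^ 2 := by
        refine (BoundedContinuousFunction.norm_le (by positivity)).2 fun x => ?_
        show ‖(F 0 : S →ᵇ ℝ) x‖ ≤ _
        rw [hF 0 (by simpa using hr0)]
        have e : ext0 S ((0 : symSub S J) : S →ᵇ ℝ) = fun _ => 0 := by
          ext y; by_cases hy : y ∈ S <;> simp [ext0, hy]
        rw [e]
        exact FR_zero hp h1 h2 hR0 r3 x.2
      calc _ ≤ N * (A / R ^ 2) := by gcongr
        _ ≤ (N + 1 / 2) * (A / R ^ 2) := by gcongr; linarith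
        _ = _ := by rw [hr]; ring)
  refine ⟨ext0 S u, h.ext0_meas u, ext0_cont _, fun y => (ext0_abs _ y).trans hu,
    fun j hj y _ => symSub_ext sy u.2 hj y, fun y hy => ?_⟩
  rw [← hF u hu ⟨y, hy⟩, hFu]
  rfl

end Geo

end Trap

namespace Trap

variable {Ψ : Pt → ℝ} {G : Pt → Pt} {S : Set Pt} {K c0 M : ℝ}
namespace Geo
variable {h : Geo Ψ G S K c0 M} {P : Set Pt} {δ δ' : ℝ} {u u1 u2 : Pt → ℝ}

variable (h) in
lemma Mono {ε : ℝ} (hε : 0 < ε) : ∃ δ0 > 0, ∀ (P : Set Pt) (δ : ℝ), δ ≤ δ0 → h.Pch P δ →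
    ∀ D, P ⊆ closedBall 0 D → h.tube δ ⊆ closedBall 0 D → ∃ R0 : ℝ, ∀ R, R0 ≤ R →
    ∀ u : Pt → ℝ, Measurable u → ∀ y ∈ S, ∀ s s', |s| < δ → |s'| < δ →
    |h.PsiR P δ R u (pp G y s) - h.PsiR P δ R u (pp G y s') - (s - s')| ≤ ε * |s - s'| := by
  have hc := h.c0_pos
  have hK := h.K_pos
  obtain ⟨δ2, hδ2, C2, hC2, hE⟩ := h.E1'
  set δ4 := ε * c0 ^ 2 / (5 * K) with hδ4
  set δ5 := (ε * c0 / (30 * C2)) ^ 2 with hδ5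
  have hdelp_four : 0 < δ4 := by positivity
  have hdelp_five : 0 < δ5 := by positivity
  refine ⟨min (min δ2 δ4) (min δ5 1), by positivity, fun P δ hδ hp D hPD hTD => ?_⟩
  simp only [le_min_iff] at hδ
  obtain ⟨⟨d2, d4⟩, d5, d6⟩ := hδ
  have hδp := hp.adm2.1
  have hadm := hp.adm2
  have hD0 : 0 ≤ D := by
    obtain ⟨y, hy⟩ := h.nonempty
    exact (norm_nonneg _).trans (pp_mem hp hTD hy (s := 0) (by simpa using hδp))
  set V := volume.real (closedBall (0:Pt) D) with hV
  have hV0 : 0 ≤ V := measureReal_nonneg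
  set A := D * V / c0 with hA
  have hA0 : 0 ≤ A := by positivity
  refine ⟨max 1 (max (4 * D) (A * (5 / (2 * ε)))), fun R hR u2 m2 y hy s s' bs bs' => ?_⟩
  simp only [max_le_iff] at hR
  obtain ⟨hR1, hR2, hR3⟩ := hR
  have hR0 : 0 < R := by linarith
  set d := |s - s'| with hd
  have hd0 : 0 ≤ d := abs_nonneg _
  have hAR : A / R ^ 2 ≤ 2 * ε / 5 := by
    rw [div_le_iff₀ (by positivity)]
    have : A ≤ 2 * ε / 5 * R := by
      have := mul_le_mul_of_nonneg_left hR3 (by positivity : 0 ≤ 2 * ε / 5)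
      calc A = 2 * ε / 5 * (A * (5 / (2 * ε))) := by field_simp
        _ ≤ _ := this
    refine this.trans ?_
    gcongr
    nlinarith
  set x1 := pp G y s with hx1
  set x2 := pp G y s' with hx2
  have n1 : ‖x1‖ ≤ D := pp_mem hp hTD hy bs
  have n2 : ‖x2‖ ≤ D := pp_mem hp hTD hy bs'
  have n1' : ‖x1‖ ≤ 2 * R := by linarith
  have n2' : ‖x2‖ ≤ 2 * R := by linarith
  have x12 : ‖x1 - x2‖ ≤ d / c0 := by
    have : x1 - x2 = (s - s') • ker (G y) := by rw [hx1, hx2, pp, pp, sub_smul]; abel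
    rw [this, norm_smul, Real.norm_eq_abs, div_eq_mul_one_div]
    exact mul_le_mul le_rfl (h.normker hy) (norm_nonneg _) hd0
  have bW : ∀ u, Bornology.IsBounded (h.WW P δ u) := fun u =>
    isBounded_closedBall.subset (WW_sub hPD hTD)
  have T1 : |Ψ x1 - Ψ x2 - (s - s')| ≤ ε / 5 * d := by
    refine (h.psi_pp hy bs.le bs'.le).trans ?_
    have : K * δ / c0 ^ 2 ≤ ε / 5 := by
      rw [div_le_iff₀ (by positivity)]
      calc K * δ ≤ K * δ4 := by gcongr
        _ = _ := by rw [hδ4]; field_simp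
    exact mul_le_mul this le_rfl (abs_nonneg _) (by positivity)
  have pi0 : 0 ≤ 1 / (2 * π) := by positivity
  have e3 : ∀ x, newt (h.WW P δ u2) x - newt P x =
      ∫ z in h.tube δ, h.chi u2 (fun _ => 0) z • log ‖x - z‖ := fun x => by
    conv_lhs => rw [← WW_zero hp]
    have := int_WW_sub hp m2 (measurable_const (a := (0:ℝ))) (integrableOn_log (bW u2) x)
      (integrableOn_log (bW (fun _ => 0)) x)
    rw [WW_zero hp] at this ⊢
    exact this
  have T3 : |(newt (h.WW P δ u2) x1 - newt P x1) - (newt (h.WW P δ u2) x2 - newt P x2)| ≤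
      ε / 5 * d := by
    rw [e3, e3]
    refine (newt_diff hadm m2 measurable_const x1 x2).trans ?_
    have r1 := hE δ d2 d6 hadm x1
    have r2 := hE δ d2 d6 hadm x2
    have r3 := dlog hδp d6
    have r4 : √δ ≤ ε * c0 / (30 * C2) := by
      rw [Real.sqrt_le_left (by positivity)]; exact d5
    calc _ ≤ d / c0 * (C2 * (3 * (ε * c0 / (30 * C2))) + C2 * (3 * (ε * c0 / (30 * C2)))) := by
          gcongr
          · exact r1.trans (mul_le_mul_of_nonneg_left (r3.trans (by linarith)) hC2.le)
          · exact r2.trans (mul_le_mul_of_nonneg_left (r3.trans (by linarith)) hC2.le)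
      _ = ε / 5 * d := by field_simp; ring
  have T5 := hpot_lip (meas_WW hp m2) (WW_sub hPD hTD) hR0 hR2 n1' n2'
  have vW : volume.real (h.WW P δ u2) ≤ V :=
    measureReal_mono (WW_sub hPD hTD) (bounded_vol isBounded_closedBall)
  have T45 : |hpot R (h.WW P δ u2) x1 - hpot R (h.WW P δ u2) x2| ≤ 2 * ε / 5 * d := by
    calc _ ≤ D / R ^ 2 * (d / c0) * V := by
          refine (T5.trans ?_) ; gcongr
      _ = A / R ^ 2 * d := by rw [hA]; field_simp
      _ ≤ _ := by gcongr
  have key : h.PsiR P δ R u2 x1 - h.PsiR P δ R u2 x2 - (s - s') =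
      (Ψ x1 - Ψ x2 - (s - s')) +
      (1 / (2 * π)) * ((newt (h.WW P δ u2) x1 - newt P x1) -
        (newt (h.WW P δ u2) x2 - newt P x2)) +
      (hpot R (h.WW P δ u2) x1 - hpot R (h.WW P δ u2) x2) := by
    simp only [PsiR]; ring
  have sc : ∀ a : ℝ, |a| ≤ ε / 5 * d → |1 / (2 * π) * a| ≤ ε / 5 * d := fun a ha => by
    rw [abs_mul, abs_of_nonneg pi0]
    exact (mul_le_of_le_one_left (abs_nonneg _) pi_le_one).trans ha
  have T3' := sc _ T3
  rw [key]
  refine (abs_add_le _ _).trans ?_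
  refine (add_le_add_left (abs_add_le _ _) _).trans ?_
  have : 0 ≤ ε * d := by positivity
  linarith

lemma chi_supp {η : ℝ} {z : Pt} (hz : η < |h.sc z|) (hu : ∀ y, |u y| ≤ η) :
    h.chi u (fun _ => 0) z = 0 := by
  have := abs_le.1 (hu (h.ft z))
  simp only [chi, XX]
  rcases lt_abs.1 hz with h1 | h1
  · rw [if_neg (by linarith), if_neg (by linarith)]; simp
  · rw [if_pos (by linarith), if_pos (by linarith)]; simp

variable (h) in
lemma bs_est : ∃ δ0 > 0, ∃ C > 0, ∀ (P : Set Pt) (δ : ℝ), h.Pch P δ →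
    ∀ u : Pt → ℝ, Measurable u → Bornology.IsBounded (h.WW P δ u) → ∀ η, 0 < η → 2 * η ≤ δ0 →
    2 * η ≤ 1 → 2 * η ≤ δ →
    (∀ y, |u y| ≤ η) → ∀ x, ‖bs (h.WW P δ u) x - bs P x‖ ≤ C * (2 * η * (1 + log (2 * η)⁻¹)) := by
  obtain ⟨δ0, hδ0, C, hC, hE⟩ := h.E1'
  refine ⟨δ0, hδ0, C, hC, fun P δ hp u mu bW η hη e1 e2 e3 hu x => ?_⟩
  have ha := h.adm2_mono hp.adm2 (by positivity : 0 < 2 * η) e3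
  refine le_trans ?_ (hE (2 * η) e1 e2 ha x)
  have v1 := bounded_vol bW
  have v2 := bounded_vol hp.bdd
  have e : bs (h.WW P δ u) x - bs P x = ∫ z in h.tube δ, h.chi u (fun _ => 0) z • ker (x - z) := by
    have := int_WW_sub hp mu (measurable_const (a := (0:ℝ))) (integrableOn_ker v1 x)
      (by rw [WW_zero hp]; exact integrableOn_ker v2 x)
    rw [WW_zero hp] at this
    exact this
  have m2 := (h.isOpen_tube ha).measurableSet
  have m1 := (h.isOpen_tube hp.adm2).measurableSet
  have i2 := riesz_int_one (tube_vol (h := h) ha) x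
  rw [e, ← integral_indicator m1, ← integral_indicator m2]
  refine norm_integral_le_of_norm_le ((integrable_indicator_iff m2).2 i2)
    (Eventually.of_forall fun z => ?_)
  by_cases hz : z ∈ h.tube (2 * η)
  · rw [Set.indicator_of_mem hz, Set.indicator_of_mem (tube_mono e3 hz), norm_smul, norm_ker]
    exact mul_le_of_le_one_left (by positivity) (chi_abs_le z)
  · rw [Set.indicator_of_notMem hz]
    have : η < |h.sc z| := by
      have : 2 * η ≤ |h.sc z| := not_lt.1 hz
      linarith
    by_cases hz' : z ∈ h.tube δ
    · rw [Set.indicator_of_mem hz', chi_supp this hu]; simp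
    · rw [Set.indicator_of_notMem hz']; simp

lemma ind_int (hp : h.Pch P δ) (R : ℝ) (mu : Measurable u) :
    ∫ y in ball (0 : Pt) R, |(h.WW P δ u).indicator 1 y - P.indicator 1 y| ≤
      ∫ z in h.tube δ, |h.chi u (fun _ => 0) z| := by
  have e : ∀ z, |(h.WW P δ u).indicator 1 z - P.indicator 1 z| =
      (h.tube δ).indicator (fun z => |h.chi u (fun _ => 0) z|) z := fun z => by
    have := ind_eq (h := h) (P := P) (δ := δ) (u1 := u) (u2 := fun _ => 0) z
    rw [WW_zero hp] at this
    rw [this]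
    by_cases hz : z ∈ h.tube δ <;> simp [hz]
  simp only [e]
  have m1 := (h.isOpen_tube hp.adm2).measurableSet
  rw [← integral_indicator m1]
  refine setIntegral_le_integral ?_ (Eventually.of_forall fun z => ?_)
  · exact (integrable_indicator_iff m1).2 (chi_integrable hp.adm2 mu measurable_const).abs
  · exact Set.indicator_nonneg (fun _ _ => abs_nonneg _) z

lemma zero_set (hp : h.Pch P δ) {R : ℝ} {δ' : ℝ} (hδ' : δ' < δ) (hu : ∀ y, |u y| ≤ δ')
    (cu : ContinuousOn u S) (hF : ∀ y ∈ S, h.FR P δ R u y = 0)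
    (hm : ∀ y ∈ S, ∀ s s', |s| < δ → |s'| < δ →
      |h.PsiR P δ R u (pp G y s) - h.PsiR P δ R u (pp G y s') - (s - s')| ≤ 1 / 2 * |s - s'|) :
    frontier (h.WW P δ u) = {x ∈ h.tube δ | h.PsiR P δ R u x = 0} ∧
    ∀ z ∈ h.tube δ, (z ∈ h.WW P δ u ↔ h.PsiR P δ R u z < 0) := by
  have key : ∀ z ∈ h.tube δ, |h.PsiR P δ R u z - (h.sc z - u (h.ft z))| ≤
      1 / 2 * |h.sc z - u (h.ft z)| := fun z hz => by
    have h1 := hF _ (h.ft_mem z)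
    have h2 := hm _ (h.ft_mem z) (h.sc z) (u (h.ft z)) hz (lt_of_le_of_lt (hu _) hδ')
    rw [FR] at h1
    rwa [h1, h.pp_ft, sub_zero] at h2
  constructor
  · rw [frontier_WW hp hδ' hu cu]
    ext z
    simp only [Set.mem_setOf_eq]
    refine and_congr_right fun hz => ⟨fun e => ?_, fun e => ?_⟩
    · have := key z hz
      rw [e] at this
      simpa using this
    · have := key z hz
      rw [e, zero_sub, abs_neg] at this
      have : |h.sc z - u (h.ft z)| = 0 := by linarith [abs_nonneg (h.sc z - u (h.ft z))]
      rw [abs_eq_zero] at this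
      linarith
  · intro z hz
    rw [mem_WW_tube hz]
    have := key z hz
    refine ⟨fun e => ?_, fun e => ?_⟩
    · rw [abs_of_neg (by linarith : h.sc z - u (h.ft z) < 0)] at this
      have := (abs_le.1 this).2
      linarith
    · by_contra hcon
      rw [abs_of_nonneg (by linarith : 0 ≤ h.sc z - u (h.ft z))] at this
      have := (abs_le.1 this).1
      linarith

end Geo
end Trap

namespace Trap

variable {m : ℕ} {Ψ : Pt → ℝ} {Ω c : ℝ} {P : Set Pt}

lemma adm_geo (H : AdmissiblePatch m Ψ Ω c P) :
    ∃ K c0 M : ℝ, Geo Ψ (gradient Ψ) (frontier P) K c0 M := by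
  have hc : IsCompact (frontier P) :=
    isCompact_of_isClosed_isBounded isClosed_frontier
      (H.bounded.closure.subset frontier_subset_closure)
  have hne : (frontier P).Nonempty := by
    rw [Set.nonempty_iff_ne_empty]
    intro h0
    have h1 := isClopen_iff_frontier_eq_empty.2 h0
    rcases isClopen_iff.1 h1 with h2 | h2
    · exact H.nonempty.ne_empty h2
    · have := H.bounded
      rw [h2] at this
      exact NoncompactSpace.noncompact_univ (X := Pt)
        (isCompact_of_isClosed_isBounded isClosed_univ this)
  obtain ⟨K, hK⟩ := H.gradLip
  obtain ⟨a, ha, ha'⟩ := hc.exists_isMinOn hne hK.continuous.norm.continuousOn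
  obtain ⟨b, hb, hb'⟩ := hc.exists_isMaxOn hne hK.continuous.norm.continuousOn
  have hd : ∀ x, HasGradientAt Ψ (gradient Ψ x) x := fun x =>
    (H.contDiff.differentiable one_ne_zero x).hasGradientAt
  refine ⟨K + 1, ‖gradient Ψ a‖, ‖gradient Ψ b‖, ⟨hc, hne, hd, fun x y => ?_, fun y hy => ?_,
    by positivity, norm_pos_iff.2 (H.gradNeZero a ha), fun y hy => ha' hy, fun y hy => hb' hy,
    ?_, fun x => ?_⟩⟩
  · have := hK.dist_le_mul x y
    rw [dist_eq_norm, dist_eq_norm] at this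
    nlinarith [norm_nonneg (x - y)]
  · obtain ⟨V, _, _, h3, _⟩ := H.level
    rw [h3] at hy
    exact hy.2
  · obtain ⟨V, h1, h2, h3, _⟩ := H.level
    refine ⟨V, h1, h2, fun x hx h0 => ?_⟩
    rw [h3]
    exact ⟨hx, h0⟩
  · have := (H.contDiff.contDiffAt (x := x)).hasStrictFDerivAt' (hd x).hasFDerivAt one_ne_zero
    exact this

lemma adm_pch (H : AdmissiblePatch m Ψ Ω c P) {K c0 M : ℝ}
    (h : Geo Ψ (gradient Ψ) (frontier P) K c0 M) :
    ∃ δ0 > 0, ∀ δ, 0 < δ → δ ≤ δ0 → h.Pch P δ := by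
  obtain ⟨δ1, hδ1⟩ := h.exists_adm2
  obtain ⟨V, h1, h2, h3, h4, h5⟩ := H.level
  obtain ⟨e, he, he'⟩ := h.compact.exists_thickening_subset_open h1 h2
  have hc := h.c0_pos
  have hM := h.M_pos
  have hK := h.K_pos
  have hδ1' := hδ1.1
  refine ⟨min δ1 (min (e * c0) (c0 ^ 2 / (10 * K))), by positivity, fun δ hδ hle => ?_⟩
  have l1 := hle.trans (min_le_left _ _)
  have l2 := (hle.trans (min_le_right _ _)).trans (min_le_left _ _)
  have l3 := (hle.trans (min_le_right _ _)).trans (min_le_right _ _)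
  have had := h.adm2_mono hδ1 hδ l1
  refine ⟨had, H.isOpen, H.bounded, rfl, fun z hz => ?_⟩
  have hzV : z ∈ V := by
    apply he'
    rw [mem_thickening_iff_infDist_lt h.nonempty]
    have := h.tube_infDist hz
    have q : M * infDist z (frontier P) < M * e := by
      refine this.trans_le ?_
      calc _ ≤ M / c0 * (e * c0) := by gcongr
        _ = _ := by field_simp
    exact lt_of_mul_lt_mul_left q hM.le
  have hs : |h.sc z| < δ := hz
  have sg := h.psi_sign (h.ft_mem z) hs.le (by
    rw [le_div_iff₀ (by positivity)] at l3
    rw [div_le_iff₀ (by positivity)]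
    linarith)
  rw [h.pp_ft] at sg
  rw [← sg]
  refine ⟨fun hP => h4 z ⟨hzV, hP⟩, fun hn => ?_⟩
  by_contra hP
  by_cases hcl : z ∈ closure P
  · have : z ∈ frontier P := by
      rw [H.isOpen.frontier_eq]; exact ⟨hcl, hP⟩
    linarith [h.zero z this]
  · linarith [h5 z ⟨hzV, hcl⟩]

/-- reflection as an isometry -/
def reflL : Pt →ₗ[ℝ] Pt where
  toFun := reflPt
  map_add' x y := by ext i; fin_cases i <;> simp [reflPt, pt] <;> ring
  map_smul' a x := by ext i; fin_cases i <;> simp [reflPt, pt]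

/-- rotation as a linear map -/
def rotL (θ : ℝ) : Pt →ₗ[ℝ] Pt where
  toFun := rotPt θ
  map_add' x y := by ext i; fin_cases i <;> simp [rotPt, pt] <;> ring
  map_smul' a x := by ext i; fin_cases i <;> simp [rotPt, pt] <;> ring

/-- reflection as a linear isometry -/
def reflE : Pt ≃ₗᵢ[ℝ] Pt :=
  LinearIsometry.toLinearIsometryEquiv ⟨reflL, fun x => by
    simp [reflL, reflPt, pt, EuclideanSpace.norm_eq]⟩ rfl

/-- rotation as a linear isometry -/
def rotE (θ : ℝ) : Pt ≃ₗᵢ[ℝ] Pt :=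
  LinearIsometry.toLinearIsometryEquiv ⟨rotL θ, fun x => by
    simp only [rotL, rotPt, pt, EuclideanSpace.norm_eq]
    congr 1
    simp [rotPt, pt]
    linear_combination (x 0 ^ 2 + x 1 ^ 2) * Real.sin_sq_add_cos_sq θ⟩ rfl

lemma reflE_apply (x : Pt) : reflE x = reflPt x := rfl
lemma rotE_apply (θ : ℝ) (x : Pt) : rotE θ x = rotPt θ x := rfl

lemma sym_of {J : Pt ≃ₗᵢ[ℝ] Pt} (h1 : ∀ x, Ψ (J x) = Ψ x) (h2 : ∀ x, J x ∈ P ↔ x ∈ P) :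
    Sym J Ψ (frontier P) P := by
  refine ⟨h1, fun x => ?_, h2⟩
  have e : J ⁻¹' P = P := by ext x; exact h2 x
  have := J.toHomeomorph.preimage_frontier P
  have e2 : (J.toHomeomorph : Pt → Pt) = J := rfl
  rw [e2, e] at this
  rw [← Set.mem_preimage, this]

lemma adm_sym (H : AdmissiblePatch m Ψ Ω c P) :
    ∀ j ∈ ({reflE, rotE (2 * π / m)} : Set (Pt ≃ₗᵢ[ℝ] Pt)), Sym j Ψ (frontier P) P := by
  rintro j (rfl | rfl)
  · exact sym_of (fun x => (H.symFun x).1.symm) (fun x => (H.symSet x).1.symm)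
  · exact sym_of (fun x => (H.symFun x).2.symm) (fun x => (H.symSet x).2.symm)

lemma adm_grad (H : AdmissiblePatch m Ψ Ω c P) (x : Pt) :
    gradient Ψ x = (1 / (2 * π)) • bs P x - Ω • x := by
  have e : Ψ = fun x => (1 / (2 * π)) * newt P x - Ω * ‖x‖ ^ 2 / 2 - c := by
    funext x; exact H.potential x
  have h1 := (newt_hasGradientAt H.bounded x).hasFDerivAt
  have h2 : HasFDerivAt (fun x : Pt => ‖x‖ ^ 2) (2 • (innerSL ℝ x)) x :=
    (hasStrictFDerivAt_norm_sq x).hasFDerivAt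
  have h3 := ((h1.const_mul (1 / (2 * π))).sub (((h2.const_mul Ω).mul_const (2⁻¹)))).sub_const c
  have h4 : HasGradientAt Ψ ((1 / (2 * π)) • bs P x - Ω • x) x := by
    rw [hasGradientAt_iff_hasFDerivAt, e]
    have e3 : (fun x : Pt => (1 / (2 * π)) * newt P x - Ω * ‖x‖ ^ 2 / 2 - c) =
        fun x => (1 / (2 * π)) * newt P x - Ω * ‖x‖ ^ 2 * 2⁻¹ - c := by
      funext x; ring
    rw [e3]
    refine h3.congr_fderiv ?_
    refine ContinuousLinearMap.ext fun v => ?_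
    simp only [_root_.sub_apply, _root_.smul_apply, map_sub, map_smul,
      InnerProductSpace.toDual_apply_apply, innerSL_apply_apply, smul_eq_mul, nsmul_eq_mul]
    push_cast
    ring
  exact h4.gradient

end Trap

namespace Trap

lemma cross_int {a f : Pt → ℝ} {C : NNReal} (ha : LipschitzWith C a) (sa : HasCompactSupport a)
    (hf : ContDiff ℝ 1 f) (sf : HasCompactSupport f) (v w : Pt) :
    ∫ x, lineDeriv ℝ a x v * fderiv ℝ f x w = ∫ x, lineDeriv ℝ a x w * fderiv ℝ f x v := by
  obtain ⟨Cf, lf⟩ := ContDiff.lipschitzWith_of_hasCompactSupport sf hf one_ne_zero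
  have df := hf.differentiable one_ne_zero
  have cD : ∀ v, Continuous fun x => fderiv ℝ f x v := fun v =>
    (hf.continuous_fderiv one_ne_zero).clm_apply continuous_const
  have sD : ∀ v, HasCompactSupport fun x => fderiv ℝ f x v := fun v => sf.fderiv_apply ℝ v
  have i1 : Integrable fun x => lineDeriv ℝ a x v := by
    have hz : ∀ x, x ∉ tsupport a → lineDeriv ℝ a x v = 0 := fun x hx => by
      have : a =ᶠ[𝓝 x] fun _ => 0 := by
        have := notMem_tsupport_iff_eventuallyEq.1 hx
        exact this
      rw [this.lineDeriv_eq]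
      simp [lineDeriv]
    have := (ha.memLp_lineDeriv (μ := volume) v).locallyIntegrable le_top
    have h2 : IntegrableOn (fun x => lineDeriv ℝ a x v) (tsupport a) :=
      this.integrableOn_isCompact sa
    exact (integrableOn_iff_integrable_of_support_subset fun x hx => by
      by_contra hc
      exact hx (hz x hc)).1 h2
  have A := lf.integral_inv_smul_sub_mul_tendsto_integral_lineDeriv_mul i1 w
  have B := ha.integral_inv_smul_sub_mul_tendsto_integral_lineDeriv_mul (μ := volume)
    ((cD (-v)).integrable_of_hasCompactSupport (sD (-v))) (-w)
  have key : ∀ t : ℝ, ∫ x, (t⁻¹ • (f (x + t • w) - f x)) * lineDeriv ℝ a x v =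
      ∫ x, (t⁻¹ • (a (x + t • (-w)) - a x)) * fderiv ℝ f x (-v) := by
    intro t
    have hF : ContDiff ℝ 1 fun x => t⁻¹ • (f (x + t • w) - f x) := by fun_prop
    have lF : LipschitzWith (‖t⁻¹‖₊ * (Cf + Cf)) fun x => t⁻¹ • (f (x + t • w) - f x) := by
      have h1 : LipschitzWith Cf fun x : Pt => f (x + t • w) := by
        have := lf.comp (isometry_add_right (t • w)).lipschitz
        simpa [Function.comp_def] using this
      have h2 := (h1.sub lf)
      refine LipschitzWith.of_dist_le_mul fun x y => ?_
      have h3 := h2.dist_le_mul x y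
      rw [dist_smul₀, NNReal.coe_mul, mul_assoc, coe_nnnorm]
      gcongr
    have e1 := lF.integral_lineDeriv_mul_eq (μ := volume) ha sa (-v)
    rw [neg_neg] at e1
    have e2 : ∀ x, lineDeriv ℝ (fun x => t⁻¹ • (f (x + t • w) - f x)) x (-v) =
        t⁻¹ * (fderiv ℝ f (x + t • w) (-v) - fderiv ℝ f x (-v)) := fun x => by
      have d1 : HasFDerivAt (fun x => t⁻¹ • (f (x + t • w) - f x))
          (t⁻¹ • (fderiv ℝ f (x + t • w) - fderiv ℝ f x)) x := by
        have q1 : HasFDerivAt (fun x => f (x + t • w)) (fderiv ℝ f (x + t • w)) x := by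
          rw [hasFDerivAt_comp_add_right]
          exact (df _).hasFDerivAt
        exact (q1.sub (df x).hasFDerivAt).const_smul t⁻¹
      rw [(d1.hasLineDerivAt (-v)).lineDeriv]
      simp
    simp only [e2] at e1
    have c1 : Continuous fun x => fderiv ℝ f (x + t • w) (-v) := (cD (-v)).comp (by fun_prop)
    have j1 : Integrable fun x => fderiv ℝ f (x + t • w) (-v) * a x :=
      (c1.mul ha.continuous).integrable_of_hasCompactSupport sa.mul_left
    have j2 : Integrable fun x => fderiv ℝ f x (-v) * a x :=
      ((cD (-v)).mul ha.continuous).integrable_of_hasCompactSupport sa.mul_left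
    have c3 : Continuous fun x : Pt => a (x + t • (-w)) := ha.continuous.comp (by fun_prop)
    have j3 : Integrable fun x => fderiv ℝ f x (-v) * a (x + t • (-w)) :=
      ((cD (-v)).mul c3).integrable_of_hasCompactSupport (sD (-v)).mul_right
    calc ∫ x, (t⁻¹ • (f (x + t • w) - f x)) * lineDeriv ℝ a x v
        = ∫ x, lineDeriv ℝ a x v * (t⁻¹ • (f (x + t • w) - f x)) := by
          simp only [mul_comm]
      _ = ∫ x, t⁻¹ * (fderiv ℝ f (x + t • w) (-v) * a x - fderiv ℝ f x (-v) * a x) := by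
          rw [← e1]
          refine integral_congr_ae (Eventually.of_forall fun x => ?_)
          show _ * (_ - _) * _ = _
          ring
      _ = t⁻¹ * ((∫ x, fderiv ℝ f (x + t • w) (-v) * a x) - ∫ x, fderiv ℝ f x (-v) * a x) := by
          rw [integral_const_mul, integral_sub j1 j2]
      _ = t⁻¹ * ((∫ x, fderiv ℝ f x (-v) * a (x + t • (-w))) - ∫ x, fderiv ℝ f x (-v) * a x) := by
          congr 2
          rw [← integral_add_right_eq_self (fun x => fderiv ℝ f x (-v) * a (x + t • (-w))) (t • w)]
          refine integral_congr_ae (Eventually.of_forall fun x => ?_)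
          show _ = fderiv ℝ f (x + t • w) (-v) * a (x + t • w + t • (-w))
          rw [smul_neg, add_neg_cancel_right]
      _ = _ := by
          rw [← integral_sub j3 j2, ← integral_const_mul]
          refine integral_congr_ae (Eventually.of_forall fun x => ?_)
          simp only [smul_eq_mul]
          ring
  have e := tendsto_nhds_unique A (by simp only [key]; exact B)
  have l : ∀ x, lineDeriv ℝ f x w = fderiv ℝ f x w := fun x =>
    ((df x).hasFDerivAt.hasLineDerivAt w).lineDeriv
  simp only [l, lineDeriv_neg, map_neg, neg_mul_neg] at e
  rw [← e]
  simp only [mul_comm]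

lemma lip_cut {W : Set Pt} {q : Pt → ℝ} {L D : ℝ} (hL : 0 ≤ L) (hW : IsOpen W) (hD : W ⊆ closedBall 0 D)
    (hq : ∀ x ∈ closedBall (0 : Pt) D, ∀ y ∈ closedBall (0 : Pt) D, |q x - q y| ≤ L * ‖x - y‖)
    (h0 : ∀ x ∈ frontier W, q x = 0) :
    LipschitzWith ⟨L, hL⟩ (W.indicator q) := by
  have key : ∀ x ∈ W, ∀ y, y ∉ W → |q x| ≤ L * ‖x - y‖ := by
    intro x hx y hy
    have hcon : ¬ (segment ℝ x y ∩ frontier W = ∅) := by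
      intro hc
      have hp : IsPreconnected (segment ℝ x y) := (convex_segment x y).isPreconnected
      have cov : ∀ z ∈ segment ℝ x y, z ∈ W ∨ z ∈ (closure W)ᶜ := fun z hz => by
        by_contra hcon
        rw [not_or, Set.mem_compl_iff, not_not] at hcon
        have : z ∈ segment ℝ x y ∩ frontier W :=
          ⟨hz, by rw [hW.frontier_eq]; exact ⟨hcon.2, hcon.1⟩⟩
        rw [hc] at this
        exact this
      obtain ⟨z, _, h1, h2⟩ := hp W (closure W)ᶜ hW isClosed_closure.isOpen_compl cov
        ⟨x, left_mem_segment ℝ x y, hx⟩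
        ⟨y, right_mem_segment ℝ x y, (cov y (right_mem_segment ℝ x y)).resolve_left hy⟩
      exact h2 (subset_closure h1)
    obtain ⟨z, hz, hz'⟩ := Set.nonempty_iff_ne_empty.2 hcon
    have hzD : z ∈ closedBall (0 : Pt) D :=
      closure_minimal hD isClosed_closedBall (frontier_subset_closure hz')
    have h1 := hq x (hD hx) z hzD
    rw [h0 z hz', sub_zero] at h1
    refine h1.trans (mul_le_mul_of_nonneg_left ?_ hL)
    have := dist_add_dist_of_mem_segment hz
    rw [← dist_eq_norm, ← dist_eq_norm]
    linarith [dist_nonneg (x := z) (y := y)]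
  refine LipschitzWith.of_dist_le_mul fun x y => ?_
  rw [dist_eq_norm, dist_eq_norm, Real.norm_eq_abs]
  show _ ≤ L * _
  by_cases hx : x ∈ W <;> by_cases hy : y ∈ W
  · rw [Set.indicator_of_mem hx, Set.indicator_of_mem hy]
    exact hq x (hD hx) y (hD hy)
  · rw [Set.indicator_of_mem hx, Set.indicator_of_notMem hy, sub_zero]
    exact key x hx y hy
  · rw [Set.indicator_of_mem hy, Set.indicator_of_notMem hx, zero_sub, abs_neg, norm_sub_rev]
    exact key y hy x hx
  · rw [Set.indicator_of_notMem hx, Set.indicator_of_notMem hy, sub_zero, abs_zero]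
    positivity

lemma perp_inner (v w : Pt) : ⟪perp v, w⟫ = v 0 * w 1 - v 1 * w 0 := by
  simp [perp, pt, PiLp.inner_apply, Fin.sum_univ_two]
  ring

lemma weak_form {W : Set Pt} {q : Pt → ℝ} {g : Pt → Pt} {D R : ℝ} (h0D : 0 < D) (hDR : D < R)
    (hW : IsOpen W) (hD : W ⊆ ball 0 D)
    (hq : ∀ x ∈ closedBall (0 : Pt) D, HasGradientAt q (g x) x)
    (cg : ContinuousOn g (closedBall (0 : Pt) D))
    (h0 : ∀ x ∈ frontier W, q x = 0)
    (hs : ∀ x ∈ frontier W, ∀ᶠ z in 𝓝 x, z ∈ W → q z ≤ 0)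
    (f : Pt → ℝ) (hf : ∃ V : Set Pt, IsOpen V ∧ closedBall (0 : Pt) R ⊆ V ∧ ContDiffOn ℝ 1 f V) :
    ∫ x in ball (0 : Pt) R, Set.indicator W 1 x * ⟪perp (g x), gradient f x⟫ = 0 := by
  obtain ⟨V, oV, bV, hf⟩ := hf
  obtain ⟨L, hL⟩ := (isCompact_closedBall (0 : Pt) D).exists_bound_of_continuousOn cg
  have hL0 : 0 ≤ L := (norm_nonneg _).trans (hL 0 (by simpa using h0D.le))
  have hD' : W ⊆ closedBall 0 D := hD.trans ball_subset_closedBall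
  have la := lip_cut (q := q) hL0 hW hD' (fun x hx y hy => by
    have := (convex_closedBall (0 : Pt) D).norm_image_sub_le_of_norm_hasFDerivWithin_le
      (f := q) (f' := fun x => InnerProductSpace.toDual ℝ Pt (g x)) (C := L)
      (fun x hx => (hq x hx).hasFDerivAt.hasFDerivWithinAt)
      (fun x hx => by rw [LinearIsometryEquiv.norm_map]; exact hL x hx) hy hx
    exact this) h0
  have sa : HasCompactSupport (W.indicator q) :=
    HasCompactSupport.intro (isCompact_closedBall (0 : Pt) D) fun x hx =>
      Set.indicator_of_notMem (fun h => hx (hD' h)) _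
  let b : ContDiffBump (0 : Pt) := ⟨D, R, h0D, hDR⟩
  have sb : tsupport b = closedBall (0 : Pt) R := b.tsupport_eq
  have hft : ContDiff ℝ 1 fun x => b x * f x := by
    rw [contDiff_iff_contDiffAt]
    intro x
    by_cases hx : x ∈ V
    · exact b.contDiff.contDiffAt.mul (hf.contDiffAt (oV.mem_nhds hx))
    · have : x ∉ tsupport b := fun h => hx (bV (by rwa [sb] at h))
      have e := notMem_tsupport_iff_eventuallyEq.1 this
      have : (fun x => b x * f x) =ᶠ[𝓝 x] fun _ => 0 := by
        filter_upwards [e] with z hz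
        rw [hz]; simp
      exact contDiffAt_const.congr_of_eventuallyEq this
  have sf : HasCompactSupport fun x => b x * f x := b.hasCompactSupport.mul_right
  have c := cross_int la sa hft sf (EuclideanSpace.single 0 1) (EuclideanSpace.single 1 1)
  -- line derivatives
  have d1 : ∀ x ∈ W, ∀ v, lineDeriv ℝ (W.indicator q) x v = ⟪g x, v⟫ := fun x hx v => by
    have e : W.indicator q =ᶠ[𝓝 x] q := by
      filter_upwards [hW.mem_nhds hx] with z hz using Set.indicator_of_mem hz _
    rw [e.lineDeriv_eq, ((hq x (hD' hx)).hasFDerivAt.hasLineDerivAt v).lineDeriv]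
    simp
  have d2 : ∀ x, x ∉ W → ∀ v, lineDeriv ℝ (W.indicator q) x v = 0 := fun x hx v => by
    have lm : IsLocalMax (W.indicator q) x := by
      have h1 : ∀ᶠ z in 𝓝 x, z ∈ W → q z ≤ 0 := by
        by_cases hc : x ∈ closure W
        · exact hs x (by rw [hW.frontier_eq]; exact ⟨hc, hx⟩)
        · filter_upwards [isClosed_closure.isOpen_compl.mem_nhds hc] with z hz hzW
          exact absurd (subset_closure hzW) hz
      filter_upwards [h1] with z hz
      rw [Set.indicator_of_notMem hx]
      by_cases hzW : z ∈ W
      · rw [Set.indicator_of_mem hzW]; exact hz hzW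
      · rw [Set.indicator_of_notMem hzW]
    have ct : Tendsto (fun t : ℝ => x + t • v) (𝓝 0) (𝓝 x) := by
      have : Continuous fun t : ℝ => x + t • v := by fun_prop
      simpa using this.tendsto 0
    have : IsLocalMax (fun t : ℝ => W.indicator q (x + t • v)) 0 := by
      have := ct.eventually lm
      filter_upwards [this] with t ht
      simpa using ht
    exact this.deriv_eq_zero
  have d3 : ∀ x ∈ W, ∀ v, fderiv ℝ (fun x => b x * f x) x v = ⟪gradient f x, v⟫ := fun x hx v => by
    have e : (fun x => b x * f x) =ᶠ[𝓝 x] f := by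
      filter_upwards [isOpen_ball.mem_nhds (hD hx)] with z hz
      rw [b.one_of_mem_closedBall (ball_subset_closedBall hz), one_mul]
    rw [e.fderiv_eq]
    simp [gradient]
  have i0 : ∀ v w : Pt, Integrable fun x => lineDeriv ℝ (W.indicator q) x v *
      fderiv ℝ (fun x => b x * f x) x w := fun v w => by
    have c1 : Continuous fun x => fderiv ℝ (fun x => b x * f x) x w :=
      (hft.continuous_fderiv one_ne_zero).clm_apply continuous_const
    have := c1.integrable_of_hasCompactSupport (μ := volume) (sf.fderiv_apply ℝ w)
    exact this.bdd_mul (aestronglyMeasurable_lineDeriv la.continuous _)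
      (Eventually.of_forall fun x => norm_lineDeriv_le_of_lipschitz ℝ la)
  have hsub : W ⊆ ball (0 : Pt) R := hD.trans (ball_subset_ball hDR.le)
  calc _ = ∫ x, (lineDeriv ℝ (W.indicator q) x (EuclideanSpace.single 0 1) *
        fderiv ℝ (fun x => b x * f x) x (EuclideanSpace.single 1 1) -
        lineDeriv ℝ (W.indicator q) x (EuclideanSpace.single 1 1) *
        fderiv ℝ (fun x => b x * f x) x (EuclideanSpace.single 0 1)) := by
        rw [← integral_indicator measurableSet_ball]
        refine integral_congr_ae (Eventually.of_forall fun x => ?_)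
        by_cases hx : x ∈ W
        · show Set.indicator _ _ _ = _
          rw [Set.indicator_of_mem (hsub hx)]
          simp only [d1 x hx, d3 x hx, Set.indicator_of_mem hx, perp_inner]
          have es : ∀ (z : Pt) (i : Fin 2), ⟪z, EuclideanSpace.single i (1 : ℝ)⟫ = z i := fun z i => by
            simp [EuclideanSpace.inner_single_right]
          simp only [es, Pi.one_apply, one_mul]
        · simp only [d2 x hx]
          by_cases hb : x ∈ ball (0 : Pt) R
          · rw [Set.indicator_of_mem hb, Set.indicator_of_notMem hx]; simp
          · rw [Set.indicator_of_notMem hb]; simp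
    _ = 0 := by
        rw [integral_sub (i0 _ _) (i0 _ _), c, sub_self]

end Trap

namespace Trap

/-- The gradient of the stream function in the disk. -/
def gg (Ω R : ℝ) (W : Set Pt) (x : Pt) : Pt := (1 / (2 * π)) • bs W x + gpot R W x - Ω • x

variable {Ω R D : ℝ} {W : Set Pt}

lemma perp_perp (a b : Pt) (s t : ℝ) : perp (s • perp a + t • perp b) = -(s • a + t • b) := by
  ext i
  fin_cases i <;> simp [perp, pt] <;> ring

lemma gg_int (hm : MeasurableSet W) (hW : W ⊆ closedBall 0 D) (hR : 0 < R) (hD : 4 * D ≤ R)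
    {x : Pt} (hx : ‖x‖ ≤ R) :
    gg Ω R W x = (∫ y in W, ((1 / (2 * π)) • ker (x - y) + gk R x y)) - Ω • x := by
  have hb : Bornology.IsBounded W := isBounded_closedBall.subset hW
  have i1 : IntegrableOn (fun y => (1 / (2 * π)) • ker (x - y)) W :=
    (integrableOn_ker (bounded_vol hb) x).smul (1 / (2 * π))
  rw [integral_add i1 (integrableOn_gk hm hW hR hD (by linarith)), integral_smul]
  rfl

lemma gg_bs (hm : MeasurableSet W) (hW : W ⊆ closedBall 0 D) (hW' : W ⊆ ball 0 R) (hR : 0 < R)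
    (hD : 4 * D ≤ R) {x : Pt} (hx : ‖x‖ ≤ R) :
    gg Ω R W x = -Ω • x - ∫ y in ball (0 : Pt) R, Set.indicator W (1 : Pt → ℝ) y •
              perp ((1 / (2 * π) / ‖x - y‖ ^ 2) • perp (x - y) +
                (1 / (2 * π) / (R ^ 4 - 2 * R ^ 2 * ⟪x, y⟫ + ‖x‖ ^ 2 * ‖y‖ ^ 2)) •
                  perp ((R ^ 2 : ℝ) • y - (‖y‖ ^ 2 : ℝ) • x)) := by
  have e : ∀ y, Set.indicator W (1 : Pt → ℝ) y •
              perp ((1 / (2 * π) / ‖x - y‖ ^ 2) • perp (x - y) +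
                (1 / (2 * π) / (R ^ 4 - 2 * R ^ 2 * ⟪x, y⟫ + ‖x‖ ^ 2 * ‖y‖ ^ 2)) •
                  perp ((R ^ 2 : ℝ) • y - (‖y‖ ^ 2 : ℝ) • x)) =
      W.indicator (fun y => -((1 / (2 * π)) • ker (x - y) + gk R x y)) y := fun y => by
    by_cases hy : y ∈ W
    · rw [Set.indicator_of_mem hy, Set.indicator_of_mem hy, perp_perp, Pi.one_apply, one_smul,
        ker, gk, den, smul_smul, div_eq_mul_inv (1 / (2 * π)) (‖x - y‖ ^ 2)]
    · rw [Set.indicator_of_notMem hy, Set.indicator_of_notMem hy, zero_smul]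
  simp only [e]
  rw [setIntegral_indicator hm, Set.inter_eq_right.2 hW', integral_neg,
    gg_int hm hW hR hD hx, neg_smul]
  abel

lemma gg_tan (hm : MeasurableSet W) (hW : W ⊆ closedBall 0 D) (hR : 0 < R)
    (hD : 4 * D ≤ R) {x : Pt} (hx : ‖x‖ = R) : ⟪perp (gg Ω R W x), x⟫ = 0 := by
  have hb : Bornology.IsBounded W := isBounded_closedBall.subset hW
  have e1 : ∀ v : Pt, ⟪perp v, x⟫ = -⟪perp x, v⟫ := fun v => by
    rw [perp_inner, perp_inner]; ring
  have e2 : ⟪perp x, x⟫ = (0 : ℝ) := by rw [perp_inner]; ring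
  rw [e1, gg_int hm hW hR hD hx.le, inner_sub_right, inner_smul_right, e2, ← integral_inner]
  · have : ∀ y, ⟪perp x, (1 / (2 * π)) • ker (x - y) + gk R x y⟫ = (0 : ℝ) := fun y => by
      have hd : den R x y = R ^ 2 * ‖x - y‖ ^ 2 := by
        rw [den, norm_sub_sq_real, hx]; ring
      rw [inner_add_right, inner_smul_right, ker, gk, inner_smul_right, inner_smul_right,
        inner_sub_right, inner_sub_right, inner_smul_right, inner_smul_right, e2, hd]
      have : R ≠ 0 := hR.ne'
      by_cases h0 : ‖x - y‖ = 0
      · rw [h0]; simp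
      · field_simp
        ring
    simp only [this, integral_zero, mul_zero, sub_zero, neg_zero]
  · exact ((integrableOn_ker (bounded_vol hb) x).smul (1 / (2 * π))).add
      (integrableOn_gk hm hW hR hD (by linarith))

lemma gg_holder (hm : MeasurableSet W) (hW : W ⊆ closedBall 0 D) (hR : 0 < R)
    (hD : 4 * D ≤ R) {α : ℝ} (hα : α ∈ Set.Ioo (0 : ℝ) 1) : ∃ Cα : ℝ,
            ∀ x ∈ closedBall (0 : Pt) R, ∀ y ∈ closedBall (0 : Pt) R,
              ‖gg Ω R W x - gg Ω R W y‖ ≤ Cα * ‖x - y‖ ^ α := by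
  have hb : Bornology.IsBounded W := isBounded_closedBall.subset hW
  obtain ⟨C, hC⟩ := bs_holder (bounded_vol hb) hα.1 hα.2
  have hpi : 0 < 1 / (2 * π) := by positivity
  refine ⟨1 / (2 * π) * C + (1 / R ^ 2 * volume.real W + |Ω|) * (2 * R) ^ (1 - α),
    fun x hx y hy => ?_⟩
  rw [mem_closedBall_zero_iff] at hx hy
  have e : gg Ω R W x - gg Ω R W y = (1 / (2 * π)) • (bs W x - bs W y) +
      (gpot R W x - gpot R W y) - Ω • (x - y) := by
    rw [gg, gg, smul_sub, smul_sub]; abel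
  have h1 := hC x y
  have h2 := gpot_lip hm hW hR hD (x := x) (x' := y) (by linarith) (by linarith)
  have h3 : ‖x - y‖ ≤ (2 * R) ^ (1 - α) * ‖x - y‖ ^ α := by
    rcases (norm_nonneg (x - y)).eq_or_lt with h0 | h0
    · rw [← h0]; positivity
    · calc ‖x - y‖ = ‖x - y‖ ^ (1 - α) * ‖x - y‖ ^ α := by
            rw [← Real.rpow_add h0]; simp
        _ ≤ _ := by
            gcongr
            · linarith [hα.2]
            · exact (norm_sub_le x y).trans (by linarith)
  rw [e]
  calc _ ≤ ‖(1 / (2 * π)) • (bs W x - bs W y)‖ + ‖gpot R W x - gpot R W y‖ + ‖Ω • (x - y)‖ :=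
        (norm_sub_le _ _).trans (by gcongr; exact norm_add_le _ _)
    _ ≤ 1 / (2 * π) * (C * ‖x - y‖ ^ α) + 1 / R ^ 2 * ‖x - y‖ * volume.real W + |Ω| * ‖x - y‖ := by
        rw [norm_smul, norm_smul, Real.norm_eq_abs, abs_of_pos hpi, Real.norm_eq_abs]
        gcongr
    _ = 1 / (2 * π) * C * ‖x - y‖ ^ α + (1 / R ^ 2 * volume.real W + |Ω|) * ‖x - y‖ := by ring
    _ ≤ 1 / (2 * π) * C * ‖x - y‖ ^ α + (1 / R ^ 2 * volume.real W + |Ω|) *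
        ((2 * R) ^ (1 - α) * ‖x - y‖ ^ α) := by
        gcongr
    _ = _ := by ring

lemma gg_cont (hm : MeasurableSet W) (hW : W ⊆ closedBall 0 D) (hR : 0 < R)
    (hD : 4 * D ≤ R) : ContinuousOn (gg Ω R W) (closedBall (0 : Pt) R) := by
  obtain ⟨C, hC⟩ := gg_holder (Ω := Ω) hm hW hR hD (α := 1 / 2) (by constructor <;> norm_num)
  intro x hx
  rw [ContinuousWithinAt, tendsto_iff_norm_sub_tendsto_zero]
  have l : Tendsto (fun y : Pt => C * ‖y - x‖ ^ (1 / 2 : ℝ)) (𝓝[closedBall 0 R] x) (𝓝 0) := by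
    have : Continuous fun y : Pt => C * ‖y - x‖ ^ (1 / 2 : ℝ) :=
      continuous_const.mul ((continuous_id.sub continuous_const).norm.rpow_const
        fun _ => Or.inr (by norm_num))
    have := (this.tendsto x).mono_left (nhdsWithin_le_nhds (s := closedBall 0 R))
    simpa using this
  refine squeeze_zero' (Eventually.of_forall fun _ => norm_nonneg _) ?_ l
  filter_upwards [self_mem_nhdsWithin] with y hy using hC y hy x hx

end Trap

open Trap

/-- **Trapping of admissible states** (Theorem III). -/
theorem trapping_of_admissible_states
    (m : ℕ) (Ψ : Pt → ℝ) (Ω c : ℝ) (Upatch : Set Pt)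
    (hadm : AdmissiblePatch m Ψ Ω c Upatch) :
    ∃ (Rstar C C₁ : ℝ) (U : Set Pt),
      1 ≤ Rstar ∧ 0 < C ∧ 0 < C₁ ∧ C₁ ≤ Rstar ∧
      IsOpen U ∧ Bornology.IsBounded U ∧ frontier Upatch ⊆ U ∧
      (∀ R : ℝ, Rstar ≤ R →
        ∃ (W : Set Pt) (ΨR : Pt → ℝ) (g : Pt → Pt),
          -- `W_R` is a bounded open subset of `B(0, C₁)`
          IsOpen W ∧ Bornology.IsBounded W ∧ W ⊆ ball (0 : Pt) C₁ ∧
          -- `Ψ_R` is continuously differentiable on the closed disk, with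
          -- gradient `g` ...
          (∀ x ∈ closedBall (0 : Pt) R,
            HasGradientWithinAt ΨR (g x) (closedBall (0 : Pt) R) x) ∧
          ContinuousOn g (closedBall (0 : Pt) R) ∧
          -- ... which is uniformly `α`-Hölder for every `α ∈ (0,1)`
          (∀ α ∈ Set.Ioo (0 : ℝ) 1, ∃ Cα : ℝ,
            ∀ x ∈ closedBall (0 : Pt) R, ∀ y ∈ closedBall (0 : Pt) R,
              ‖g x - g y‖ ≤ Cα * ‖x - y‖ ^ α) ∧
          -- (1) `(Ω, Ψ_R, ω_R)` with `ω_R = 1_{W_R}` is a steady rotating weak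
          -- solution in the disk `B(0,R)`: the Biot–Savart law in the disk ...
          (∀ᵐ x : Pt, x ∈ ball (0 : Pt) R →
            g x = -Ω • x - ∫ y in ball (0 : Pt) R, Set.indicator W (1 : Pt → ℝ) y •
              perp ((1 / (2 * π) / ‖x - y‖ ^ 2) • perp (x - y) +
                (1 / (2 * π) / (R ^ 4 - 2 * R ^ 2 * ⟪x, y⟫ + ‖x‖ ^ 2 * ‖y‖ ^ 2)) •
                  perp ((R ^ 2 : ℝ) • y - (‖y‖ ^ 2 : ℝ) • x))) ∧
          -- ... the weak form of the transport equation ...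
          (∀ f : Pt → ℝ,
            (∃ V : Set Pt, IsOpen V ∧ closedBall (0 : Pt) R ⊆ V ∧ ContDiffOn ℝ 1 f V) →
            ∫ x in ball (0 : Pt) R,
              Set.indicator W 1 x * ⟪perp (g x), gradient f x⟫ = 0) ∧
          -- ... and the no-penetration boundary condition
          (∀ x : Pt, ‖x‖ = R → ⟪perp (g x), x⟫ = 0) ∧
          -- (2) `∂W_R` is the zero set of `Ψ_R` in `U`
          frontier W = {x ∈ U | ΨR x = 0} ∧
          -- (3) the deviation estimates
          (∀ x ∈ ball (0 : Pt) R,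
            (∫ y in ball (0 : Pt) R, |Set.indicator W 1 y - Set.indicator Upatch 1 y|) +
              ‖g x - gradient Ψ x‖ ≤ C * Real.log R / R ^ 2) ∧
          -- (4) `m`-fold dihedral symmetry
          DihedralSymFun m ΨR ∧ DihedralSymFun m (Set.indicator W 1)) := by
  obtain ⟨K, c0, M, h⟩ := adm_geo hadm
  set P := Upatch with hPdef
  obtain ⟨δ1, hδ1, pch⟩ := adm_pch hadm h
  have hsy := adm_sym hadm
  obtain ⟨δ2, hδ2, B, hB, fix⟩ := Geo.exists_fix h _ hsy (fun φ c1 c2 c3 => hadm.nondeg φ c1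
    (fun x hx => ⟨(c2 x hx reflE (by simp)).symm, (c2 x hx (rotE (2 * π / m)) (by simp)).symm⟩) c3)
  obtain ⟨δ3, hδ3, mono⟩ := Geo.Mono h (ε := 1 / 2) (by norm_num)
  obtain ⟨δ4, hδ4, Cb, hCb, bse⟩ := Geo.bs_est h
  obtain ⟨δ5, hδ5, Cx, hCx, chi⟩ := Geo.chi_int h
  obtain ⟨δ, hδ0, hd1, hd2, hd3, hd5⟩ : ∃ δ > 0, δ ≤ δ1 ∧ δ ≤ δ2 ∧ δ ≤ δ3 ∧ δ ≤ δ5 :=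
    ⟨min (min δ1 δ2) (min δ3 δ5), by positivity,
      (min_le_left _ _).trans (min_le_left _ _), (min_le_left _ _).trans (min_le_right _ _),
      (min_le_right _ _).trans (min_le_left _ _), (min_le_right _ _).trans (min_le_right _ _)⟩
  have hp := pch δ hδ0 hd1
  have hadm1 := Geo.Adm2.adm h hp.adm2
  obtain ⟨D, hD0, hPD, hTD⟩ : ∃ D : ℝ, 1 ≤ D ∧ P ⊆ closedBall 0 D ∧
      h.tube δ ⊆ closedBall 0 D := by
    obtain ⟨a, ha⟩ := hadm.bounded.subset_closedBall 0
    obtain ⟨b, hb⟩ := (h.tube_bdd hadm1).subset_closedBall 0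
    exact ⟨max 1 (max a b), le_max_left _ _,
      ha.trans (closedBall_subset_closedBall ((le_max_left _ _).trans (le_max_right _ _))),
      hb.trans (closedBall_subset_closedBall ((le_max_right _ _).trans (le_max_right _ _)))⟩
  obtain ⟨R1, fix⟩ := fix δ hd2 hp D hPD hTD
  obtain ⟨R2, mono⟩ := mono P δ hd3 hp D hPD hTD
  set A := B * (D * D * volume.real P) + 1 with hA
  have hA1 : 1 ≤ A := by rw [hA]; linarith [show 0 ≤ B * (D * D * volume.real P) by positivity]
  set e := min δ4 (min 1 δ) with he
  have he0 : 0 < e := by positivity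
  have cb0 : 0 ≤ volume.real (closedBall (0 : Pt) D) := measureReal_nonneg
  refine ⟨max (max R1 R2) (max (max (4 * D + 2) (Real.exp 1)) (2 * A / e)),
    Cx * A + 6 * Cb * A + D * volume.real (closedBall (0 : Pt) D), D + 1, h.tube δ, ?_, ?_, ?_, ?_,
    h.isOpen_tube hp.adm2, h.tube_bdd hadm1, ?_, ?_⟩
  · exact le_trans (by linarith) (((le_max_left (4 * D + 2) _).trans (le_max_left _ _)).trans
      (le_max_right _ _))
  · positivity
  · linarith
  · exact le_trans (by linarith) (((le_max_left (4 * D + 2) _).trans (le_max_left _ _)).trans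
      (le_max_right _ _))
  · intro y hy
    have := h.mem_tube_pp hadm1 hy (s := 0) (by simpa using hδ0)
    simpa [pp] using this
  intro R hRs
  have r1 : R1 ≤ R := ((le_max_left _ _).trans (le_max_left _ _)).trans hRs
  have r2 : R2 ≤ R := ((le_max_right _ _).trans (le_max_left _ _)).trans hRs
  have r3 : 4 * D + 2 ≤ R :=
    (((le_max_left _ _).trans (le_max_left _ _)).trans (le_max_right _ _)).trans hRs
  have r4 : Real.exp 1 ≤ R :=
    (((le_max_right _ _).trans (le_max_left _ _)).trans (le_max_right _ _)).trans hRs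
  have r5 : 2 * A / e ≤ R := ((le_max_right _ _).trans (le_max_right _ _)).trans hRs
  have hR : 0 < R := by linarith
  have hR1 : 1 ≤ R := by linarith
  have hlog : 1 ≤ Real.log R := by
    rw [Real.le_log_iff_exp_le hR]; exact r4
  obtain ⟨u, mu, cu, bu, su, fu⟩ := fix R r1
  set η := A / R ^ 2 with hη
  have hη0 : 0 < η := by positivity
  have hηe : 2 * η ≤ e := by
    rw [div_le_iff₀ he0] at r5
    rw [hη, ← mul_div_assoc, div_le_iff₀ (by positivity)]
    nlinarith
  have e4 : 2 * η ≤ δ4 := hηe.trans (min_le_left _ _)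
  have e1 : 2 * η ≤ 1 := hηe.trans ((min_le_right _ _).trans (min_le_left _ _))
  have eδ : 2 * η ≤ δ := hηe.trans ((min_le_right _ _).trans (min_le_right _ _))
  have hu : ∀ y, |u y| ≤ η := fun y => (bu y).trans (by
    rw [hη]; gcongr; rw [hA]; linarith)
  have hηδ : η < δ := by linarith
  set W := h.WW P δ u with hW
  have oW : IsOpen W := Geo.isOpen_WW hp hηδ hu cu
  have mW := oW.measurableSet
  have WD : W ⊆ closedBall 0 D := Geo.WW_sub hPD hTD
  have bW : Bornology.IsBounded W := isBounded_closedBall.subset WD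
  have W1 : W ⊆ ball 0 (D + 1) := WD.trans (closedBall_subset_ball (by linarith))
  have WR : W ⊆ ball 0 R := WD.trans (closedBall_subset_ball (by linarith))
  have h4D : 4 * D ≤ R := by linarith
  have hgr : ∀ x : Pt, gradient Ψ x + (1 / (2 * π)) • (bs W x - bs P x) + gpot R W x =
      gg Ω R W x := fun x => by
    rw [adm_grad hadm x, gg, smul_sub]; abel
  have gr : ∀ x : Pt, ‖x‖ < 2 * R → HasGradientAt (h.PsiR P δ R u) (gg Ω R W x) x := fun x hx => by
    have := Geo.PsiR_grad hp mu hPD hTD hR h4D hx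
    rwa [← hW, hgr] at this
  obtain ⟨z1, z2⟩ := Geo.zero_set hp hηδ hu cu fu (mono R r2 u mu)
  rw [← hW] at z1 z2
  refine ⟨W, h.PsiR P δ R u, gg Ω R W, oW, bW, W1, fun x hx => ?_, gg_cont mW WD hR h4D,
    fun α hα => gg_holder mW WD hR h4D hα, Eventually.of_forall fun x hx => ?_, ?_,
    fun x hx => gg_tan mW WD hR h4D hx, z1, fun x hx => ?_, fun x => ?_, fun x => ?_⟩
  · rw [mem_closedBall_zero_iff] at hx
    exact (gr x (by linarith)).hasFDerivAt.hasFDerivWithinAt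
  · rw [mem_ball_zero_iff] at hx
    exact gg_bs mW WD WR hR h4D hx.le
  · refine weak_form (q := h.PsiR P δ R u) (D := D + 1) (by linarith) (by linarith) oW W1
      (fun x hx => gr x ?_) ((gg_cont mW WD hR h4D).mono
        (closedBall_subset_closedBall (by linarith))) (fun x hx => ?_) (fun x hx => ?_)
    · rw [mem_closedBall_zero_iff] at hx
      linarith
    · rw [z1] at hx
      exact hx.2
    · rw [z1] at hx
      filter_upwards [(h.isOpen_tube hp.adm2).mem_nhds hx.1] with z hz hzW
      exact ((z2 z hz).1 hzW).le
  · rw [mem_ball_zero_iff] at hx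
    have t1 : ∫ y in ball (0 : Pt) R, |Set.indicator W 1 y - Set.indicator P 1 y| ≤ Cx * η :=
      (Geo.ind_int hp R mu).trans (chi δ hd5 hp.adm2 u (fun _ => 0) mu measurable_const
        (fun y => (hu y).trans hηδ.le) (fun y => by simpa using hδ0.le) η
        (fun y _ => by simpa using hu y))
    have t2 := bse P δ hp u mu bW η hη0 e4 e1 eδ hu x
    rw [← hW] at t2
    have t3 := norm_gpot_le mW WD hR h4D (x := x) (by linarith)
    have t4 : volume.real W ≤ volume.real (closedBall (0 : Pt) D) :=
      measureReal_mono WD isBounded_closedBall.measure_lt_top.ne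
    have t5 : Real.log (2 * η)⁻¹ ≤ 2 * Real.log R := by
      have : 2 * Real.log R = Real.log (R ^ 2) := by rw [Real.log_pow]; push_cast; ring
      rw [this]
      refine Real.log_le_log (by positivity) ?_
      rw [inv_le_comm₀ (by positivity) (by positivity), hη, inv_eq_one_div, ← mul_div_assoc]
      gcongr
      linarith
    have t6 : ‖gg Ω R W x - gradient Ψ x‖ ≤ ‖bs W x - bs P x‖ + ‖gpot R W x‖ := by
      rw [← hgr x, add_assoc, add_sub_cancel_left]
      refine (norm_add_le _ _).trans ?_
      gcongr
      rw [norm_smul, Real.norm_eq_abs, abs_of_pos (by positivity)]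
      exact mul_le_of_le_one_left (norm_nonneg _) pi_le_one
    calc _ ≤ Cx * η + (Cb * (2 * η * (1 + Real.log (2 * η)⁻¹)) + D / R ^ 2 * volume.real W) :=
          add_le_add t1 (t6.trans (add_le_add t2 t3))
      _ ≤ Cx * η * Real.log R + (Cb * (2 * η * (Real.log R + 2 * Real.log R)) +
          D / R ^ 2 * volume.real (closedBall (0 : Pt) D) * Real.log R) := by
          have s1 : Cx * η ≤ Cx * η * Real.log R := le_mul_of_one_le_right (by positivity) hlog
          have s2 : D / R ^ 2 * volume.real W ≤
              D / R ^ 2 * volume.real (closedBall (0 : Pt) D) * Real.log R := by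
            calc _ ≤ D / R ^ 2 * volume.real (closedBall (0 : Pt) D) := by gcongr
              _ ≤ _ := le_mul_of_one_le_right (by positivity) hlog
          have s3 : Cb * (2 * η * (1 + Real.log (2 * η)⁻¹)) ≤
              Cb * (2 * η * (Real.log R + 2 * Real.log R)) := by gcongr
          linarith
      _ = _ := by rw [hη]; field_simp; ring
  · exact ⟨(Geo.PsiR_inv hp (hsy reflE (by simp)) (su reflE (by simp)) R x).symm,
      (Geo.PsiR_inv hp (hsy (rotE (2 * π / m)) (by simp))
        (su (rotE (2 * π / m)) (by simp)) R x).symm⟩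
  · have i1 := Geo.WW_inv hp (hsy reflE (by simp)) (su reflE (by simp)) x
    have i2 := Geo.WW_inv hp (hsy (rotE (2 * π / m)) (by simp)) (su (rotE (2 * π / m)) (by simp)) x
    rw [reflE_apply, ← hW] at i1
    rw [rotE_apply, ← hW] at i2
    constructor
    · by_cases hx : x ∈ W
      · rw [Set.indicator_of_mem hx, Set.indicator_of_mem (i1.2 hx)]; rfl
      · rw [Set.indicator_of_notMem hx, Set.indicator_of_notMem (fun q => hx (i1.1 q))]
    · by_cases hx : x ∈ W
      · rw [Set.indicator_of_mem hx, Set.indicator_of_mem (i2.2 hx)]; rfl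
      · rw [Set.indicator_of_notMem hx, Set.indicator_of_notMem (fun q => hx (i2.1 q))]
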